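/- arXiv:math/0508011 — 2 statements merged into one kernel-verified Lean document; each statement's English description precedes it below -/
import Mathlib

section
/- For every n > 3 and p, q ≥ 1 with p + q < n, the tube manifold 𝒯_{p,q} ⊆ Matrix (Fin n) (Fin n) ℂ is path-connected and its fundamental group at any basepoint is isomorphic to ℤ/2 × ℤ/2: for every x ∈ 𝒯_{p,q} there is a group isomorphism FundamentalGroup 𝒯_{p,q} x ≃* (ZMod 2 × ZMod 2). -/
open Matrix

/-- The diagonal matrix `D_{p,q}` with `p` entries `1`, then `q` entries `−1`, then zeros. -/
def signatureDiag (n p q : ℕ) : Matrix (Fin n) (Fin n) ℝ :=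
  Matrix.diagonal (fun i => if (i : ℕ) < p then (1 : ℝ) else if (i : ℕ) < p + q then -1 else 0)

/-- The cone `𝒞_{p,q}` of real symmetric `n×n` matrices of signature `(p,q)`. -/
def sigCone (n p q : ℕ) : Set (Matrix (Fin n) (Fin n) ℝ) :=
  {x | ∃ g : Matrix (Fin n) (Fin n) ℝ, IsUnit g ∧ x = g * signatureDiag n p q * gᵀ}

/-- The tube manifold `𝒯_{p,q} = 𝒞_{p,q} ⊕ iV` of symmetric complex matrices `z`
whose real part `(z + z̄)/2` lies in `𝒞_{p,q}`. -/
def sigTube (n p q : ℕ) : Set (Matrix (Fin n) (Fin n) ℂ) :=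
  {z | zᵀ = z ∧
    (Matrix.of fun i j => ((z + z.map (starRingEnd ℂ)) i j).re / 2) ∈ sigCone n p q}

set_option linter.unusedSectionVars false

namespace TubeAux
open unitInterval Topology

/-- Building a homotopy of paths in a subset from an explicit continuous family. -/
theorem homotopic_of_family {Y : Type*} [TopologicalSpace Y] {S : Set Y} {a b : S}
    (γ γ' : Path a b) (H : I → I → Y) (hH : Continuous (fun p : I × I => H p.1 p.2))
    (hS : ∀ s t, H s t ∈ S)
    (h0 : ∀ t, H 0 t = γ t) (h1 : ∀ t, H 1 t = γ' t)
    (ha : ∀ s, H s 0 = a) (hb : ∀ s, H s 1 = b) :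
    Path.Homotopic γ γ' := by
  refine ⟨⟨⟨⟨fun p => ⟨H p.1 p.2, hS _ _⟩, ?_⟩, ?_, ?_⟩, ?_⟩⟩
  · exact Continuous.subtype_mk hH _
  · intro t; apply Subtype.ext; simpa using h0 t
  · intro t; apply Subtype.ext; simpa using h1 t
  · intro s t ht
    simp only [Set.mem_insert_iff, Set.mem_singleton_iff] at ht
    rcases ht with rfl | rfl
    · apply Subtype.ext; simpa using ha s
    · apply Subtype.ext; simpa using hb s

/-- The end of an explicit family gives a path homotopic to the start. -/
theorem exists_homotopic_of_family {Y : Type*} [TopologicalSpace Y] {S : Set Y} {a b : S}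
    (γ : Path a b) (H : I → I → Y) (hH : Continuous (fun p : I × I => H p.1 p.2))
    (hS : ∀ s t, H s t ∈ S)
    (h0 : ∀ t, H 0 t = γ t)
    (ha : ∀ s, H s 0 = a) (hb : ∀ s, H s 1 = b) :
    ∃ γ' : Path a b, Path.Homotopic γ γ' ∧ ∀ t, (γ' t : Y) = H 1 t := by
  let γ' : Path a b := ⟨⟨fun t => ⟨H 1 t, hS 1 t⟩, Continuous.subtype_mk
    (hH.comp (by fun_prop : Continuous fun t : I => ((1 : I), t))) _⟩,
    Subtype.ext (ha 1), Subtype.ext (hb 1)⟩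
  exact ⟨γ', homotopic_of_family γ γ' H hH hS h0 (fun t => rfl) ha hb, fun t => rfl⟩

variable {ι : Type*} [Fintype ι] [DecidableEq ι]

/-- Invertible real matrices. -/
def GLs (ι : Type*) [Fintype ι] [DecidableEq ι] : Set (Matrix ι ι ℝ) := {M | M.det ≠ 0}

theorem one_mem_GLs : (1 : Matrix ι ι ℝ) ∈ GLs ι := by simp [GLs]

theorem mul_mem_GLs {A B : Matrix ι ι ℝ} (hA : A ∈ GLs ι) (hB : B ∈ GLs ι) : A * B ∈ GLs ι := by
  simp only [GLs, Set.mem_ofPred_eq, det_mul] at *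
  exact mul_ne_zero hA hB

theorem joined_mul {A B A' B' : Matrix ι ι ℝ} (hA : JoinedIn (GLs ι) A A') (hB : JoinedIn (GLs ι) B B') :
    JoinedIn (GLs ι) (A * B) (A' * B') := by
  obtain ⟨γ, hγ⟩ := hA
  obtain ⟨δ, hδ⟩ := hB
  refine ⟨⟨⟨fun t => γ t * δ t, by fun_prop⟩, by simp, by simp⟩, fun t => ?_⟩
  exact mul_mem_GLs (hγ t) (hδ t)

theorem joined_transvection {i j : ι} (hij : i ≠ j) (a : ℝ) :
    JoinedIn (GLs ι) 1 (Matrix.transvection i j a) := by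
  refine ⟨⟨⟨fun t => Matrix.transvection i j ((t:ℝ) * a), ?_⟩, by simp, by simp⟩, fun t => ?_⟩
  · unfold Matrix.transvection
    refine continuous_const.add ?_
    refine continuous_matrix fun k l => ?_
    simp only [Matrix.single_apply]
    split_ifs <;> fun_prop
  · simp [GLs, Matrix.det_transvection_of_ne _ _ hij]

theorem diag2_eq {i j : ι} (hij : i ≠ j) {c : ℝ} (hc : c ≠ 0) :
    (diagonal (fun k ↦ if k = i then c else if k = j then c⁻¹ else 1) : Matrix ι ι ℝ) =
    Matrix.transvection i j c * Matrix.transvection j i (-c⁻¹) * Matrix.transvection i j c *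
    (Matrix.transvection i j (-1) * Matrix.transvection j i 1 * Matrix.transvection i j (-1)) := by
  have h : (diagonal (fun k ↦ if k = i then c else if k = j then c⁻¹ else 1) : Matrix ι ι ℝ) =
      1 + Matrix.single i i (c - 1) + Matrix.single j j (c⁻¹ - 1) := by
    ext k l
    simp only [diagonal_apply, Matrix.add_apply, Matrix.one_apply, Matrix.single_apply]
    by_cases hkl : k = l
    · subst hkl
      by_cases h1 : k = i
      · subst h1; simp [hij.symm]
      · by_cases h2 : k = j
        · subst h2; simp [h1, hij]
        · simp [h1, h2, Ne.symm h1, Ne.symm h2]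
    · simp only [hkl, if_false]
      have h1 : ¬ (i = k ∧ i = l) := by grind
      have h2 : ¬ (j = k ∧ j = l) := by grind
      simp [h1, h2]
  rw [h]
  unfold Matrix.transvection
  simp only [mul_add, add_mul, mul_one, one_mul, single_mul_single_same,
    single_mul_single_of_ne _ _ _ _ hij, single_mul_single_of_ne _ _ _ _ hij.symm, zero_mul, mul_zero]
  obtain ⟨F, e⟩ : ∃ F : ι → ι → Matrix ι ι ℝ, ∀ (a b : ι) (x : ℝ), Matrix.single a b x = x • F a b :=
    ⟨fun a b => Matrix.single a b 1, fun a b x => by rw [Matrix.smul_single]; simp⟩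
  simp only [e]
  simp only [mul_neg, neg_mul, mul_one, one_mul, mul_inv_cancel₀ hc, inv_mul_cancel₀ hc, neg_neg]
  module

theorem joined_one_of_det_eq_one (M : Matrix ι ι ℝ) (h : M.det = 1) : JoinedIn (GLs ι) 1 M := by
  rcases subsingleton_or_nontrivial ι with hs | hs
  · have : M = 1 := by
      rcases isEmpty_or_nonempty ι with he | ⟨⟨i⟩⟩
      · exact Subsingleton.elim _ _
      · rw [Matrix.det_eq_elem_of_subsingleton M i] at h
        ext a b
        rw [Subsingleton.elim a i, Subsingleton.elim b i, h]; simp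
    subst this
    exact JoinedIn.refl one_mem_GLs
  · refine Matrix.SpecialLinearGroup.diagonal_transvection_induction'
      (fun A : SpecialLinearGroup ι ℝ => JoinedIn (GLs ι) 1 A.1) ⟨M, h⟩ ?_ ?_ ?_
    · intro i j hij c hc
      rw [Matrix.SpecialLinearGroup.diag2n_coe, diag2_eq hij hc]
      have T := fun a => joined_transvection hij a
      have T' := fun a => joined_transvection hij.symm a
      simpa using joined_mul (joined_mul (joined_mul (T c) (T' (-c⁻¹))) (T c))
        (joined_mul (joined_mul (T (-1)) (T' 1)) (T (-1)))
    · intro i j hij a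
      exact joined_transvection hij a
    · intro A B hA hB
      simpa using joined_mul hA hB

theorem joined_one_of_det_pos (M : Matrix ι ι ℝ) (h : 0 < M.det) : JoinedIn (GLs ι) 1 M := by
  rcases isEmpty_or_nonempty ι with he | hne
  · rw [Subsingleton.elim M 1]; exact JoinedIn.refl one_mem_GLs
  set c : ℝ := (M.det) ^ (-(1 / (Fintype.card ι : ℝ))) with hc
  have hcp : 0 < c := Real.rpow_pos_of_pos h _
  have hn : (Fintype.card ι : ℝ) ≠ 0 := by simp
  have hd : (c • M).det = 1 := by
    rw [det_smul, hc, ← Real.rpow_natCast, ← Real.rpow_mul h.le]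
    have : -(1 / (Fintype.card ι : ℝ)) * (Fintype.card ι : ℝ) = -1 := by field_simp
    rw [this, Real.rpow_neg_one, inv_mul_cancel₀ h.ne']
  refine (joined_one_of_det_eq_one _ hd).trans ?_
  refine ⟨⟨⟨fun t => ((1 - (t:ℝ)) * c + t) • M, by fun_prop⟩, by simp, by simp⟩, fun t => ?_⟩
  have hpos : 0 < (1 - (t:ℝ)) * c + t := by
    rcases eq_or_lt_of_le t.2.2 with h1 | h1
    · simp [h1]
    · have := t.2.1
      have : 0 < (1 - (t:ℝ)) * c := mul_pos (by linarith) hcp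
      linarith
  simp only [GLs, Set.mem_ofPred_eq, Path.coe_mk_mk, det_smul]
  positivity

end TubeAux

namespace TubeAux
open unitInterval Topology
section loops
variable {ι : Type*} [Fintype ι] [DecidableEq ι]

theorem continuous_matInv {X : Type*} [TopologicalSpace X] {f : X → Matrix ι ι ℝ}
    (hf : Continuous f) (h : ∀ x, (f x).det ≠ 0) : Continuous (fun x => (f x)⁻¹) := by
  simp only [Matrix.inv_def, Ring.inverse_eq_inv']
  exact (hf.matrix_det.inv₀ h).smul hf.matrix_adjugate

theorem det_one_add_vecMulVec (x y : ι → ℝ) : (1 + vecMulVec x y).det = 1 + y ⬝ᵥ x := by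
  rw [vecMulVec_eq Unit, det_one_add_replicateCol_mul_replicateRow]

/-- `M` has standard rows and columns at the indices in `L`. -/
def Fixes (L : Finset ι) (M : Matrix ι ι ℝ) : Prop :=
  ∀ l ∈ L, M *ᵥ Pi.single l 1 = Pi.single l 1 ∧ Pi.single l 1 ᵥ* M = Pi.single l 1

theorem Fixes.mul {L : Finset ι} {A B : Matrix ι ι ℝ} (hA : Fixes L A) (hB : Fixes L B) :
    Fixes L (A * B) := by
  intro l hl
  constructor
  · rw [← mulVec_mulVec, (hB l hl).1, (hA l hl).1]
  · rw [← vecMul_vecMul, (hA l hl).2, (hB l hl).2]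

theorem Fixes.inv {L : Finset ι} {A : Matrix ι ι ℝ} (hA : Fixes L A) (h : A.det ≠ 0) :
    Fixes L (A⁻¹) := by
  have hu : IsUnit A.det := isUnit_iff_ne_zero.2 h
  intro l hl
  constructor
  · conv_lhs => rw [← (hA l hl).1]
    rw [mulVec_mulVec, nonsing_inv_mul _ hu, one_mulVec]
  · conv_lhs => rw [← (hA l hl).2]
    rw [vecMul_vecMul, mul_nonsing_inv _ hu, vecMul_one]

theorem Fixes.one (L : Finset ι) : Fixes L (1 : Matrix ι ι ℝ) := by
  intro l hl; exact ⟨one_mulVec _, vecMul_one _⟩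

theorem Fixes.one_add {L : Finset ι} {x y : ι → ℝ} (hx : ∀ l ∈ L, x l = 0) (hy : ∀ l ∈ L, y l = 0) :
    Fixes L (1 + vecMulVec x y) := by
  intro l hl
  constructor
  · rw [add_mulVec, one_mulVec, vecMulVec_mulVec]; simp [hy l hl]
  · rw [vecMul_add, vecMul_one, vecMul_vecMulVec]; simp [hx l hl]

abbrev oneG (ι : Type*) [Fintype ι] [DecidableEq ι] : GLs ι := ⟨1, one_mem_GLs⟩

theorem loop_update {L : Finset ι} (γ : Path (oneG ι) (oneG ι)) (hγ : ∀ t, Fixes L (γ t).1)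
    {i : ι} (hi : i ∉ L) (y φ : I → ι → ℝ) (hyc : Continuous y) (hφc : Continuous φ)
    (hyL : ∀ t, ∀ l ∈ L, y t l = 0) (hφL : ∀ t, ∀ l ∈ L, φ t l = 0)
    (hy01 : y 0 = y 1) (hφ01 : φ 0 = φ 1)
    (hφx : ∀ t, φ t ⬝ᵥ ((γ t).1 *ᵥ Pi.single i 1) = 1) (hφy : ∀ t, 0 < φ t ⬝ᵥ y t) :
    ∃ γ' : Path (oneG ι) (oneG ι), Path.Homotopic γ γ' ∧ (∀ t, Fixes L (γ' t).1) ∧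
      ∃ R : Matrix ι ι ℝ, R.det ≠ 0 ∧ R *ᵥ Pi.single i 1 = y 0 ∧
        ∀ t, R *ᵥ ((γ' t).1 *ᵥ Pi.single i 1) = y t := by
  set e : ι → ℝ := Pi.single i 1 with he
  set x : I → ι → ℝ := fun t => (γ t).1 *ᵥ e with hx
  have hxc : Continuous x := by
    have : Continuous (fun t => (γ t).1) := by fun_prop
    exact this.matrix_mulVec continuous_const
  have hxL : ∀ t, ∀ l ∈ L, x t l = 0 := by
    intro t l hl
    have : x t l = Pi.single l 1 ⬝ᵥ ((γ t).1 *ᵥ e) := by simp [hx]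
    rw [this, dotProduct_mulVec, (hγ t l hl).2]
    have : i ≠ l := fun h => hi (h ▸ hl)
    simp [he, this.symm]
  let R : ℝ → I → Matrix ι ι ℝ := fun s t => 1 + vecMulVec (s • (y t - x t)) (φ t)
  have hRdet : ∀ s : I, ∀ t, 0 < (R s t).det := by
    intro s t
    simp only [R]
    rw [det_one_add_vecMulVec, dotProduct_smul, dotProduct_sub]
    have h1 := hφx t
    have h2 := hφy t
    have h1' : φ t ⬝ᵥ x t = 1 := h1
    rw [h1', smul_eq_mul]
    have := s.2.1
    have := s.2.2
    rcases eq_or_lt_of_le s.2.1 with h | h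
    · rw [← h]; norm_num
    · nlinarith
  have hRF : ∀ s : I, ∀ t, Fixes L (R s t) := by
    intro s t
    refine Fixes.one_add (fun l hl => ?_) (hφL t)
    simp [hyL t l hl, hxL t l hl]
  have hRc : Continuous (fun p : I × I => R p.1 p.2) := by
    simp only [R]
    refine continuous_const.add (Continuous.matrix_vecMulVec ?_ (by fun_prop))
    exact (by fun_prop : Continuous fun p : I × I => (p.1 : ℝ) • (y p.2 - x p.2))
  have hR1 : ∀ s : I, R s 1 = R s 0 := by
    intro s
    simp only [R, hx, hy01, hφ01, γ.source, γ.target]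
  have key : ∃ γ' : Path (oneG ι) (oneG ι), Path.Homotopic γ γ' ∧
      ∀ t, (γ' t).1 = (R (1 : I) 0)⁻¹ * R (1 : I) t * (γ t).1 := by
    refine exists_homotopic_of_family γ (fun s t => (R s 0)⁻¹ * R s t * (γ t).1) ?_ ?_ ?_ ?_ ?_
    · refine Continuous.mul (Continuous.mul ?_ hRc) (by fun_prop)
      exact continuous_matInv (f := fun p : I × I => R p.1 0)
        (hRc.comp (Continuous.prodMk continuous_fst continuous_const))
        (fun p => (hRdet p.1 0).ne')
    · intro s t
      refine mul_mem_GLs (mul_mem_GLs ?_ (hRdet s t).ne') (γ t).2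
      simp only [GLs, Set.mem_ofPred_eq, det_nonsing_inv, Ring.inverse_eq_inv']
      exact inv_ne_zero (hRdet s 0).ne'
    · intro t
      simp [R]
    · intro s
      rw [nonsing_inv_mul _ (isUnit_iff_ne_zero.2 (hRdet s 0).ne')]; simp
    · intro s
      rw [hR1, nonsing_inv_mul _ (isUnit_iff_ne_zero.2 (hRdet s 0).ne')]; simp
  obtain ⟨γ', hh, hγ'⟩ := key
  refine ⟨γ', hh, ?_, R (1 : I) 0, (hRdet 1 0).ne', ?_, ?_⟩
  · intro t
    rw [hγ']
    exact (((hRF 1 0).inv (hRdet 1 0).ne').mul (hRF 1 t)).mul (hγ t)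
  · have := hφx 0
    simp only [R, add_mulVec, one_mulVec, vecMulVec_mulVec]
    have h0 : (γ 0).1 = 1 := by rw [γ.source]
    rw [h0, one_mulVec] at this
    simp [this, hx]
  · intro t
    rw [hγ', mulVec_mulVec, ← mul_assoc, ← mul_assoc]
    have h1 : IsUnit (R (1 : I) 0).det := isUnit_iff_ne_zero.2 (hRdet 1 0).ne'
    rw [mul_nonsing_inv _ h1, one_mul, ← mulVec_mulVec]
    simp only [R, add_mulVec, one_mulVec, vecMulVec_mulVec, hφx t]
    simp [hx]

end loops
end TubeAux

namespace TubeAux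
open unitInterval Topology
section loops2
variable {ι : Type*} [Fintype ι] [DecidableEq ι]

theorem poly_approx (f : I → ℝ) (hf : Continuous f) (ε : ℝ) (hε : 0 < ε) :
    ∃ p : Polynomial ℝ, p.eval 0 = f 0 ∧ p.eval 1 = f 1 ∧ ∀ t : I, |p.eval (t : ℝ) - f t| < ε := by
  obtain ⟨q, hq⟩ := exists_polynomial_near_continuousMap 0 1 ⟨f, hf⟩ (ε / 3) (by positivity)
  have hq' : ∀ t : I, |q.eval (t : ℝ) - f t| < ε / 3 := by
    intro t
    have := ContinuousMap.norm_coe_le_norm (q.toContinuousMapOn (Set.Icc (0:ℝ) 1) - ⟨f, hf⟩) t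
    refine lt_of_le_of_lt ?_ hq
    simpa using this
  refine ⟨q + Polynomial.C (f 0 - q.eval 0) * (1 - Polynomial.X) + Polynomial.C (f 1 - q.eval 1) * Polynomial.X, by simp, by simp, ?_⟩
  intro t
  have h0 := hq' 0
  have h1 := hq' 1
  have ht := hq' t
  simp only [Set.Icc.coe_zero, Set.Icc.coe_one] at h0 h1
  have t0 := t.2.1
  have t1 := t.2.2
  simp only [Polynomial.eval_add, Polynomial.eval_mul, Polynomial.eval_C, Polynomial.eval_sub, Polynomial.eval_one, Polynomial.eval_X]
  rw [abs_lt] at *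
  constructor <;> nlinarith

theorem vec_approx (L : Finset ι) (x : I → ι → ℝ) (hx : Continuous x) (h01 : x 0 = x 1)
    (hL : ∀ t, ∀ l ∈ L, x t l = 0) (hne : ∀ t, x t ≠ 0) :
    ∃ y : ℝ → ι → ℝ, ContDiff ℝ 1 y ∧ y 0 = x 0 ∧ y 1 = x 0 ∧ (∀ t, ∀ l ∈ L, y t l = 0) ∧
      ∀ t : I, 0 < x t ⬝ᵥ y t := by
  have hpos : ∀ t, 0 < x t ⬝ᵥ x t := by
    intro t
    have : x t ⬝ᵥ x t ≠ 0 := by simpa using hne t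
    exact lt_of_le_of_ne (Finset.sum_nonneg fun i _ => mul_self_nonneg _) this.symm
  have hs : ∀ t, 0 < 1 + ∑ k, |x t k| := fun t => by positivity
  obtain ⟨t0, -, ht0⟩ := isCompact_univ.exists_isMinOn (s := (Set.univ : Set I)) ⟨0, trivial⟩
    (f := fun t => (x t ⬝ᵥ x t) / (1 + ∑ k, |x t k|)) (by
      refine Continuous.continuousOn (Continuous.div (hx.dotProduct hx) ?_ (fun t => (hs t).ne'))
      fun_prop)
  set ε := (x t0 ⬝ᵥ x t0) / (1 + ∑ k, |x t0 k|) with hεd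
  have hε : 0 < ε := div_pos (hpos _) (hs _)
  have : ∀ k, ∃ p : Polynomial ℝ, p.eval 0 = x 0 k ∧ p.eval 1 = x 0 k ∧ (k ∈ L → p = 0) ∧
      ∀ t : I, |p.eval (t : ℝ) - x t k| < ε := by
    intro k
    by_cases hk : k ∈ L
    · refine ⟨0, ?_, ?_, fun _ => rfl, ?_⟩
      · simp [hL _ k hk]
      · simp [hL _ k hk]
      · intro t; simpa [hL _ k hk] using hε
    · obtain ⟨p, h0, h1, h⟩ := poly_approx (fun t => x t k) (by fun_prop) ε hε
      exact ⟨p, h0, by rw [h1, h01], fun h => absurd h hk, h⟩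
  choose p h0 h1 hpL hp using this
  refine ⟨fun t k => (p k).eval t, ?_, ?_, ?_, ?_, ?_⟩
  · rw [contDiff_pi]
    intro k
    simpa using (p k).contDiff_aeval (𝕜 := ℝ) 1
  · ext k; exact h0 k
  · ext k; exact h1 k
  · intro t l hl; simp [hpL l hl]
  · intro t
    have e1 : (x t ⬝ᵥ fun k => (p k).eval (t:ℝ)) = x t ⬝ᵥ x t + ∑ k, x t k * ((p k).eval (t:ℝ) - x t k) := by
      simp only [dotProduct, ← Finset.sum_add_distrib]
      refine Finset.sum_congr rfl fun k _ => by ring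
    have e2 : |∑ k, x t k * ((p k).eval (t:ℝ) - x t k)| ≤ (∑ k, |x t k|) * ε := by
      refine (Finset.abs_sum_le_sum_abs _ _).trans ?_
      rw [Finset.sum_mul]
      refine Finset.sum_le_sum fun k _ => ?_
      rw [abs_mul]
      exact mul_le_mul_of_nonneg_left (hp k t).le (abs_nonneg _)
    have e3 : ε ≤ (x t ⬝ᵥ x t) / (1 + ∑ k, |x t k|) := ht0 (Set.mem_univ t)
    rw [le_div_iff₀ (hs t)] at e3
    rw [e1]
    have := (abs_le.1 e2).1
    nlinarith

theorem avoid_line (L : Finset ι) (hL : L.card + 3 ≤ Fintype.card ι) (y : ℝ → ι → ℝ) (hy : ContDiff ℝ 1 y) :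
    ∃ v : ι → ℝ, (∀ l ∈ L, v l = 0) ∧ ∀ t (c : ℝ), v ≠ c • y t := by
  let f : ℝ × ℝ → ({i // i ∉ L} → ℝ) := fun p i => p.2 * y p.1 i
  have hf : ContDiff ℝ 1 f := by
    rw [contDiff_pi]
    intro i
    have : ContDiff ℝ 1 (fun t => y t i) := contDiff_pi.1 hy i
    exact contDiff_snd.mul (this.comp contDiff_fst)
  have hd := ContDiff.dense_compl_range_of_finrank_lt_finrank hf (by
    simp only [Module.finrank_prod, Module.finrank_self, Module.finrank_fintype_fun_eq_card]
    rw [Fintype.card_subtype_compl]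
    simp
    omega)
  obtain ⟨v, hv⟩ := hd.nonempty
  refine ⟨fun i => if h : i ∉ L then v ⟨i, h⟩ else 0, ?_, ?_⟩
  · intro l hl; simp [hl]
  · intro t c h
    apply hv
    refine ⟨(t, c), ?_⟩
    ext i
    have := congrFun h i
    simp only [i.2, not_false_eq_true, dif_pos, Pi.smul_apply, smul_eq_mul] at this
    simp only [f]
    exact this.symm

theorem strict_cs {y v : ι → ℝ} (hy : y ≠ 0) (h : ∀ c : ℝ, v ≠ c • y) :
    0 < (y ⬝ᵥ y) * (v ⬝ᵥ v) - (y ⬝ᵥ v) ^ 2 := by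
  have hpos : ∀ u : ι → ℝ, u ≠ 0 → 0 < u ⬝ᵥ u := by
    intro u hu
    have : u ⬝ᵥ u ≠ 0 := by simpa using hu
    exact lt_of_le_of_ne (Finset.sum_nonneg fun i _ => mul_self_nonneg _) this.symm
  have h1 := hpos y hy
  have h2 : 0 < ((y ⬝ᵥ y) • v - (y ⬝ᵥ v) • y) ⬝ᵥ ((y ⬝ᵥ y) • v - (y ⬝ᵥ v) • y) := by
    apply hpos
    intro h0
    apply h ((y ⬝ᵥ v) / (y ⬝ᵥ y))
    rw [sub_eq_zero] at h0
    rw [div_eq_inv_mul, mul_smul, ← h0, smul_smul, inv_mul_cancel₀ h1.ne', one_smul]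
  simp only [sub_dotProduct, dotProduct_sub, smul_dotProduct, dotProduct_smul, smul_eq_mul, dotProduct_comm v y] at h2
  have h3 : 0 < (y ⬝ᵥ y) * ((y ⬝ᵥ y) * (v ⬝ᵥ v) - (y ⬝ᵥ v) ^ 2) := by nlinarith
  exact pos_of_mul_pos_right h3 h1.le

theorem loop_column {L : Finset ι} (hL : L.card + 3 ≤ Fintype.card ι)
    (γ : Path (oneG ι) (oneG ι)) (hγ : ∀ t, Fixes L (γ t).1) {i : ι} (hi : i ∉ L) :
    ∃ γ' : Path (oneG ι) (oneG ι), Path.Homotopic γ γ' ∧ (∀ t, Fixes L (γ' t).1) ∧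
      ∀ t, (γ' t).1 *ᵥ Pi.single i 1 = Pi.single i 1 := by
  have hcol : ∀ (δ : Path (oneG ι) (oneG ι)), (∀ t, Fixes L (δ t).1) →
      Continuous (fun t => (δ t).1 *ᵥ (Pi.single i 1 : ι → ℝ)) ∧
      (∀ t, ∀ l ∈ L, ((δ t).1 *ᵥ (Pi.single i 1 : ι → ℝ)) l = 0) ∧
      ∀ t, (δ t).1 *ᵥ (Pi.single i 1 : ι → ℝ) ≠ 0 := by
    intro δ hδ
    refine ⟨?_, ?_, ?_⟩
    · have : Continuous (fun t => (δ t).1) := by fun_prop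
      exact this.matrix_mulVec continuous_const
    · intro t l hl
      have : ((δ t).1 *ᵥ (Pi.single i 1 : ι → ℝ)) l = Pi.single l 1 ⬝ᵥ ((δ t).1 *ᵥ (Pi.single i 1 : ι → ℝ)) := by
        rw [single_one_dotProduct]
      rw [this, dotProduct_mulVec, (hδ t l hl).2]
      have : i ≠ l := fun h => hi (h ▸ hl)
      simp [this.symm]
    · intro t h0
      have h1 := Matrix.eq_zero_of_mulVec_eq_zero (δ t).2 h0
      have := congrFun h1 i
      simp at this
  obtain ⟨hxc, hxL, hx0⟩ := hcol γ hγ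
  set x : I → ι → ℝ := fun t => (γ t).1 *ᵥ (Pi.single i 1 : ι → ℝ) with hx
  have hx00 : x 0 = Pi.single i 1 := by simp only [hx, γ.source, one_mulVec]
  have hx01 : x 0 = x 1 := by simp only [hx, γ.source, γ.target]
  have hpos : ∀ u : ι → ℝ, u ≠ 0 → 0 < u ⬝ᵥ u := by
    intro u hu
    have : u ⬝ᵥ u ≠ 0 := by simpa using hu
    exact lt_of_le_of_ne (Finset.sum_nonneg fun i _ => mul_self_nonneg _) this.symm
  obtain ⟨y, hyd, hy0, hy1, hyL, hxy⟩ := vec_approx L x hxc hx01 hxL hx0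
  have hyc : Continuous (fun t : I => y t) := hyd.continuous.comp continuous_subtype_val
  obtain ⟨γ₁, hh₁, hF₁, R, hR, hR0, hRt⟩ := loop_update γ hγ hi (fun t => y t)
    (fun t => (x t ⬝ᵥ x t)⁻¹ • x t) hyc
    (Continuous.smul ((hxc.dotProduct hxc).inv₀ fun t => (hpos _ (hx0 t)).ne') hxc)
    (fun t => hyL t) (fun t l hl => by
      have : x t l = 0 := hxL t l hl
      rw [Pi.smul_apply, this, smul_zero])
    (by simp [hy0, hy1]) (by simp only [hx01])
    (fun t => by rw [smul_dotProduct, smul_eq_mul]; exact inv_mul_cancel₀ (hpos _ (hx0 t)).ne')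
    (fun t => by
      rw [smul_dotProduct, smul_eq_mul]
      exact mul_pos (inv_pos.2 (hpos _ (hx0 t))) (hxy t))
  obtain ⟨hzc, hzL, hz0⟩ := hcol γ₁ hF₁
  -- the new column is `R⁻¹ y`, which is again smooth
  set z : ℝ → ι → ℝ := fun t => R⁻¹ *ᵥ y t with hz
  have hRu : IsUnit R.det := isUnit_iff_ne_zero.2 hR
  have hzt : ∀ t : I, (γ₁ t).1 *ᵥ (Pi.single i 1 : ι → ℝ) = z t := by
    intro t
    rw [hz]
    simp only
    rw [← hRt t, mulVec_mulVec, nonsing_inv_mul _ hRu, one_mulVec]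
  have hzd : ContDiff ℝ 1 z := by
    exact (Matrix.mulVecLin R⁻¹).toContinuousLinearMap.contDiff.comp hyd
  obtain ⟨v, hvL, hv⟩ := avoid_line L hL z hzd
  have hΔ : ∀ t : I, 0 < (z t ⬝ᵥ z t) * (v ⬝ᵥ v) - (z t ⬝ᵥ v) ^ 2 := fun t =>
    strict_cs (by rw [← hzt]; exact hz0 t) (hv t)
  have hzc' : Continuous (fun t : I => z t) := hzd.continuous.comp continuous_subtype_val
  have h01 : z (1 : I) = z (0 : I) := by rw [← hzt, ← hzt, γ₁.source, γ₁.target]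
  obtain ⟨γ₂, hh₂, hF₂, R', hR', hR0', hRt'⟩ := loop_update γ₁ hF₁ hi (fun _ => v)
    (fun t => ((z t ⬝ᵥ z t) * (v ⬝ᵥ v) - (z t ⬝ᵥ v) ^ 2)⁻¹ •
      ((v ⬝ᵥ v - z t ⬝ᵥ v) • z t + (z t ⬝ᵥ z t - z t ⬝ᵥ v) • v)) continuous_const
    (by
      have c1 := hzc'.dotProduct hzc'
      have c2 := hzc'.dotProduct (continuous_const (y := v))
      refine Continuous.smul (Continuous.inv₀ (by fun_prop) fun t => (hΔ t).ne') (by fun_prop))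
    (fun t => hvL)
    (fun t l hl => by
      have : z t l = 0 := by rw [← hzt]; exact hzL t l hl
      simp [hvL l hl, this])
    rfl (by simp only [h01])
    (fun t => by
      rw [hzt, smul_dotProduct, add_dotProduct, smul_dotProduct, smul_dotProduct, smul_eq_mul,
        inv_mul_eq_one₀ (hΔ t).ne', dotProduct_comm v (z t)]
      simp only [smul_eq_mul]; ring)
    (fun t => by
      have : 1 = (((z t ⬝ᵥ z t) * (v ⬝ᵥ v) - (z t ⬝ᵥ v) ^ 2)⁻¹ •
        ((v ⬝ᵥ v - z t ⬝ᵥ v) • z t + (z t ⬝ᵥ z t - z t ⬝ᵥ v) • v)) ⬝ᵥ v := by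
        symm
        rw [smul_dotProduct, add_dotProduct, smul_dotProduct, smul_dotProduct, smul_eq_mul,
          inv_mul_eq_one₀ (hΔ t).ne']
        simp only [smul_eq_mul]; ring
      rw [← this]; exact one_pos)
  refine ⟨γ₂, hh₁.trans hh₂, hF₂, fun t => ?_⟩
  have h1 : R' *ᵥ ((γ₂ t).1 *ᵥ Pi.single i 1) = R' *ᵥ Pi.single i 1 := by rw [hRt', hR0']
  have h2 := congrArg (fun u => R'⁻¹ *ᵥ u) h1
  have hRu' : IsUnit R'.det := isUnit_iff_ne_zero.2 hR'
  simpa only [mulVec_mulVec, nonsing_inv_mul _ hRu', one_mulVec, ← mul_assoc, one_mul] using h2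

theorem loop_row {L : Finset ι}
    (γ : Path (oneG ι) (oneG ι)) (hγ : ∀ t, Fixes L (γ t).1) {i : ι} (hi : i ∉ L)
    (hcol : ∀ t, (γ t).1 *ᵥ Pi.single i 1 = Pi.single i 1) :
    ∃ γ' : Path (oneG ι) (oneG ι), Path.Homotopic γ γ' ∧ (∀ t, Fixes (insert i L) (γ' t).1) := by
  set e : ι → ℝ := Pi.single i 1 with he
  set ρ : I → ι → ℝ := fun t => e ᵥ* (γ t).1 - e with hρ
  have hρc : Continuous ρ := by
    have : Continuous (fun t => (γ t).1) := by fun_prop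
    exact (Continuous.matrix_vecMul continuous_const this).sub continuous_const
  have hρe : ∀ t, ρ t ⬝ᵥ e = 0 := by
    intro t
    rw [hρ]; simp only
    rw [sub_dotProduct, ← dotProduct_mulVec, hcol t, sub_self]
  have hρL : ∀ t, ∀ l ∈ L, ρ t l = 0 := by
    intro t l hl
    have hil : i ≠ l := fun h => hi (h ▸ hl)
    have : ρ t l = ρ t ⬝ᵥ Pi.single l 1 := by simp
    rw [this, hρ]; simp only
    rw [sub_dotProduct, ← dotProduct_mulVec, (hγ t l hl).1, sub_self]
  have heL : ∀ l ∈ L, e l = 0 := by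
    intro l hl
    have hil : i ≠ l := fun h => hi (h ▸ hl)
    simp [he, hil.symm]
  -- γ (1 - s e ρ)
  have key : ∃ γ' : Path (oneG ι) (oneG ι), Path.Homotopic γ γ' ∧
      ∀ t, (γ' t).1 = (γ t).1 * (1 + vecMulVec (-((1 : I) : ℝ) • e) (ρ t)) := by
    refine exists_homotopic_of_family γ
      (fun s t => (γ t).1 * (1 + vecMulVec (-(s : ℝ) • e) (ρ t))) ?_ ?_ ?_ ?_ ?_
    · refine Continuous.mul (by fun_prop) (continuous_const.add (Continuous.matrix_vecMulVec ?_ (by fun_prop)))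
      exact (by fun_prop : Continuous fun p : I × I => -(p.1 : ℝ) • e)
    · intro s t
      refine mul_mem_GLs (γ t).2 ?_
      simp only [GLs, Set.mem_ofPred_eq]
      rw [det_one_add_vecMulVec, dotProduct_smul, hρe]; simp
    · intro t; simp [zero_vecMulVec]
    · intro s; simp [hρ]
    · intro s; simp [hρ]
  obtain ⟨γ', hh, hγ'⟩ := key
  refine ⟨γ', hh, fun t => ?_⟩
  have hF : Fixes L (γ' t).1 := by
    rw [hγ']
    exact (hγ t).mul (Fixes.one_add (fun l hl => by simp [heL l hl]) (hρL t))
  intro l hl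
  rcases Finset.mem_insert.1 hl with rfl | hl
  · rw [hγ', ← he]
    constructor
    · rw [← mulVec_mulVec, add_mulVec, one_mulVec, vecMulVec_mulVec, hρe]; simpa using hcol t
    · rw [← vecMul_vecMul, vecMul_add, vecMul_one, vecMul_vecMulVec, ← dotProduct_mulVec, mulVec_smul, hcol t]
      simp [he, hρ]
  · exact hF l hl

theorem loop_reduce {i j : ι} (hij : i ≠ j) (γ : Path (oneG ι) (oneG ι)) :
    ∃ γ' : Path (oneG ι) (oneG ι), Path.Homotopic γ γ' ∧
      ∀ t, ∀ l, l ≠ i → l ≠ j → ∀ k, k ≠ l → (γ' t).1 k l = 0 ∧ (γ' t).1 l k = 0 := by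
  have key : ∀ L : Finset ι, i ∉ L → j ∉ L →
      ∃ γ' : Path (oneG ι) (oneG ι), Path.Homotopic γ γ' ∧ (∀ t, Fixes L (γ' t).1) := by
    intro L
    induction L using Finset.induction_on with
    | empty => exact fun _ _ => ⟨γ, Path.Homotopic.refl _, fun t l hl => by simp at hl⟩
    | insert l L hl ih =>
      intro h1 h2
      simp only [Finset.mem_insert, not_or] at h1 h2
      obtain ⟨γ₁, hh₁, hF₁⟩ := ih h1.2 h2.2
      have hc : L.card + 3 ≤ Fintype.card ι := by
        have h3 : (insert i (insert j (insert l L))).card = L.card + 3 := by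
          rw [Finset.card_insert_of_notMem, Finset.card_insert_of_notMem, Finset.card_insert_of_notMem hl]
          · simp [h2.1, h2.2]
          · simp [h1.1, h1.2, hij]
        rw [← h3]; exact Finset.card_le_univ _
      obtain ⟨γ₂, hh₂, hF₂, hcol⟩ := loop_column hc γ₁ hF₁ hl
      obtain ⟨γ₃, hh₃, hF₃⟩ := loop_row γ₂ hF₂ hl hcol
      exact ⟨γ₃, (hh₁.trans hh₂).trans hh₃, hF₃⟩
  obtain ⟨γ', hh, hF⟩ := key (Finset.univ.filter fun l => l ≠ i ∧ l ≠ j) (by simp) (by simp)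
  refine ⟨γ', hh, fun t l hli hlj k hk => ?_⟩
  obtain ⟨h1, h2⟩ := hF t l (by simp [hli, hlj])
  constructor
  · have := congrFun h1 k
    simpa [hk] using this
  · have := congrFun h2 k
    simpa [hk] using this

end loops2
end TubeAux

namespace TubeAux
open unitInterval Topology
section orbit
variable {ι : Type*} [Fintype ι] [DecidableEq ι]

/-- positive definite matrices on the coordinates in `P`, extended by zero. -/
def Qs (P : ι → Prop) (A : Matrix ι ι ℝ) : Prop :=
  Aᵀ = A ∧ (∀ i j, ¬ P i → A i j = 0) ∧ ∀ x : ι → ℝ, (∃ i, P i ∧ x i ≠ 0) → 0 < x ⬝ᵥ (A *ᵥ x)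

/-- matrices preserving the span of the coordinates in `P`. -/
def Ks (P : ι → Prop) (k : Matrix ι ι ℝ) : Prop := ∀ i j, P j → ¬ P i → k i j = 0

theorem Ks.mul {P : ι → Prop} {k l : Matrix ι ι ℝ} (hk : Ks P k) (hl : Ks P l) : Ks P (k * l) := by
  intro i j hj hi
  rw [Matrix.mul_apply]
  refine Finset.sum_eq_zero fun a _ => ?_
  by_cases ha : P a
  · rw [hk i a ha hi, zero_mul]
  · rw [hl a j hj ha, mul_zero]

theorem Ks.inv {P : ι → Prop} {k : Matrix ι ι ℝ} (hk : Ks P k) (h : k.det ≠ 0) : Ks P k⁻¹ := by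
  classical
  have hb : k.BlockTriangular (fun i => if P i then 0 else 1) := by
    intro i j hij
    by_cases hi : P i <;> by_cases hj : P j <;> simp [hi, hj] at hij
    exact hk i j hj hi
  have : Invertible k := Matrix.invertibleOfIsUnitDet k (isUnit_iff_ne_zero.2 h)
  have := blockTriangular_inv_of_blockTriangular hb
  intro i j hj hi
  exact this (by simp [hi, hj])

theorem Ks.one (P : ι → Prop) : Ks P (1 : Matrix ι ι ℝ) := by
  intro i j hj hi
  have : i ≠ j := by rintro rfl; exact hi hj
  simp [this]

theorem quad_conj (k A : Matrix ι ι ℝ) (x : ι → ℝ) :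
    x ⬝ᵥ ((k * A * kᵀ) *ᵥ x) = (x ᵥ* k) ⬝ᵥ (A *ᵥ (x ᵥ* k)) := by
  rw [← mulVec_mulVec, ← mulVec_mulVec, dotProduct_mulVec, mulVec_transpose]

theorem Qs.conj {P : ι → Prop} {k A : Matrix ι ι ℝ} (hA : Qs P A) (hk : Ks P k) (h : k.det ≠ 0) :
    Qs P (k * A * kᵀ) := by
  obtain ⟨h1, h2, h3⟩ := hA
  refine ⟨?_, ?_, ?_⟩
  · simp [h1, mul_assoc]
  · intro i j hi
    rw [Matrix.mul_assoc, Matrix.mul_apply]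
    refine Finset.sum_eq_zero fun a _ => ?_
    by_cases ha : P a
    · rw [hk i a ha hi, zero_mul]
    · rw [Matrix.mul_apply, Finset.sum_eq_zero, mul_zero]
      intro b _
      rw [h2 a b ha, zero_mul]
  · rintro x ⟨i, hi, hx⟩
    rw [quad_conj]
    apply h3
    by_contra hcon
    push Not at hcon
    apply hx
    have : x = (x ᵥ* k) ᵥ* k⁻¹ := by
      rw [vecMul_vecMul, mul_nonsing_inv _ (isUnit_iff_ne_zero.2 h), vecMul_one]
    rw [this]
    simp only [vecMul, dotProduct] at hcon ⊢
    refine Finset.sum_eq_zero fun a _ => ?_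
    by_cases ha : P a
    · rw [hcon a ha, zero_mul]
    · rw [hk.inv h a i hi ha, mul_zero]

theorem Ks_of_conj {P : ι → Prop} {k A B : Matrix ι ι ℝ} (hA : Qs P A) (hB : Qs P B)
    (h : k * A * kᵀ = B) : Ks P k := by
  intro i j hj hi
  by_contra hne
  have h1 := hA.2.2 (k i) ⟨j, hj, hne⟩
  have h2 : B i i = 0 := hB.2.1 i i hi
  have h3 := quad_conj k A (Pi.single i 1)
  rw [h] at h3
  simp only [single_one_dotProduct, mulVec_single_one, Matrix.col_apply] at h3
  rw [h2, single_one_vecMul] at h3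
  exact h1.ne h3

theorem Qs.convex {P : ι → Prop} {A B : Matrix ι ι ℝ} (hA : Qs P A) (hB : Qs P B) (s : I) :
    Qs P ((1 - (s : ℝ)) • A + (s : ℝ) • B) := by
  refine ⟨by simp [hA.1, hB.1], fun i j hi => by simp [hA.2.1 i j hi, hB.2.1 i j hi], fun x hx => ?_⟩
  have h1 := hA.2.2 x hx
  have h2 := hB.2.2 x hx
  rw [add_mulVec, dotProduct_add, smul_mulVec, smul_mulVec, dotProduct_smul, dotProduct_smul,
    smul_eq_mul, smul_eq_mul]
  have := s.2.1
  have := s.2.2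
  rcases eq_or_lt_of_le s.2.1 with h | h
  · rw [← h]; simpa using h1
  · nlinarith

/-- indicator diagonal matrix -/
noncomputable def Dg (P : ι → Prop) : Matrix ι ι ℝ :=
  open Classical in Matrix.diagonal (fun i => if P i then (1 : ℝ) else 0)

theorem Qs_Dg (P : ι → Prop) : Qs P (Dg P) := by
  classical
  refine ⟨by simp [Dg], ?_, ?_⟩
  · intro i j hi
    by_cases h : i = j
    · subst h; simp [Dg, hi]
    · simp [Dg, h]
  · rintro x ⟨i, hi, hx⟩
    simp only [Dg, dotProduct, mulVec_diagonal]
    refine Finset.sum_pos' (fun j _ => ?_) ⟨i, Finset.mem_univ _, ?_⟩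
    · split_ifs
      · rw [one_mul]; exact mul_self_nonneg _
      · simp
    · simp only [hi, if_true, one_mul]; exact mul_self_pos.2 hx

/-- `g` carries a point of the model set to `y`. -/
def Lifts (P N : ι → Prop) (g : Matrix ι ι ℝ) (y : Matrix ι ι ℝ × Matrix ι ι ℝ) : Prop :=
  g.det ≠ 0 ∧ Qs P (g⁻¹ * y.1 * g⁻¹ᵀ) ∧ Qs N (g⁻¹ * y.2 * g⁻¹ᵀ)

theorem Lifts.mulK {P N : ι → Prop} {g k : Matrix ι ι ℝ} {y : Matrix ι ι ℝ × Matrix ι ι ℝ}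
    (h : Lifts P N g y) (hk : k.det ≠ 0) (hP : Ks P k) (hN : Ks N k) : Lifts P N (g * k) y := by
  have hk' : k⁻¹.det ≠ 0 := by
    rw [det_nonsing_inv, Ring.inverse_eq_inv']; exact inv_ne_zero hk
  refine ⟨by rw [det_mul]; exact mul_ne_zero h.1 hk, ?_, ?_⟩
  · have := h.2.1.conj (hP.inv hk) hk'
    simpa only [Matrix.mul_inv_rev, transpose_mul, mul_assoc] using this
  · have := h.2.2.conj (hN.inv hk) hk'
    simpa only [Matrix.mul_inv_rev, transpose_mul, mul_assoc] using this

theorem Lifts.K {P N : ι → Prop} {g g' : Matrix ι ι ℝ} {y : Matrix ι ι ℝ × Matrix ι ι ℝ}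
    (h : Lifts P N g y) (h' : Lifts P N g' y) : Ks P (g⁻¹ * g') ∧ Ks N (g⁻¹ * g') := by
  have hu : IsUnit g'.det := isUnit_iff_ne_zero.2 h'.1
  have e : ∀ A : Matrix ι ι ℝ, (g⁻¹ * g') * (g'⁻¹ * A * g'⁻¹ᵀ) * (g⁻¹ * g')ᵀ = g⁻¹ * A * g⁻¹ᵀ := by
    intro A
    calc _ = g⁻¹ * (g' * g'⁻¹) * A * (g' * g'⁻¹)ᵀ * g⁻¹ᵀ := by
          simp only [transpose_mul, mul_assoc]
      _ = _ := by rw [mul_nonsing_inv _ hu]; simp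
  exact ⟨Ks_of_conj h'.2.1 h.2.1 (e _), Ks_of_conj h'.2.2 h.2.2 (e _)⟩

theorem Lifts_of_eq {P N : ι → Prop} {g A B : Matrix ι ι ℝ} (hg : g.det ≠ 0) (hA : Qs P A) (hB : Qs N B) :
    Lifts P N g (g * A * gᵀ, g * B * gᵀ) := by
  have hu : IsUnit g.det := isUnit_iff_ne_zero.2 hg
  have e : ∀ A : Matrix ι ι ℝ, g⁻¹ * (g * A * gᵀ) * g⁻¹ᵀ = A := by
    intro A
    calc _ = (g⁻¹ * g) * A * (g⁻¹ * g)ᵀ := by simp only [transpose_mul, mul_assoc]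
      _ = _ := by rw [nonsing_inv_mul _ hu]; simp
  refine ⟨hg, ?_, ?_⟩
  · simpa only [e] using hA
  · simpa only [e] using hB

theorem conj_inv_conj {g : Matrix ι ι ℝ} (hg : g.det ≠ 0) (A : Matrix ι ι ℝ) :
    g * (g⁻¹ * A * g⁻¹ᵀ) * gᵀ = A := by
  have hu : IsUnit g.det := isUnit_iff_ne_zero.2 hg
  calc _ = (g * g⁻¹) * A * (g * g⁻¹)ᵀ := by simp only [transpose_mul, mul_assoc]
      _ = _ := by rw [mul_nonsing_inv _ hu]; simp

/-- The space of pairs. -/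
def Cp (P N : ι → Prop) : Set (Matrix ι ι ℝ × Matrix ι ι ℝ) := {y | ∃ g, Lifts P N g y}

theorem tau_K {P N : ι → Prop} (hPN : ∀ i, P i → ¬ N i) {h A B : Matrix ι ι ℝ} (hh : h.det ≠ 0)
    (hA : Qs P A) (hB : Qs N B) :
    Ks P (h⁻¹ * (h * A * hᵀ * Dg P + h * B * hᵀ * Dg N + Dg fun i => ¬ P i ∧ ¬ N i)) ∧
    Ks N (h⁻¹ * (h * A * hᵀ * Dg P + h * B * hᵀ * Dg N + Dg fun i => ¬ P i ∧ ¬ N i)) := by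
  classical
  have hu : IsUnit h.det := isUnit_iff_ne_zero.2 hh
  have e : h⁻¹ * (h * A * hᵀ * Dg P + h * B * hᵀ * Dg N + Dg fun i => ¬ P i ∧ ¬ N i) =
    A * (hᵀ * Dg P) + B * (hᵀ * Dg N) + h⁻¹ * Dg fun i => ¬ P i ∧ ¬ N i := by
    rw [mul_add, mul_add]
    simp only [← mul_assoc, nonsing_inv_mul _ hu, one_mul]
  have hz : ∀ (P : ι → Prop) (A M : Matrix ι ι ℝ), Qs P A → ∀ i j, ¬ P i → (A * M) i j = 0 := by
    intro P A M hA i j hi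
    rw [Matrix.mul_apply]
    exact Finset.sum_eq_zero fun a _ => by rw [hA.2.1 i a hi, zero_mul]
  have hd : ∀ (P : ι → Prop) (M : Matrix ι ι ℝ), ∀ i j, ¬ P j → (M * Dg P) i j = 0 := by
    intro P M i j hj
    simp [Dg, mul_diagonal, hj]
  rw [e]
  constructor
  · intro i j hj hi
    rw [Matrix.add_apply, Matrix.add_apply, hz P A _ hA i j hi, ← mul_assoc, hd N _ i j (hPN j hj), hd _ _ i j (by tauto)]
    simp
  · intro i j hj hi
    rw [Matrix.add_apply, Matrix.add_apply, hz N B _ hB i j hi, ← mul_assoc, hd P _ i j (fun h => hPN j h hj), hd _ _ i j (by tauto)]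
    simp

theorem Qs.nonneg {P : ι → Prop} {A : Matrix ι ι ℝ} (hA : Qs P A) (x : ι → ℝ) :
    0 ≤ x ⬝ᵥ (A *ᵥ x) := by
  by_cases h : ∃ i, P i ∧ x i ≠ 0
  · exact (hA.2.2 x h).le
  · push Not at h
    have : A *ᵥ x = 0 := by
      ext i
      simp only [mulVec, dotProduct, Pi.zero_apply]
      refine Finset.sum_eq_zero fun j _ => ?_
      by_cases hj : P j
      · rw [h j hj, mul_zero]
      · rw [← hA.1, transpose_apply, hA.2.1 j i hj, zero_mul]
    rw [this]; simp

theorem sum_posDef {P N : ι → Prop} {A B : Matrix ι ι ℝ} (hA : Qs P A) (hB : Qs N B)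
    {x : ι → ℝ} (hx : x ≠ 0) : 0 < x ⬝ᵥ ((A + B + Dg fun i => ¬ P i ∧ ¬ N i) *ᵥ x) := by
  have hD := Qs_Dg (fun i => ¬ P i ∧ ¬ N i)
  rw [add_mulVec, add_mulVec, dotProduct_add, dotProduct_add]
  have h1 := hA.nonneg x
  have h2 := hB.nonneg x
  have h3 := hD.nonneg x
  obtain ⟨i, hi⟩ := Function.ne_iff.1 hx
  by_cases hP : P i
  · have := hA.2.2 x ⟨i, hP, hi⟩; linarith
  by_cases hN : N i
  · have := hB.2.2 x ⟨i, hN, hi⟩; linarith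
  · have := hD.2.2 x ⟨i, ⟨hP, hN⟩, hi⟩; linarith

theorem sum_det_ne {P N : ι → Prop} {A B : Matrix ι ι ℝ} (hA : Qs P A) (hB : Qs N B) :
    (A + B + Dg fun i => ¬ P i ∧ ¬ N i).det ≠ 0 := by
  intro h
  obtain ⟨x, hx, h0⟩ := Matrix.exists_mulVec_eq_zero_iff.2 h
  have := sum_posDef hA hB hx
  rw [h0] at this
  simp at this

theorem Qs.mul_Dg {P : ι → Prop} {A : Matrix ι ι ℝ} (hA : Qs P A) : A * Dg P = A := by
  classical
  ext i j
  by_cases hj : P j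
  · simp [Dg, mul_diagonal, hj]
  · rw [← hA.1]; simp [Dg, mul_diagonal, hj, hA.2.1 j i hj]

theorem local_section {P N : ι → Prop} (hPN : ∀ i, P i → ¬ N i) {y : Matrix ι ι ℝ × Matrix ι ι ℝ}
    (hy : y ∈ Cp P N) :
    ∃ f : Matrix ι ι ℝ × Matrix ι ι ℝ → Matrix ι ι ℝ, Continuous f ∧ (f y).det ≠ 0 ∧
      ∀ z ∈ Cp P N, (f z).det ≠ 0 → Lifts P N (f z) z := by
  obtain ⟨g, hg, hA, hB⟩ := hy
  have hu : IsUnit g.det := isUnit_iff_ne_zero.2 hg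
  refine ⟨fun z => g * (g⁻¹ * z.1 * g⁻¹ᵀ * Dg P + g⁻¹ * z.2 * g⁻¹ᵀ * Dg N +
    Dg fun i => ¬ P i ∧ ¬ N i), by fun_prop, ?_, ?_⟩
  · simp only
    rw [hA.mul_Dg, hB.mul_Dg, det_mul]
    exact mul_ne_zero hg (sum_det_ne hA hB)
  · rintro z ⟨h, hL⟩ hz
    have hh := isUnit_iff_ne_zero.2 hL.1
    have hd : (g⁻¹ * h).det ≠ 0 := by
      rw [det_mul, det_nonsing_inv, Ring.inverse_eq_inv']
      exact mul_ne_zero (inv_ne_zero hg) hL.1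
    have hK := tau_K hPN hd hL.2.1 hL.2.2
    have e : ∀ A : Matrix ι ι ℝ, (g⁻¹ * h) * (h⁻¹ * A * h⁻¹ᵀ) * (g⁻¹ * h)ᵀ = g⁻¹ * A * g⁻¹ᵀ := by
      intro A
      calc _ = g⁻¹ * (h * h⁻¹) * A * (h * h⁻¹)ᵀ * g⁻¹ᵀ := by
            simp only [transpose_mul, mul_assoc]
        _ = _ := by rw [mul_nonsing_inv _ hh]; simp
    rw [e, e] at hK
    set τ := g⁻¹ * z.1 * g⁻¹ᵀ * Dg P + g⁻¹ * z.2 * g⁻¹ᵀ * Dg N +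
      Dg fun i => ¬ P i ∧ ¬ N i
    have e2 : g * τ = h * ((g⁻¹ * h)⁻¹ * τ) := by
      rw [Matrix.mul_inv_rev, nonsing_inv_nonsing_inv _ hu, mul_assoc, ← mul_assoc h,
        mul_nonsing_inv _ hh, one_mul]
    have hz' : (g * τ).det ≠ 0 := hz
    show Lifts P N (g * τ) z
    rw [e2] at hz' ⊢
    refine hL.mulK ?_ hK.1 hK.2
    rw [det_mul] at hz'
    exact right_ne_zero_of_mul hz'

theorem path_lift {P N : ι → Prop} (hPN : ∀ i, P i → ¬ N i) (γ : I → Matrix ι ι ℝ × Matrix ι ι ℝ)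
    (hγ : Continuous γ) (hC : ∀ t, γ t ∈ Cp P N) {g₀ : Matrix ι ι ℝ} (h₀ : Lifts P N g₀ (γ 0)) :
    ∃ g : I → Matrix ι ι ℝ, Continuous g ∧ g 0 = g₀ ∧ ∀ t, Lifts P N (g t) (γ t) := by
  choose f hfc hf0 hf using fun t => local_section hPN (hC t)
  obtain ⟨τ, hτ0, hmono, ⟨m, hm⟩, hτ⟩ := exists_monotone_Icc_subset_open_cover_unitInterval
    (c := fun s : I => {t : I | (f s (γ t)).det ≠ 0})
    (fun s => isOpen_ne_fun ((hfc s).comp hγ).matrix_det continuous_const)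
    (fun t _ => Set.mem_iUnion.2 ⟨t, hf0 t⟩)
  have key : ∀ n, ∃ g : I → Matrix ι ι ℝ, Continuous g ∧ g 0 = g₀ ∧
      ∀ t, Lifts P N (g t) (γ (min t (τ n))) := by
    intro n
    induction n with
    | zero =>
      refine ⟨fun _ => g₀, continuous_const, rfl, fun t => ?_⟩
      have : min t (τ 0) = 0 := by rw [hτ0]; exact min_eq_right t.2.1
      rw [this]; exact h₀
    | succ n ih =>
      obtain ⟨g, hgc, hg0, hg⟩ := ih
      obtain ⟨s, hs⟩ := hτ n
      have hle : τ n ≤ τ (n + 1) := hmono (Nat.le_succ n)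
      let cl : I → I := fun t => max (τ n) (min t (τ (n + 1)))
      have hcl : Continuous cl := by fun_prop
      have hclm : ∀ t, cl t ∈ Set.Icc (τ n) (τ (n + 1)) := fun t =>
        ⟨le_max_left _ _, max_le hle (min_le_right _ _)⟩
      have hL : ∀ t, Lifts P N (f s (γ (cl t))) (γ (cl t)) := fun t =>
        hf s _ (hC _) (hs (hclm t))
      have hn : τ n ∈ Set.Icc (τ n) (τ (n + 1)) := ⟨le_rfl, hle⟩
      have hLn : Lifts P N (f s (γ (τ n))) (γ (τ n)) := hf s _ (hC _) (hs hn)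
      have hun : IsUnit (f s (γ (τ n))).det := isUnit_iff_ne_zero.2 hLn.1
      have hlow : ∀ t, t ≤ τ n → f s (γ (cl t)) * ((f s (γ (τ n)))⁻¹ * g t) = g t := by
        intro t ht
        have : cl t = τ n := by
          simp only [cl]; exact max_eq_left ((min_le_left _ _).trans ht)
        rw [this, ← mul_assoc, mul_nonsing_inv _ hun, one_mul]
      refine ⟨fun t => f s (γ (cl t)) * ((f s (γ (τ n)))⁻¹ * g t), ?_, ?_, ?_⟩
      · exact ((hfc s).comp (hγ.comp hcl)).mul (continuous_const.mul hgc)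
      · simp only
        rw [hlow 0 (τ n).2.1, hg0]
      · intro t
        rcases le_total t (τ n) with ht | ht
        · simp only
          rw [hlow t ht, min_eq_left (ht.trans hle)]
          have := hg t
          rwa [min_eq_left ht] at this
        · have h1 : cl t = min t (τ (n + 1)) := max_eq_right (le_min ht hle)
          have h2 := hg t
          rw [min_eq_right ht] at h2
          have h3 := hLn.K h2
          rw [← h1]
          refine (hL t).mulK ?_ h3.1 h3.2
          rw [det_mul, det_nonsing_inv, Ring.inverse_eq_inv']
          exact mul_ne_zero (inv_ne_zero hLn.1) h2.1
  obtain ⟨g, hgc, hg0, hg⟩ := key m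
  refine ⟨g, hgc, hg0, fun t => ?_⟩
  have := hg t
  rwa [hm m le_rfl, min_eq_left (show t ≤ 1 from t.2.2)] at this

end orbit
end TubeAux

namespace TubeAux
open unitInterval Topology
section orbit2
variable {ι : Type*} [Fintype ι] [DecidableEq ι]

theorem det_blocks (c : ι → Fin 3) {k : Matrix ι ι ℝ}
    (hP : Ks (fun i => c i = 0) k) (hN : Ks (fun i => c i = 1) k) :
    k.det = (k.toSquareBlock c 0).det * (k.toSquareBlock c 1).det * (k.toSquareBlock c 2).det := by
  have hb : k.BlockTriangular c := by
    intro i j hij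
    have h1 := hP i j
    have h2 := hN i j
    by_cases hj0 : c j = 0
    · exact h1 hj0 (by rw [hj0] at hij; exact hij.ne')
    by_cases hj1 : c j = 1
    · exact h2 hj1 (by rw [hj1] at hij; exact hij.ne')
    exfalso
    generalize c i = a at *
    generalize c j = b at *
    omega
  rw [hb.det_fintype, Fin.prod_univ_three]

theorem K_path (c : ι → Fin 3) {k : Matrix ι ι ℝ} (hk : 0 < k.det)
    (hP : Ks (fun i => c i = 0) k) (hN : Ks (fun i => c i = 1) k)
    (h0 : 0 < (k.toSquareBlock c 0).det) (h1 : 0 < (k.toSquareBlock c 1).det) :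
    ∃ κ : I → Matrix ι ι ℝ, Continuous κ ∧ κ 0 = 1 ∧ κ 1 = k ∧ ∀ t, (κ t).det ≠ 0 ∧
      Ks (fun i => c i = 0) (κ t) ∧ Ks (fun i => c i = 1) (κ t) := by
  have h2 : 0 < (k.toSquareBlock c 2).det := by
    rw [det_blocks c hP hN] at hk
    exact pos_of_mul_pos_right hk (mul_pos h0 h1).le
  have hall : ∀ a : Fin 3, JoinedIn (GLs {i // c i = a}) 1 (k.toSquareBlock c a) := by
    intro a
    apply joined_one_of_det_pos
    fin_cases a
    · exact h0
    · exact h1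
    · exact h2
  choose β hβ using hall
  let κ : I → Matrix ι ι ℝ := fun t => Matrix.of fun i j =>
    if h : c j = c i then β (c i) t ⟨i, rfl⟩ ⟨j, h⟩ else (t : ℝ) * k i j
  have hKs : ∀ (a : Fin 3), Ks (fun i => c i = a) k → ∀ t, Ks (fun i => c i = a) (κ t) := by
    intro a ha t i j hj hi
    have hne : ¬ (c j = c i) := fun h => hi (h.symm.trans hj)
    simp only [κ, Matrix.of_apply, hne, dite_false]
    rw [ha i j hj hi, mul_zero]
  have hblock : ∀ a t, (κ t).toSquareBlock c a = β a t := by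
    rintro a t
    ext ⟨i, hi⟩ ⟨j, hj⟩
    subst hi
    simp [toSquareBlock, toSquareBlockProp, κ, hj]
  refine ⟨κ, ?_, ?_, ?_, fun t => ⟨?_, hKs 0 hP t, hKs 1 hN t⟩⟩
  · refine continuous_matrix fun i j => ?_
    simp only [κ, Matrix.of_apply]
    split_ifs with h
    · exact (β (c i)).continuous.matrix_elem _ _
    · fun_prop
  · ext i j
    simp only [κ, Matrix.of_apply]
    split_ifs with h
    · rw [(β (c i)).source]
      simp [Matrix.one_apply]
    · have : i ≠ j := fun h' => h (by rw [h'])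
      simp [this]
  · ext i j
    simp only [κ, Matrix.of_apply]
    split_ifs with h
    · rw [(β (c i)).target]
      rfl
    · simp
  · rw [det_blocks c (hKs 0 hP t) (hKs 1 hN t), hblock, hblock, hblock]
    exact mul_ne_zero (mul_ne_zero (hβ 0 t) (hβ 1 t)) (hβ 2 t)

/-- base point of the space of pairs -/
noncomputable abbrev baseC (P N : ι → Prop) : Cp P N :=
  ⟨(Dg P, Dg N), 1, by simpa using Lifts_of_eq (g := (1 : Matrix ι ι ℝ)) (by simp) (Qs_Dg P) (Qs_Dg N)⟩

theorem lifts_one (P N : ι → Prop) : Lifts P N (1 : Matrix ι ι ℝ) (Dg P, Dg N) := by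
  simpa using Lifts_of_eq (g := (1 : Matrix ι ι ℝ)) (by simp) (Qs_Dg P) (Qs_Dg N)

theorem loop_null_of_K {P N : ι → Prop} (h : I → Matrix ι ι ℝ)
    (γ : Path (baseC P N) (baseC P N)) (hK : ∀ t, (h t).det ≠ 0 ∧ Ks P (h t) ∧ Ks N (h t))
    (hγ : ∀ t, (γ t).1 = (h t * Dg P * (h t)ᵀ, h t * Dg N * (h t)ᵀ)) :
    γ.Homotopic (Path.refl _) := by
  have hQ : ∀ t, Qs P (γ t).1.1 ∧ Qs N (γ t).1.2 := by
    intro t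
    rw [hγ]
    exact ⟨(Qs_Dg P).conj (hK t).2.1 (hK t).1, (Qs_Dg N).conj (hK t).2.2 (hK t).1⟩
  refine homotopic_of_family γ (Path.refl _) (fun s t =>
    ((1 - (s : ℝ)) • (γ t).1.1 + (s : ℝ) • Dg P, (1 - (s : ℝ)) • (γ t).1.2 + (s : ℝ) • Dg N))
    (by fun_prop) ?_ ?_ ?_ ?_ ?_
  · intro s t
    refine ⟨1, ?_⟩
    have := Lifts_of_eq (g := (1 : Matrix ι ι ℝ)) (by simp) ((hQ t).1.convex (Qs_Dg P) s) ((hQ t).2.convex (Qs_Dg N) s)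
    simpa using this
  · intro t; simp
  · intro t; simp
  · intro s
    simp only [γ.source]
    simp [← add_smul]
  · intro s
    simp only [γ.target]
    simp [← add_smul]

theorem cont_conv {X : Type*} [TopologicalSpace X] {f f' A : X → Matrix ι ι ℝ} {s : X → ℝ}
    (B : Matrix ι ι ℝ) (hf : Continuous f) (hf' : Continuous f') (hA : Continuous A) (hs : Continuous s) :
    Continuous fun x => f x * ((1 - s x) • (f' x * A x * (f' x)ᵀ) + s x • B) * (f x)ᵀ := by
  fun_prop

theorem null_in_Cp (c : ι → Fin 3) {i j : ι} (hij : i ≠ j) (hc : c i = c j)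
    (P N : ι → Prop) (hPd : P = fun i => c i = 0) (hNd : N = fun i => c i = 1)
    (γ : Path (baseC P N) (baseC P N))
    (hdet : ∀ g : I → Matrix ι ι ℝ, Continuous g → g 0 = 1 →
      (∀ t, Lifts P N (g t) (γ t).1) → Ks P (g 1) → Ks N (g 1) →
      0 < ((g 1).toSquareBlock c 0).det ∧ 0 < ((g 1).toSquareBlock c 1).det) :
    γ.Homotopic (Path.refl _) := by
  have hPN : ∀ i, P i → ¬ N i := by
    intro i h1 h2
    simp only [hPd, hNd] at h1 h2
    rw [h1] at h2; exact absurd h2 (by decide)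
  obtain ⟨g, hgc, hg0, hg⟩ := path_lift hPN (fun t => (γ t).1) (by fun_prop) (fun t => (γ t).2)
    (g₀ := 1) (by rw [γ.source]; exact lifts_one P N)
  have hK := (lifts_one P N).K (g' := g 1) (by have := hg 1; rwa [γ.target] at this)
  simp only [inv_one, one_mul] at hK
  obtain ⟨hd0, hd1⟩ := hdet g hgc hg0 hg hK.1 hK.2
  have hgdet : 0 < (g 1).det := by
    by_contra hneg
    have hcont : Continuous fun t => (g t).det := hgc.matrix_det
    have h0 : (g 0).det = 1 := by rw [hg0]; simp
    have : (0 : ℝ) ∈ Set.range fun t => (g t).det := by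
      apply mem_range_of_exists_le_of_exists_ge hcont ⟨1, not_lt.1 hneg⟩ ⟨0, by rw [h0]; norm_num⟩
    obtain ⟨t, ht⟩ := this
    exact (hg t).1 ht
  obtain ⟨κ, hκc, hκ0, hκ1, hκ⟩ := K_path c hgdet (hPd ▸ hK.1) (hNd ▸ hK.2) hd0 hd1
  rw [← hPd, ← hNd] at hκ
  -- corrected lift, a loop in GL
  set G : I → Matrix ι ι ℝ := fun t => g t * (κ t)⁻¹ with hG
  have hκi := continuous_matInv hκc (fun t => (hκ t).1)
  have hGc : Continuous G := hgc.mul hκi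
  have hGL : ∀ t, Lifts P N (G t) (γ t).1 := by
    intro t
    refine (hg t).mulK ?_ ((hκ t).2.1.inv (hκ t).1) ((hκ t).2.2.inv (hκ t).1)
    rw [det_nonsing_inv, Ring.inverse_eq_inv']; exact inv_ne_zero (hκ t).1
  have hG0 : G 0 = 1 := by simp [hG, hg0, hκ0]
  have hG1 : G 1 = 1 := by
    simp only [hG, hκ1]; exact mul_nonsing_inv _ (isUnit_iff_ne_zero.2 hgdet.ne')
  let Gp : Path (oneG ι) (oneG ι) := ⟨⟨fun t => ⟨G t, (hGL t).1⟩, by fun_prop⟩,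
    Subtype.ext hG0, Subtype.ext hG1⟩
  obtain ⟨ĥ, hhom, hred⟩ := loop_reduce hij Gp
  have hGi := continuous_matInv hGc (fun t => (hGL t).1)
  -- first homotopy
  have step1 : ∃ γ₁ : Path (baseC P N) (baseC P N), γ.Homotopic γ₁ ∧
      ∀ t, (γ₁ t).1 = (G t * ((1 - ((1 : I) : ℝ)) • ((G t)⁻¹ * (γ t).1.1 * (G t)⁻¹ᵀ) + ((1 : I) : ℝ) • Dg P) * (G t)ᵀ,
        G t * ((1 - ((1 : I) : ℝ)) • ((G t)⁻¹ * (γ t).1.2 * (G t)⁻¹ᵀ) + ((1 : I) : ℝ) • Dg N) * (G t)ᵀ) := by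
    refine exists_homotopic_of_family γ (fun s t =>
      (G t * ((1 - (s : ℝ)) • ((G t)⁻¹ * (γ t).1.1 * (G t)⁻¹ᵀ) + (s : ℝ) • Dg P) * (G t)ᵀ,
        G t * ((1 - (s : ℝ)) • ((G t)⁻¹ * (γ t).1.2 * (G t)⁻¹ᵀ) + (s : ℝ) • Dg N) * (G t)ᵀ)) ?_ ?_ ?_ ?_ ?_
    · have c1 : Continuous fun p : I × I => G p.2 := hGc.comp continuous_snd
      have c2 : Continuous fun p : I × I => (G p.2)⁻¹ := hGi.comp continuous_snd
      have c3 : Continuous fun p : I × I => (γ p.2).1 := by fun_prop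
      have c4 : Continuous fun p : I × I => (p.1 : ℝ) := by fun_prop
      exact Continuous.prodMk (cont_conv (Dg P) c1 c2 c3.fst c4) (cont_conv (Dg N) c1 c2 c3.snd c4)
    · intro s t
      exact ⟨G t, Lifts_of_eq (hGL t).1 ((hGL t).2.1.convex (Qs_Dg P) s) ((hGL t).2.2.convex (Qs_Dg N) s)⟩
    · intro t
      simp [conj_inv_conj (hGL t).1]
    · intro s
      simp [hG0, ← add_smul]
    · intro s
      simp [hG1, ← add_smul]
  obtain ⟨γ₁, hh₁, hγ₁⟩ := step1
  obtain ⟨F⟩ := hhom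
  have step2 : ∃ γ₂ : Path (baseC P N) (baseC P N), γ₁.Homotopic γ₂ ∧
      ∀ t, (γ₂ t).1 = ((F ((1 : I), t)).1 * Dg P * (F ((1 : I), t)).1ᵀ, (F ((1 : I), t)).1 * Dg N * (F ((1 : I), t)).1ᵀ) := by
    refine exists_homotopic_of_family γ₁ (fun s t => ((F (s, t)).1 * Dg P * (F (s, t)).1ᵀ, (F (s, t)).1 * Dg N * (F (s, t)).1ᵀ)) ?_ ?_ ?_ ?_ ?_
    · have c1 : Continuous fun p : I × I => (F (p.1, p.2)).1 :=
        continuous_subtype_val.comp F.continuous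
      exact ((c1.mul continuous_const).mul c1.matrix_transpose).prodMk
        ((c1.mul continuous_const).mul c1.matrix_transpose)
    · intro s t
      exact ⟨(F (s, t)).1, Lifts_of_eq (F (s, t)).2 (Qs_Dg P) (Qs_Dg N)⟩
    · intro t
      rw [hγ₁]
      simp [Gp]
    · intro s; simp
    · intro s; simp
  obtain ⟨γ₂, hh₂, hγ₂⟩ := step2
  refine (hh₁.trans hh₂).trans (loop_null_of_K (fun t => (ĥ t).1) γ₂ (fun t => ⟨(ĥ t).2, ?_, ?_⟩) ?_)
  · intro a b hb ha
    have hab : a ≠ b := by rintro rfl; exact ha hb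
    by_cases h1 : b ≠ i ∧ b ≠ j
    · exact (hred t b h1.1 h1.2 a hab).1
    by_cases h2 : a ≠ i ∧ a ≠ j
    · exact (hred t a h2.1 h2.2 b hab.symm).2
    exfalso
    have e1 : c b = c i := by
      rw [not_and_or, not_not, not_not] at h1; rcases h1 with rfl | rfl <;> simp [hc]
    have e2 : c a = c i := by
      rw [not_and_or, not_not, not_not] at h2; rcases h2 with rfl | rfl <;> simp [hc]
    apply ha
    simp only [hPd] at *
    rw [e2, ← e1, hb]
  · intro a b hb ha
    have hab : a ≠ b := by rintro rfl; exact ha hb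
    by_cases h1 : b ≠ i ∧ b ≠ j
    · exact (hred t b h1.1 h1.2 a hab).1
    by_cases h2 : a ≠ i ∧ a ≠ j
    · exact (hred t a h2.1 h2.2 b hab.symm).2
    exfalso
    have e1 : c b = c i := by
      rw [not_and_or, not_not, not_not] at h1; rcases h1 with rfl | rfl <;> simp [hc]
    have e2 : c a = c i := by
      rw [not_and_or, not_not, not_not] at h2; rcases h2 with rfl | rfl <;> simp [hc]
    apply ha
    simp only [hNd] at *
    rw [e2, ← e1, hb]
  · intro t
    rw [hγ₂]
    simp

end orbit2
end TubeAux

namespace TubeAux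
open unitInterval Topology
section minors
variable {ι : Type*} [Fintype ι] [DecidableEq ι]

/-- the vector of maximal minors of the columns of class `a`. -/
def um (c : ι → Fin 3) (a : Fin 3) (g : Matrix ι ι ℝ) (S : {i // c i = a} → ι) : ℝ :=
  (g.submatrix S Subtype.val).det

theorem sum_class {P : ι → Prop} [DecidablePred P] (f : ι → ℝ) (h : ∀ i, ¬ P i → f i = 0) :
    ∑ i, f i = ∑ i : {i // P i}, f i := by
  rw [← Finset.sum_subtype (Finset.univ.filter P) (p := P) (by simp) f, Finset.sum_filter]
  refine Finset.sum_congr rfl fun i _ => ?_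
  split_ifs with hi
  · rfl
  · exact h i hi

theorem um_mul (c : ι → Fin 3) (a : Fin 3) (g k : Matrix ι ι ℝ) (hk : Ks (fun i => c i = a) k)
    (S : {i // c i = a} → ι) : um c a (g * k) S = um c a g S * (k.toSquareBlock c a).det := by
  rw [um, um, ← det_mul]
  congr 1
  ext i j
  simp only [submatrix_apply, Matrix.mul_apply]
  rw [sum_class (P := fun i => c i = a)]
  · rfl
  · intro b hb
    rw [hk b j j.2 hb, mul_zero]

theorem minor_conj (c : ι → Fin 3) (a : Fin 3) (g A : Matrix ι ι ℝ) (hA : Qs (fun i => c i = a) A)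
    (S J : {i // c i = a} → ι) :
    ((g * A * gᵀ).submatrix S J).det = um c a g S * (A.toSquareBlock c a).det * um c a g J := by
  have e : (g * A * gᵀ).submatrix S J =
      ((g * A).submatrix S Subtype.val) * (g.submatrix J (Subtype.val : {i // c i = a} → ι))ᵀ := by
    ext i j
    rw [submatrix_apply, Matrix.mul_apply, sum_class (P := fun i => c i = a)]
    · rfl
    · intro b hb
      rw [Matrix.mul_apply, Finset.sum_eq_zero, zero_mul]
      intro d _
      rw [← hA.1, transpose_apply, hA.2.1 b d hb, mul_zero]
  rw [e, det_mul, det_transpose]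
  have := um_mul c a g A (fun i j _ hi => hA.2.1 i j hi) S
  rw [um] at this
  rw [this, um, um]

theorem det_block_pos (c : ι → Fin 3) (a : Fin 3) (A : Matrix ι ι ℝ) (hA : Qs (fun i => c i = a) A) :
    0 < (A.toSquareBlock c a).det := by
  have : (A.toSquareBlock c a).PosDef := by
    refine PosDef.of_dotProduct_mulVec_pos ?_ ?_
    · ext i j
      have := congrFun (congrFun hA.1 i) j
      simpa [toSquareBlock, toSquareBlockProp] using this
    · intro x hx
      obtain ⟨i, hi⟩ := Function.ne_iff.1 hx
      have h := hA.2.2 (fun i => if h : c i = a then x ⟨i, h⟩ else 0) ⟨i, i.2, by simpa [i.2] using hi⟩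
      refine h.trans_eq ?_
      symm
      simp only [dotProduct, mulVec, star_trivial]
      rw [sum_class (P := fun i => c i = a) _ (fun i hi => by simp [hi])]
      refine Finset.sum_congr rfl fun i _ => ?_
      rw [sum_class (P := fun i => c i = a) _ (fun i hi => by simp [hi])]
      simp only [i.2, dite_true, toSquareBlock, toSquareBlockProp, Matrix.of_apply]
      congr 1
      refine Finset.sum_congr rfl fun j _ => ?_
      simp [j.2]
  exact this.det_pos

theorem exists_um_ne (c : ι → Fin 3) (a : Fin 3) {g : Matrix ι ι ℝ} (hg : g.det ≠ 0) :
    ∃ S, um c a g S ≠ 0 := by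
  by_contra hcon
  push Not at hcon
  have h1 : (g⁻¹.submatrix (Subtype.val : {i // c i = a} → ι) id) * (g.submatrix id (Subtype.val : {i // c i = a} → ι)) = 1 := by
    rw [← submatrix_mul _ _ _ _ _ Function.bijective_id, nonsing_inv_mul _ (isUnit_iff_ne_zero.2 hg)]
    ext i j
    simp [Matrix.one_apply, Subtype.ext_iff]
  have h2 := congrArg det h1
  rw [det_one] at h2
  have h3 : ((g⁻¹.submatrix (Subtype.val : {i // c i = a} → ι) id) * (g.submatrix id (Subtype.val : {i // c i = a} → ι))).det =
    detRowAlternating (fun i : {i // c i = a} => ∑ b, g⁻¹ i b • (fun j : {i // c i = a} => g b j)) := by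
    rw [det]
    congr 1
    ext i j
    simp [Matrix.mul_apply]
  rw [h3, ← AlternatingMap.coe_multilinearMap, MultilinearMap.map_sum] at h2
  rw [Finset.sum_eq_zero] at h2
  · exact zero_ne_one h2
  · intro S _
    rw [MultilinearMap.map_smul_univ]
    have := hcon S
    rw [um, det] at this
    simp only [AlternatingMap.coe_multilinearMap, smul_eq_mul]
    exact mul_eq_zero_of_right _ this

theorem det_pos_of_path (c : ι → Fin 3) (a : Fin 3) (g A : I → Matrix ι ι ℝ) (hg : Continuous g)
    (hdet : ∀ t, (g t).det ≠ 0)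
    (hA : ∀ t, Qs (fun i => c i = a) ((g t)⁻¹ * A t * (g t)⁻¹ᵀ))
    (v : I → ({i // c i = a} → ι) → ℝ) (hv : Continuous v)
    (hvA : ∀ t S J, v t S * v t J = ((A t).submatrix S J).det)
    (hv0 : v 0 = um c a 1) (hv1 : v 1 = um c a 1) (hg0 : g 0 = 1)
    (hk : Ks (fun i => c i = a) (g 1)) :
    0 < ((g 1).toSquareBlock c a).det := by
  set φ : I → ℝ := fun t => ∑ S, v t S * um c a (g t) S with hφ
  have hsq : ∀ h : Matrix ι ι ℝ, h.det ≠ 0 → 0 < ∑ S, um c a h S * um c a h S := by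
    intro h hh
    obtain ⟨S, hI⟩ := exists_um_ne c a hh
    exact Finset.sum_pos' (fun J _ => mul_self_nonneg _) ⟨S, Finset.mem_univ _, mul_self_pos.2 hI⟩
  have hφc : Continuous φ := by
    refine continuous_finsetSum _ fun J _ => ?_
    refine Continuous.mul (by fun_prop) ?_
    exact (hg.matrix_submatrix _ _).matrix_det
  have hne : ∀ t, φ t ≠ 0 := by
    intro t h0
    have h1 : φ t * φ t = (((g t)⁻¹ * A t * (g t)⁻¹ᵀ).toSquareBlock c a).det *
        ((∑ S, um c a (g t) S * um c a (g t) S) * (∑ S, um c a (g t) S * um c a (g t) S)) := by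
      simp only [hφ]
      rw [Finset.sum_mul_sum, Finset.sum_mul_sum, Finset.mul_sum]
      refine Finset.sum_congr rfl fun S _ => ?_
      rw [Finset.mul_sum]
      refine Finset.sum_congr rfl fun J _ => ?_
      have := minor_conj c a (g t) _ (hA t) S J
      rw [conj_inv_conj (hdet t), ← hvA] at this
      linear_combination (um c a (g t) S * um c a (g t) J) * this
    rw [h0] at h1
    have h2 := det_block_pos c a _ (hA t)
    have h3 := hsq _ (hdet t)
    have := mul_pos h2 (mul_pos h3 h3)
    rw [← h1] at this
    simp at this
  have h0 : 0 < φ 0 := by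
    simp only [hφ, hv0, hg0]
    exact hsq 1 (by simp)
  have h1 : φ 1 = ((g 1).toSquareBlock c a).det * ∑ S, um c a 1 S * um c a 1 S := by
    simp only [hφ, hv1, Finset.mul_sum]
    refine Finset.sum_congr rfl fun S _ => ?_
    have := um_mul c a 1 (g 1) hk S
    rw [one_mul] at this
    rw [this]; ring
  have h2 : 0 < φ 1 := by
    by_contra hneg
    obtain ⟨t, ht⟩ : (0 : ℝ) ∈ Set.range φ :=
      mem_range_of_exists_le_of_exists_ge hφc ⟨1, not_lt.1 hneg⟩ ⟨0, h0.le⟩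
    exact hne t ht
  rw [h1] at h2
  exact pos_of_mul_pos_left h2 (hsq 1 (by simp)).le

end minors
end TubeAux

namespace TubeAux
open unitInterval Topology
section spectral
variable {ι : Type*} [Fintype ι] [DecidableEq ι]

open scoped Matrix.Norms.L2Operator in
theorem continuous_matCfc {X : Type*} [TopologicalSpace X] (f : ℝ → ℝ) (hf : Continuous f)
    (a : X → Matrix ι ι ℝ) (ha : Continuous a) (hs : ∀ x, (a x)ᵀ = a x) :
    Continuous fun x => cfc f (a x) := by
  refine Continuous.cfc_of_mem_nhdsSet (s := Set.univ) f Filter.univ_mem ha ?_ hf.continuousOn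
  intro x
  change star (a x) = a x
  rw [star_eq_conjTranspose, conjTranspose_eq_transpose_of_trivial, hs]

theorem cfc_conj (f : ℝ → ℝ) (U : Matrix ι ι ℝ) (hU : U * Uᵀ = 1) (μ : ι → ℝ) :
    cfc f (U * diagonal μ * Uᵀ) = U * diagonal (fun i => f (μ i)) * Uᵀ := by
  have hU' : Uᵀ * U = 1 := mul_eq_one_comm.mp hU
  let u : unitary (Matrix ι ι ℝ) := ⟨U, by
    rw [Unitary.mem_iff, star_eq_conjTranspose, conjTranspose_eq_transpose_of_trivial]
    exact ⟨hU', hU⟩⟩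
  let φ : (ι → ℝ) →ₐ[ℝ] Matrix ι ι ℝ :=
    (Unitary.conjStarAlgAut ℝ (Matrix ι ι ℝ) u : Matrix ι ι ℝ →ₐ[ℝ] Matrix ι ι ℝ).comp
      (diagonalAlgHom ℝ)
  have hφ : ∀ d, φ d = U * diagonal d * Uᵀ := by
    intro d
    change (Unitary.conjStarAlgAut ℝ (Matrix ι ι ℝ) u) (diagonal d) = _
    rw [Unitary.conjStarAlgAut_apply]
    rfl
  let p := Lagrange.interpolate (Finset.univ.image μ) id f
  have hp : ∀ i, p.eval (μ i) = f (μ i) := fun i =>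
    Lagrange.eval_interpolate_at_node (v := id) f Function.injective_id.injOn
      (Finset.mem_image_of_mem _ (Finset.mem_univ i))
  have hsa : IsSelfAdjoint (U * diagonal μ * Uᵀ) := by
    change star _ = _
    rw [star_eq_conjTranspose, conjTranspose_eq_transpose_of_trivial]
    simp [mul_assoc]
  have hsp : spectrum ℝ (U * diagonal μ * Uᵀ) ⊆ Set.range μ := by
    rw [← hφ]
    refine (AlgHom.spectrum_apply_subset φ μ).trans ?_
    intro r hr
    by_contra h
    apply hr
    change IsUnit (algebraMap ℝ (ι → ℝ) r - μ)
    rw [Pi.isUnit_iff]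
    intro i
    simp only [Pi.sub_apply, Pi.algebraMap_apply, isUnit_iff_ne_zero, Algebra.algebraMap_self, RingHom.id_apply]
    intro h0
    exact h ⟨i, by linarith⟩
  have : cfc f (U * diagonal μ * Uᵀ) = cfc p.eval (U * diagonal μ * Uᵀ) := by
    refine cfc_congr ?_
    intro x hx
    obtain ⟨i, rfl⟩ := hsp hx
    exact (hp i).symm
  rw [this, cfc_polynomial p _ hsa, ← hφ, ← hφ, Polynomial.aeval_algHom_apply]
  congr 1
  ext i
  rw [← hp i]
  have := Polynomial.aeval_algHom_apply (Pi.evalAlgHom ℝ (fun _ : ι => ℝ) i) μ p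
  simp only [Pi.evalAlgHom_apply] at this
  rw [← this]; simp

theorem spectral_real (S : Matrix ι ι ℝ) (hS : Sᵀ = S) :
    ∃ U : Matrix ι ι ℝ, U * Uᵀ = 1 ∧ ∃ μ : ι → ℝ, S = U * diagonal μ * Uᵀ := by
  have hA : S.IsHermitian := by
    change Sᴴ = S
    rw [conjTranspose_eq_transpose_of_trivial, hS]
  refine ⟨hA.eigenvectorUnitary, ?_, hA.eigenvalues, ?_⟩
  · have := hA.eigenvectorUnitary.2
    rw [Matrix.mem_unitaryGroup_iff, star_eq_conjTranspose, conjTranspose_eq_transpose_of_trivial] at this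
    exact this
  · have := hA.spectral_theorem
    rw [Unitary.conjStarAlgAut_apply] at this
    rw [star_eq_conjTranspose, conjTranspose_eq_transpose_of_trivial] at this
    exact this

theorem inertia (w w' : ι → ℝ) (h : Matrix ι ι ℝ) (hh : h.det ≠ 0)
    (e : diagonal w = h * diagonal w' * hᵀ) :
    {i | 0 < w i}.ncard = {i | 0 < w' i}.ncard ∧ {i | w i < 0}.ncard = {i | w' i < 0}.ncard := by
  have : QuadraticMap.Equivalent (QuadraticMap.weightedSumSquares ℝ w)
      (QuadraticMap.weightedSumSquares ℝ w') := by
    have hu : IsUnit hᵀ.det := by rw [det_transpose]; exact hh.isUnit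
    refine ⟨⟨(Matrix.toLinearEquiv' hᵀ (hᵀ.invertibleOfIsUnitDet hu)), ?_⟩⟩
    intro x
    have key : ∀ (w : ι → ℝ) x, QuadraticMap.weightedSumSquares ℝ w x = x ⬝ᵥ (diagonal w *ᵥ x) := by
      intro w x
      simp only [QuadraticMap.weightedSumSquares_apply, dotProduct, mulVec_diagonal, smul_eq_mul]
      exact Finset.sum_congr rfl fun i _ => by ring
    change QuadraticMap.weightedSumSquares ℝ w' (hᵀ *ᵥ x) = _
    rw [key, key, e, ← mulVec_mulVec, ← mulVec_mulVec, dotProduct_mulVec x h, ← mulVec_transpose]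
  constructor
  · rw [← QuadraticForm.sigPos_weightedSumSquares, this.sigPos_eq, QuadraticForm.sigPos_weightedSumSquares]
  · rw [← QuadraticForm.sigNeg_weightedSumSquares, this.sigNeg_eq, QuadraticForm.sigNeg_weightedSumSquares]

/-- the standard diagonal matrix. -/
noncomputable def Dc (c : ι → Fin 3) : Matrix ι ι ℝ :=
  Dg (fun i => c i = 0) - Dg (fun i => c i = 1)

/-- the cone. -/
def Cone (c : ι → Fin 3) : Set (Matrix ι ι ℝ) := {S | ∃ g, g.det ≠ 0 ∧ S = g * Dc c * gᵀ}

theorem Dc_eq (c : ι → Fin 3) :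
    Dc c = diagonal (fun i => if c i = 0 then (1 : ℝ) else if c i = 1 then -1 else 0) := by
  ext i j
  by_cases h : i = j
  · subst h
    simp only [Dc, Dg, Matrix.sub_apply, diagonal_apply_eq]
    by_cases h0 : c i = 0
    · simp [h0]
    · by_cases h1 : c i = 1 <;> simp [h0, h1]
  · simp [Dc, Dg, h]

theorem Cone.symm {c : ι → Fin 3} {S : Matrix ι ι ℝ} (hS : S ∈ Cone c) : Sᵀ = S := by
  obtain ⟨g, -, rfl⟩ := hS
  rw [Dc_eq]
  simp [mul_assoc]

theorem exists_perm (c c' : ι → Fin 3)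
    (h0 : Nat.card {i // c i = 0} = Nat.card {i // c' i = 0})
    (h1 : Nat.card {i // c i = 1} = Nat.card {i // c' i = 1}) :
    ∃ e : ι ≃ ι, ∀ i, c' (e i) = c i := by
  have key : ∀ c : ι → Fin 3, Nat.card {i // c i = 0} + Nat.card {i // c i = 1} +
      Nat.card {i // c i = 2} = Nat.card ι := by
    intro c
    rw [← Nat.card_congr (Equiv.sigmaFiberEquiv c), Nat.card_sigma, Fin.sum_univ_three]
  have h2 : Nat.card {i // c i = 2} = Nat.card {i // c' i = 2} := by
    have := key c; have := key c'; omega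
  have h : ∀ a : Fin 3, Nonempty ({i // c i = a} ≃ {i // c' i = a}) := by
    intro a
    rw [← Finite.card_eq]
    fin_cases a
    exacts [h0, h1, h2]
  exact ⟨Equiv.ofFiberEquiv fun a => (h a).some, fun i => Equiv.ofFiberEquiv_map _ i⟩

theorem Cone.spectral {c : ι → Fin 3} {S : Matrix ι ι ℝ} (hS : S ∈ Cone c) :
    ∃ U : Matrix ι ι ℝ, U * Uᵀ = 1 ∧ ∃ μ : ι → ℝ, S = U * diagonal μ * Uᵀ ∧
      (∀ i, c i = 0 → 0 < μ i) ∧ (∀ i, c i = 1 → μ i < 0) ∧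
      (∀ i, c i ≠ 0 → c i ≠ 1 → μ i = 0) := by
  obtain ⟨U, hU, μ, hμ⟩ := spectral_real S (Cone.symm hS)
  have hU' : Uᵀ * U = 1 := mul_eq_one_comm.mp hU
  obtain ⟨g, hg, e⟩ := hS
  have hdet : (Uᵀ * g).det ≠ 0 := by
    rw [det_mul]
    refine mul_ne_zero ?_ hg
    intro h
    have := congrArg det hU'
    rw [det_mul, h] at this
    simp at this
  have e2 : diagonal μ = (Uᵀ * g) *
      diagonal (fun i => if c i = 0 then (1 : ℝ) else if c i = 1 then -1 else 0) * (Uᵀ * g)ᵀ := by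
    rw [← Dc_eq, transpose_mul, transpose_transpose]
    calc diagonal μ = (Uᵀ * U) * diagonal μ * (Uᵀ * U) := by rw [hU']; simp
      _ = Uᵀ * (U * diagonal μ * Uᵀ) * U := by simp only [mul_assoc]
      _ = _ := by rw [← hμ, e]; simp only [mul_assoc]
  obtain ⟨i1, i2⟩ := inertia _ _ _ hdet e2
  classical
  let c' : ι → Fin 3 := fun i => if 0 < μ i then 0 else if μ i < 0 then 1 else 2
  obtain ⟨σ', hσ⟩ : ∃ e : ι ≃ ι, ∀ i, c' (e i) = c i := by
    apply exists_perm
    · change Set.ncard {i | c i = 0} = Set.ncard {i | c' i = 0}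
      have a1 : {i | c' i = 0} = {i | 0 < μ i} := by
        ext i
        simp only [Set.mem_ofPred_eq, c']
        split_ifs <;> simp_all
      rw [a1, i1]
      congr 1
      ext i
      simp only [Set.mem_ofPred_eq]
      split_ifs <;> simp_all
    · change Set.ncard {i | c i = 1} = Set.ncard {i | c' i = 1}
      have a1 : {i | c' i = 1} = {i | μ i < 0} := by
        ext i
        simp only [Set.mem_ofPred_eq, c']
        split_ifs <;> simp_all
        linarith
      rw [a1, i2]
      congr 1
      ext i
      simp only [Set.mem_ofPred_eq]
      split_ifs <;> simp_all
  have hc' : ∀ i, c i = if 0 < μ (σ' i) then 0 else if μ (σ' i) < 0 then 1 else 2 :=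
    fun i => (hσ i).symm
  refine ⟨U.submatrix id σ', ?_, μ ∘ σ', ?_, ?_, ?_, ?_⟩
  · rw [transpose_submatrix, submatrix_mul_equiv, hU]; simp
  · rw [hμ]
    have : diagonal (μ ∘ σ') = (diagonal μ).submatrix σ' σ' := by
      rw [submatrix_diagonal_equiv]
    rw [this, transpose_submatrix, submatrix_mul_equiv, submatrix_mul_equiv]; simp
  · intro i hi
    rw [hc'] at hi
    simp only [Function.comp]
    split_ifs at hi <;> simp_all
  · intro i hi
    rw [hc'] at hi
    simp only [Function.comp]
    split_ifs at hi <;> simp_all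
  · intro i hi hi'
    rw [hc'] at hi hi'
    simp only [Function.comp]
    split_ifs at hi hi' <;> simp_all
    linarith

/-- positive and negative parts. -/
noncomputable def pn (S : Matrix ι ι ℝ) : Matrix ι ι ℝ × Matrix ι ι ℝ :=
  (cfc (fun x : ℝ => max x 0) S, cfc (fun x : ℝ => max (-x) 0) S)

theorem continuous_pn {X : Type*} [TopologicalSpace X] 
    (a : X → Matrix ι ι ℝ) (ha : Continuous a) (hs : ∀ x, (a x)ᵀ = a x) :
    Continuous fun x => pn (a x) :=
  (continuous_matCfc (fun x : ℝ => max x 0) (by fun_prop) a ha hs).prodMk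
    (continuous_matCfc (fun x : ℝ => max (-x) 0) (by fun_prop) a ha hs)

theorem pn_conj (U : Matrix ι ι ℝ) (hU : U * Uᵀ = 1) (μ : ι → ℝ) :
    pn (U * diagonal μ * Uᵀ) = (U * diagonal (fun i => max (μ i) 0) * Uᵀ,
      U * diagonal (fun i => max (-μ i) 0) * Uᵀ) := by
  rw [pn, cfc_conj _ U hU, cfc_conj _ U hU]

theorem Qs_diagonal (P : ι → Prop) (μ : ι → ℝ) (h0 : ∀ i, ¬ P i → μ i = 0)
    (h1 : ∀ i, P i → 0 < μ i) : Qs P (diagonal μ) := by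
  refine ⟨by simp, ?_, ?_⟩
  · intro i j hi
    by_cases h : i = j
    · subst h; simp [h0 i hi]
    · simp [h]
  · rintro x ⟨i, hi, hx⟩
    simp only [dotProduct, mulVec_diagonal]
    have hn : ∀ j, 0 ≤ μ j := fun j => by
      by_cases hj : P j
      · exact (h1 j hj).le
      · exact (h0 j hj).ge
    refine Finset.sum_pos' (fun j _ => ?_) ⟨i, Finset.mem_univ _, ?_⟩
    · nlinarith [mul_nonneg (hn j) (mul_self_nonneg (x j))]
    · nlinarith [mul_pos (h1 i hi) (mul_self_pos.2 hx)]

theorem pn_mem {c : ι → Fin 3} {S : Matrix ι ι ℝ} (hS : S ∈ Cone c) :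
    pn S ∈ Cp (fun i => c i = 0) (fun i => c i = 1) := by
  obtain ⟨U, hU, μ, rfl, h0, h1, h2⟩ := Cone.spectral hS
  have hdet : U.det ≠ 0 := by
    intro h
    have := congrArg det hU
    rw [det_mul, h] at this
    simp at this
  rw [pn_conj U hU]
  refine ⟨U, Lifts_of_eq hdet ?_ ?_⟩
  · apply Qs_diagonal
    · intro i hi
      rcases eq_or_ne (c i) 1 with h | h
      · exact max_eq_right (h1 i h).le
      · simp [h2 i hi h]
    · intro i hi
      exact lt_max_of_lt_left (h0 i hi)
  · apply Qs_diagonal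
    · intro i hi
      rcases eq_or_ne (c i) 0 with h | h
      · exact max_eq_right (by linarith [h0 i h])
      · simp [h2 i h hi]
    · intro i hi
      exact lt_max_of_lt_left (by linarith [h1 i hi])

theorem pn_sub {S : Matrix ι ι ℝ} (hS : Sᵀ = S) : (pn S).1 - (pn S).2 = S := by
  obtain ⟨U, hU, μ, rfl⟩ := spectral_real S hS
  rw [pn_conj U hU, ← sub_mul, ← mul_sub, diagonal_sub]
  congr 3
  ext i
  rcases le_total (μ i) 0 with h | h
  · rw [max_eq_right h, max_eq_left (by linarith)]; ring
  · rw [max_eq_left h, max_eq_right (by linarith)]; ring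

theorem pn_orth (c : ι → Fin 3) (U : Matrix ι ι ℝ) (hU : U * Uᵀ = 1) :
    pn (U * Dc c * Uᵀ) =
      (U * Dg (fun i => c i = 0) * Uᵀ, U * Dg (fun i => c i = 1) * Uᵀ) := by
  rw [Dc_eq, pn_conj U hU]
  unfold Dg
  congr 5
  · ext i
    by_cases h0 : c i = 0
    · simp [h0]
    · by_cases h1 : c i = 1 <;> simp [h0, h1]
  · ext i
    by_cases h0 : c i = 0
    · simp [h0]
    · by_cases h1 : c i = 1 <;> simp [h0, h1]

theorem Dg_mul_zero {P N : ι → Prop} (h : ∀ i, P i → ¬ N i) {B : Matrix ι ι ℝ} (hB : Qs N B) :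
    Dg P * B = 0 := by
  classical
  ext i j
  by_cases hi : P i
  · simp [Dg, diagonal_mul, hB.2.1 i j (h i hi)]
  · simp [Dg, diagonal_mul, hi]

theorem Dg_mul {P : ι → Prop} {B : Matrix ι ι ℝ} (hB : Qs P B) : Dg P * B = B := by
  have := congrArg transpose hB.mul_Dg
  rwa [transpose_mul, hB.1, (Qs_Dg P).1] at this

theorem mul_Dg_zero {P N : ι → Prop} (h : ∀ i, P i → ¬ N i) {B : Matrix ι ι ℝ} (hB : Qs N B) :
    B * Dg P = 0 := by
  have := congrArg transpose (Dg_mul_zero h hB)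
  rwa [transpose_mul, hB.1, (Qs_Dg P).1, transpose_zero] at this

theorem exists_sqrt (M : Matrix ι ι ℝ) (hM : Mᵀ = M) (hp : ∀ x, 0 ≤ x ⬝ᵥ (M *ᵥ x)) :
    ∃ R : Matrix ι ι ℝ, Rᵀ = R ∧ R * R = M ∧ ∀ B, M * B = B * M → R * B = B * R := by
  obtain ⟨U, hU, μ, e⟩ := spectral_real M hM
  have hU' : Uᵀ * U = 1 := mul_eq_one_comm.mp hU
  have hμ : ∀ i, 0 ≤ μ i := by
    intro i
    have h1 := hp (U *ᵥ Pi.single i 1)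
    rw [e, quad_conj, vecMul_mulVec, hU', vecMul_one] at h1
    simpa using h1
  have hR : cfc Real.sqrt M = U * diagonal (fun i => √(μ i)) * Uᵀ := by rw [e, cfc_conj _ U hU]
  refine ⟨cfc Real.sqrt M, ?_, ?_, ?_⟩
  · rw [hR]; simp [mul_assoc]
  · rw [hR]
    calc _ = U * diagonal (fun i => √(μ i)) * (Uᵀ * U) * diagonal (fun i => √(μ i)) * Uᵀ := by
          simp only [mul_assoc]
      _ = _ := by
        rw [hU', mul_one, mul_assoc U, diagonal_mul_diagonal, e]
        simp only [Real.mul_self_sqrt (hμ _)]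
  · intro B hB
    exact Commute.cfc_real hB Real.sqrt

theorem sub_mem_Cone {c : ι → Fin 3} {y : Matrix ι ι ℝ × Matrix ι ι ℝ}
    (hy : y ∈ Cp (fun i => c i = 0) (fun i => c i = 1)) : y.1 - y.2 ∈ Cone c := by
  obtain ⟨g, hg, hA, hB⟩ := hy
  generalize hA0 : g⁻¹ * y.1 * g⁻¹ᵀ = A at hA
  generalize hB0 : g⁻¹ * y.2 * g⁻¹ᵀ = B at hB
  have e1 : y.1 = g * A * gᵀ := by rw [← hA0, conj_inv_conj hg]
  have e2 : y.2 = g * B * gᵀ := by rw [← hB0, conj_inv_conj hg]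
  have hZ := Qs_Dg (fun i => ¬ (c i = 0) ∧ ¬ (c i = 1))
  have hdM := sum_det_ne hA hB
  have hpM : ∀ x : ι → ℝ, 0 ≤ x ⬝ᵥ ((A + B + Dg fun i => ¬ (c i = 0) ∧ ¬ (c i = 1)) *ᵥ x) := by
    intro x
    by_cases hx : x = 0
    · simp [hx]
    · exact (sum_posDef hA hB hx).le
  have d01 : ∀ i, c i = 0 → ¬ (c i = 1) := fun i h => by rw [h]; decide
  have d10 : ∀ i, c i = 1 → ¬ (c i = 0) := fun i h => by rw [h]; decide
  have d0z : ∀ i, c i = 0 → ¬ (¬ (c i = 0) ∧ ¬ (c i = 1)) := fun i h h' => h'.1 h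
  have d1z : ∀ i, c i = 1 → ¬ (¬ (c i = 0) ∧ ¬ (c i = 1)) := fun i h h' => h'.2 h
  obtain ⟨R, hR, hRR, hc⟩ := exists_sqrt (A + B + Dg fun i => ¬ (c i = 0) ∧ ¬ (c i = 1))
    (by rw [transpose_add, transpose_add, hA.1, hB.1, hZ.1]) hpM
  have hRd : R.det ≠ 0 := by
    intro h
    rw [← hRR, det_mul, h] at hdM
    simp at hdM
  have c0 := hc (Dg fun i => c i = 0) (by
    rw [add_mul, add_mul, mul_add, mul_add, hA.mul_Dg, Dg_mul hA, Dg_mul_zero d01 hB,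
      mul_Dg_zero d01 hB, Dg_mul_zero d0z hZ, mul_Dg_zero d0z hZ])
  have c1 := hc (Dg fun i => c i = 1) (by
    rw [add_mul, add_mul, mul_add, mul_add, hB.mul_Dg, Dg_mul hB, Dg_mul_zero d10 hA,
      mul_Dg_zero d10 hA, Dg_mul_zero d1z hZ, mul_Dg_zero d1z hZ])
  have f : R * Dc c * Rᵀ = A - B := by
    rw [Dc, hR, mul_sub, sub_mul, c0, c1, mul_assoc, mul_assoc, hRR, mul_add, mul_add, mul_add,
      mul_add, Dg_mul hA, Dg_mul hB, Dg_mul_zero d01 hB, Dg_mul_zero d10 hA,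
      Dg_mul_zero d1z hZ, Dg_mul_zero d0z hZ]
    simp
  refine ⟨g * R, by rw [det_mul]; exact mul_ne_zero hg hRd, ?_⟩
  rw [e1, e2, transpose_mul, ← sub_mul, ← mul_sub, ← f]
  simp only [mul_assoc]
end spectral
end TubeAux

namespace TubeAux
open unitInterval Topology
section cover

theorem sgn_eq {J : Type*} (v v' : J → ℝ) (h : ∀ i j, v i * v j = v' i * v' j)
    (hv : ∃ i, v i ≠ 0) : ∃ a : ℤˣ, v = ((a : ℤ) : ℝ) • v' := by
  obtain ⟨i, hi⟩ := hv
  have h1 : (v i - v' i) * (v i + v' i) = 0 := by have := h i i; linarith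
  rcases mul_eq_zero.1 h1 with h2 | h2
  · refine ⟨1, ?_⟩
    ext j
    have := h i j
    have e : v' i = v i := by linarith
    rw [e] at this
    simpa using mul_left_cancel₀ hi this
  · refine ⟨-1, ?_⟩
    ext j
    have := h i j
    have e : v' i = - v i := by linarith
    rw [e] at this
    have : v i * v j = v i * (- v' j) := by linarith
    simpa using mul_left_cancel₀ hi this

variable {X : Type*} [TopologicalSpace X] {J₁ J₂ : Type*}

/-- `v` is a square root of the rank one matrix `m`. -/
def IsRt {J : Type*} (m : J → J → ℝ) (v : J → ℝ) : Prop := ∀ i j, v i * v j = m i j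

theorem IsRt.smul {J : Type*} {m : J → J → ℝ} {v : J → ℝ} (h : IsRt m v) (a : ℤˣ) :
    IsRt m (((a : ℤ) : ℝ) • v) := by
  intro i j
  rw [← h i j]
  rcases Int.units_eq_one_or a with rfl | rfl <;> simp

/-- the space of square roots. -/
def Cov (M₁ : X → J₁ → J₁ → ℝ) (M₂ : X → J₂ → J₂ → ℝ) : Type _ :=
  {e : X × (J₁ → ℝ) × (J₂ → ℝ) // IsRt (M₁ e.1) e.2.1 ∧ IsRt (M₂ e.1) e.2.2}

variable {M₁ : X → J₁ → J₁ → ℝ} {M₂ : X → J₂ → J₂ → ℝ}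

instance : TopologicalSpace (Cov M₁ M₂) :=
  inferInstanceAs (TopologicalSpace {e : X × (J₁ → ℝ) × (J₂ → ℝ) //
    IsRt (M₁ e.1) e.2.1 ∧ IsRt (M₂ e.1) e.2.2})

/-- the projection. -/
def Cov.pr (e : Cov M₁ M₂) : X := e.1.1

instance : MulAction (ℤˣ × ℤˣ) (Cov M₁ M₂) where
  smul g e := ⟨(e.1.1, ((g.1 : ℤ) : ℝ) • e.1.2.1, ((g.2 : ℤ) : ℝ) • e.1.2.2),
    e.2.1.smul _, e.2.2.smul _⟩
  one_smul e := by
    apply Subtype.ext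
    change (e.1.1, (((1 : ℤˣ) : ℤ) : ℝ) • e.1.2.1, (((1 : ℤˣ) : ℤ) : ℝ) • e.1.2.2) = e.1
    simp
  mul_smul g h e := by
    apply Subtype.ext
    change (e.1.1, (((g.1 * h.1 : ℤˣ) : ℤ) : ℝ) • e.1.2.1, (((g.2 * h.2 : ℤˣ) : ℤ) : ℝ) • e.1.2.2) =
      (e.1.1, ((g.1 : ℤ) : ℝ) • ((h.1 : ℤ) : ℝ) • e.1.2.1,
        ((g.2 : ℤ) : ℝ) • ((h.2 : ℤ) : ℝ) • e.1.2.2)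
    simp [mul_smul]

theorem Cov.smul_val (g : ℤˣ × ℤˣ) (e : Cov M₁ M₂) :
    (g • e).1 = (e.1.1, ((g.1 : ℤ) : ℝ) • e.1.2.1, ((g.2 : ℤ) : ℝ) • e.1.2.2) := rfl

theorem Cov.continuous_val : Continuous (Subtype.val : Cov M₁ M₂ → X × (J₁ → ℝ) × (J₂ → ℝ)) :=
  continuous_subtype_val

theorem Cov.continuous_pr : Continuous (Cov.pr : Cov M₁ M₂ → X) :=
  continuous_fst.comp Cov.continuous_val

theorem rt_section {J : Type*} {m : J → J → ℝ} (hm : ∃ v : J → ℝ, IsRt m v) (i : J)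
    (hi : m i i ≠ 0) (s : ℝ) (hs : s * s = 1) :
    IsRt m fun j => m i j / (s * √(m i i)) := by
  obtain ⟨v, hv⟩ := hm
  have hp : 0 ≤ m i i := by rw [← hv]; exact mul_self_nonneg _
  have hq : √(m i i) ≠ 0 := (Real.sqrt_ne_zero hp).2 hi
  have hs' : s ≠ 0 := by rintro rfl; simp at hs
  intro j k
  have e : √(m i i) * √(m i i) = m i i := Real.mul_self_sqrt hp
  rw [div_mul_div_comm]
  have : s * √(m i i) * (s * √(m i i)) = m i i := by linear_combination (√(m i i))^2 * hs + e
  rw [this, div_eq_iff hi, ← hv, ← hv, ← hv, ← hv]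
  ring

theorem exists_sgn {J : Type*} {m : J → J → ℝ} {v : J → ℝ} (hv : IsRt m v) (i : J)
    (hi : v i ≠ 0) : ∃ s : ℝ, s * s = 1 ∧ (fun j => m i j / (s * √(m i i))) = v := by
  have e : √(m i i) = |v i| := by rw [← hv, Real.sqrt_mul_self_eq_abs]
  rcases lt_or_gt_of_ne hi with h | h
  · refine ⟨-1, by norm_num, ?_⟩
    ext j
    rw [e, abs_of_neg h, ← hv]
    field_simp
  · refine ⟨1, by norm_num, ?_⟩
    ext j
    rw [e, abs_of_pos h, ← hv]
    field_simp


theorem Cov.ne₁ (r₁ : ∀ x, ∃ v : J₁ → ℝ, (∃ i, v i ≠ 0) ∧ IsRt (M₁ x) v)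
    {x : X} {v : J₁ → ℝ} (h : IsRt (M₁ x) v) : ∃ i, v i ≠ 0 := by
  obtain ⟨v', ⟨i, hi⟩, hv⟩ := r₁ x
  refine ⟨i, fun h0 => hi ?_⟩
  have := h i i
  rw [← hv, h0] at this
  have : v' i * v' i = 0 := by linarith
  exact mul_self_eq_zero.1 this

theorem Cov.isOpenMap_pr
  (h₁ : ∀ i j, Continuous fun x => M₁ x i j) (h₂ : ∀ i j, Continuous fun x => M₂ x i j)
  (r₁ : ∀ x, ∃ v : J₁ → ℝ, (∃ i, v i ≠ 0) ∧ IsRt (M₁ x) v)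
  (r₂ : ∀ x, ∃ v : J₂ → ℝ, (∃ i, v i ≠ 0) ∧ IsRt (M₂ x) v) :
    IsOpenMap (Cov.pr : Cov M₁ M₂ → X) := by
  refine IsOpenMap.of_nhds_le fun e => ?_
  obtain ⟨i, hi⟩ := Cov.ne₁ r₁ e.2.1
  obtain ⟨j, hj⟩ := Cov.ne₁ r₂ e.2.2
  obtain ⟨s, hs, hs'⟩ := exists_sgn e.2.1 i hi
  obtain ⟨t, ht, ht'⟩ := exists_sgn e.2.2 j hj
  let V : Set X := {y | M₁ y i i ≠ 0 ∧ M₂ y j j ≠ 0}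
  have hV : IsOpen V := ((h₁ i i).isOpen_preimage _ isOpen_ne).inter
    ((h₂ j j).isOpen_preimage _ isOpen_ne)
  let sec : V → Cov M₁ M₂ := fun y => ⟨(y.1, fun k => M₁ y.1 i k / (s * √(M₁ y.1 i i)),
    fun k => M₂ y.1 j k / (t * √(M₂ y.1 j j))),
    rt_section ((r₁ y.1).imp fun _ h => h.2) i y.2.1 s hs,
    rt_section ((r₂ y.1).imp fun _ h => h.2) j y.2.2 t ht⟩
  have sne : s ≠ 0 := by rintro rfl; simp at hs
  have tne : t ≠ 0 := by rintro rfl; simp at ht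
  have hsec : Continuous sec := by
    refine Continuous.subtype_mk (continuous_subtype_val.prodMk
      ((continuous_pi fun k => ?_).prodMk (continuous_pi fun k => ?_))) _
    · refine Continuous.div ((h₁ i k).comp continuous_subtype_val)
        (continuous_const.mul ((h₁ i i).comp continuous_subtype_val).sqrt) fun y => ?_
      obtain ⟨v, -, hv⟩ := r₁ y.1
      refine mul_ne_zero sne ((Real.sqrt_ne_zero ?_).2 y.2.1)
      rw [← hv]; exact mul_self_nonneg _
    · refine Continuous.div ((h₂ j k).comp continuous_subtype_val)
        (continuous_const.mul ((h₂ j j).comp continuous_subtype_val).sqrt) fun y => ?_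
      obtain ⟨v, -, hv⟩ := r₂ y.1
      refine mul_ne_zero tne ((Real.sqrt_ne_zero ?_).2 y.2.2)
      rw [← hv]; exact mul_self_nonneg _
  have hx : e.1.1 ∈ V := ⟨by rw [← e.2.1 i i]; exact mul_self_ne_zero.2 hi,
    by rw [← e.2.2 j j]; exact mul_self_ne_zero.2 hj⟩
  have he : sec ⟨e.1.1, hx⟩ = e := by
    apply Subtype.ext
    exact Prod.ext rfl (Prod.ext hs' ht')
  calc 𝓝 e.pr = Filter.map (Subtype.val : V → X) (𝓝 ⟨e.1.1, hx⟩) :=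
        (hV.isOpenEmbedding_subtypeVal.map_nhds_eq ⟨e.1.1, hx⟩).symm
    _ = Filter.map Cov.pr (Filter.map sec (𝓝 ⟨e.1.1, hx⟩)) := by rw [Filter.map_map]; rfl
    _ ≤ Filter.map Cov.pr (𝓝 e) := by
      refine Filter.map_mono ?_
      have := hsec.tendsto ⟨e.1.1, hx⟩
      rwa [he] at this

theorem unit_eq_one {a : ℤˣ} {x y : ℝ} (h1 : 0 < x * y) (h2 : 0 < ((a : ℤ) : ℝ) * x * y) :
    a = 1 := by
  rcases Int.units_eq_one_or a with rfl | rfl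
  · rfl
  · simp at h2; linarith

theorem Cov.isQuotientCoveringMap
  (h₁ : ∀ i j, Continuous fun x => M₁ x i j) (h₂ : ∀ i j, Continuous fun x => M₂ x i j)
  (r₁ : ∀ x, ∃ v : J₁ → ℝ, (∃ i, v i ≠ 0) ∧ IsRt (M₁ x) v)
  (r₂ : ∀ x, ∃ v : J₂ → ℝ, (∃ i, v i ≠ 0) ∧ IsRt (M₂ x) v) :
    IsQuotientCoveringMap (Cov.pr : Cov M₁ M₂ → X) (ℤˣ × ℤˣ) where
  toIsQuotientMap := (Cov.isOpenMap_pr h₁ h₂ r₁ r₂).isQuotientMap Cov.continuous_pr (by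
    intro x
    obtain ⟨v, -, hv⟩ := r₁ x
    obtain ⟨w, -, hw⟩ := r₂ x
    exact ⟨⟨(x, v, w), hv, hw⟩, rfl⟩)
  continuous_const_smul g := by
    refine Continuous.subtype_mk (f := fun e : Cov M₁ M₂ => (e.1.1, ((g.1 : ℤ) : ℝ) • e.1.2.1, ((g.2 : ℤ) : ℝ) • e.1.2.2)) ?_ _
    have := Cov.continuous_val (M₁ := M₁) (M₂ := M₂)
    fun_prop
  apply_eq_iff_mem_orbit {e₁ e₂} := by
    constructor
    · intro h
      have h' : e₁.1.1 = e₂.1.1 := h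
      have a1 := e₁.2.1
      have a2 := e₁.2.2
      rw [h'] at a1 a2
      obtain ⟨a, ha⟩ := sgn_eq e₁.1.2.1 e₂.1.2.1 (fun i j => (a1 i j).trans (e₂.2.1 i j).symm)
        (Cov.ne₁ r₁ a1)
      obtain ⟨b, hb⟩ := sgn_eq e₁.1.2.2 e₂.1.2.2 (fun i j => (a2 i j).trans (e₂.2.2 i j).symm)
        (Cov.ne₁ r₂ a2)
      refine ⟨(a, b), ?_⟩
      apply Subtype.ext
      exact Prod.ext h'.symm (Prod.ext ha.symm hb.symm)
    · rintro ⟨g, rfl⟩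
      rfl
  disjoint e := by
    obtain ⟨i, hi⟩ := Cov.ne₁ r₁ e.2.1
    obtain ⟨j, hj⟩ := Cov.ne₁ r₂ e.2.2
    have hc := Cov.continuous_val (M₁ := M₁) (M₂ := M₂)
    refine ⟨{e' | 0 < e'.1.2.1 i * e.1.2.1 i ∧ 0 < e'.1.2.2 j * e.1.2.2 j}, ?_, ?_⟩
    · refine IsOpen.mem_nhds ?_ ⟨mul_self_pos.2 hi, mul_self_pos.2 hj⟩
      have c1 : Continuous fun e' : Cov M₁ M₂ => e'.1.2.1 i * e.1.2.1 i := by fun_prop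
      have c2 : Continuous fun e' : Cov M₁ M₂ => e'.1.2.2 j * e.1.2.2 j := by fun_prop
      exact (isOpen_lt continuous_const c1).inter (isOpen_lt continuous_const c2)
    · rintro ⟨a, b⟩ ⟨_, ⟨e', ⟨h1, h2⟩, rfl⟩, h3, h4⟩
      exact Prod.ext (unit_eq_one h1 h3) (unit_eq_one h2 h4)

/-- a path together with a lift. -/
def LiftsTo (x₀ : X) (γ : Path x₀ x₀) (M₁ : X → J₁ → J₁ → ℝ) (M₂ : X → J₂ → J₂ → ℝ)
    (v v' : J₁ → ℝ) (w w' : J₂ → ℝ) : Prop :=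
  ∃ f : I → J₁ → ℝ, ∃ g : I → J₂ → ℝ, Continuous f ∧ Continuous g ∧
    (∀ t, IsRt (M₁ (γ t)) (f t)) ∧ (∀ t, IsRt (M₂ (γ t)) (g t)) ∧
    f 0 = v ∧ f 1 = v' ∧ g 0 = w ∧ g 1 = w'

theorem klein_of_data
  (h₁ : ∀ i j, Continuous fun x => M₁ x i j) (h₂ : ∀ i j, Continuous fun x => M₂ x i j)
  (r₁ : ∀ x, ∃ v : J₁ → ℝ, (∃ i, v i ≠ 0) ∧ IsRt (M₁ x) v)
  (r₂ : ∀ x, ∃ v : J₂ → ℝ, (∃ i, v i ≠ 0) ∧ IsRt (M₂ x) v)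
    (x₀ : X) (v₀ : J₁ → ℝ) (w₀ : J₂ → ℝ)
    (hv₀ : IsRt (M₁ x₀) v₀) (hw₀ : IsRt (M₂ x₀) w₀)
    (hA : ∃ γ : Path x₀ x₀, LiftsTo x₀ γ M₁ M₂ v₀ (-v₀) w₀ w₀)
    (hB : ∃ γ : Path x₀ x₀, LiftsTo x₀ γ M₁ M₂ v₀ v₀ w₀ (-w₀))
    (hN : ∀ γ : Path x₀ x₀, LiftsTo x₀ γ M₁ M₂ v₀ v₀ w₀ w₀ → γ.Homotopic (Path.refl x₀)) :
    Nonempty (FundamentalGroup X x₀ ≃* (ℤˣ × ℤˣ)ᵐᵒᵖ) := by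
  have hp := Cov.isQuotientCoveringMap h₁ h₂ r₁ r₂
  let e0 : Cov M₁ M₂ := ⟨(x₀, v₀, w₀), hv₀, hw₀⟩
  let e : (Cov.pr : Cov M₁ M₂ → X) ⁻¹' {x₀} := ⟨e0, rfl⟩
  let φ := hp.fundamentalGroupToMulOpposite e
  have key : ∀ g : ℤˣ × ℤˣ, ∀ γ : Path x₀ x₀,
      LiftsTo x₀ γ M₁ M₂ v₀ (((g.1 : ℤ) : ℝ) • v₀) w₀ (((g.2 : ℤ) : ℝ) • w₀) →
      ∃ a, φ a = MulOpposite.op g := by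
    rintro g γ ⟨f, k, hf, hk, h1, h2, f0, f1, k0, k1⟩
    let Γ : Path e0 (g • e0) :=
      { toFun := fun t => ⟨(γ t, f t, k t), h1 t, h2 t⟩
        continuous_toFun := Continuous.subtype_mk (by fun_prop) _
        source' := Subtype.ext (Prod.ext γ.source (Prod.ext f0 k0))
        target' := Subtype.ext (Prod.ext γ.target (Prod.ext f1 k1)) }
    refine ⟨.fromPath (.mk γ), ?_⟩
    rw [hp.fundamentalGroupToMulOpposite_apply_eq_Iff]
    have := hp.isCoveringMap.monodromy_eq_of_map_eq (x := x₀) (y := x₀)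
      (γ := .mk γ) (ex := e) (ey := ⟨g • e0, rfl⟩) (Γ := .mk Γ) rfl
    rw [this]
    rfl
  refine ⟨MulEquiv.ofBijective φ ⟨?_, ?_⟩⟩
  · rw [injective_iff_map_eq_one]
    intro a ha
    rw [hp.fundamentalGroupToMulOpposite_eq_one_iff] at ha
    obtain ⟨γ⟩ := a
    have h1 := congrArg Subtype.val ha
    have hγ0 : (γ : C(I, X)) 0 = Cov.pr e0 := γ.source
    let Γ := hp.isCoveringMap.liftPath (γ : C(I, X)) e0 hγ0
    have hΓ : ∀ t, (Γ t).1.1 = γ t := fun t =>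
      congrFun (hp.isCoveringMap.liftPath_lifts (γ : C(I, X)) e0 hγ0) t
    have hΓ0 : Γ 0 = e0 := hp.isCoveringMap.liftPath_zero (γ : C(I, X)) e0 hγ0
    have hΓ1 : Γ 1 = e0 := h1
    have hc := Cov.continuous_val (M₁ := M₁) (M₂ := M₂)
    have hΓc : Continuous fun t => (Γ t).1 := hc.comp Γ.continuous
    have := hN γ ⟨fun t => (Γ t).1.2.1, fun t => (Γ t).1.2.2, by fun_prop, by fun_prop,
      fun t => by rw [← hΓ]; exact (Γ t).2.1, fun t => by rw [← hΓ]; exact (Γ t).2.2,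
      congrArg (fun e : Cov M₁ M₂ => e.1.2.1) hΓ0, congrArg (fun e : Cov M₁ M₂ => e.1.2.1) hΓ1,
      congrArg (fun e : Cov M₁ M₂ => e.1.2.2) hΓ0, congrArg (fun e : Cov M₁ M₂ => e.1.2.2) hΓ1⟩
    exact Quotient.sound this
  · obtain ⟨γ, hγ⟩ := hA
    obtain ⟨δ, hδ⟩ := hB
    obtain ⟨a, ha⟩ := key (-1, 1) γ (by simpa using hγ)
    obtain ⟨b, hb⟩ := key (1, -1) δ (by simpa using hδ)
    intro g
    obtain ⟨⟨g1, g2⟩⟩ := g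
    rcases Int.units_eq_one_or g1 with rfl | rfl <;> rcases Int.units_eq_one_or g2 with rfl | rfl
    · exact ⟨1, map_one φ⟩
    · exact ⟨b, hb⟩
    · exact ⟨a, ha⟩
    · exact ⟨a * b, by rw [map_mul, ha, hb]; rfl⟩
end cover
end TubeAux

namespace TubeAux
open unitInterval Topology
section tube
variable {ι : Type*} [Fintype ι] [DecidableEq ι]

/-- The tube over the cone. -/
def Tb (c : ι → Fin 3) : Set (Matrix ι ι ℂ) := {z | zᵀ = z ∧ z.map Complex.re ∈ Cone c}

theorem map_re_ofReal (S : Matrix ι ι ℝ) : (S.map Complex.ofReal).map Complex.re = S := by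
  ext i j; simp

theorem ofReal_mem {c : ι → Fin 3} {S : Matrix ι ι ℝ} (hS : S ∈ Cone c) :
    S.map Complex.ofReal ∈ Tb c := by
  refine ⟨?_, by rwa [map_re_ofReal]⟩
  rw [← transpose_map, Cone.symm hS]

theorem Dc_mem (c : ι → Fin 3) : Dc c ∈ Cone c := ⟨1, by simp, by simp⟩

/-- the base point of the tube -/
noncomputable def bpt (c : ι → Fin 3) : Tb c := ⟨(Dc c).map Complex.ofReal, ofReal_mem (Dc_mem c)⟩

/-- minors of a matrix -/
def mn (c : ι → Fin 3) (a : Fin 3) (A : Matrix ι ι ℝ) (S J : {i // c i = a} → ι) : ℝ :=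
  (A.submatrix S J).det

theorem continuous_mn (c : ι → Fin 3) (a : Fin 3) (S J : {i // c i = a} → ι) :
    Continuous fun A : Matrix ι ι ℝ => mn c a A S J := by
  unfold mn; fun_prop

theorem continuous_um (c : ι → Fin 3) (a : Fin 3) :
    Continuous fun A : Matrix ι ι ℝ => um c a A := by
  unfold um; fun_prop

theorem continuous_re : Continuous fun z : Matrix ι ι ℂ => z.map Complex.re :=
  continuous_id.matrix_map Complex.continuous_re

theorem continuous_ofR : Continuous fun z : Matrix ι ι ℝ => z.map Complex.ofReal :=
  continuous_id.matrix_map Complex.continuous_ofReal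

theorem continuous_pnT (c : ι → Fin 3) : Continuous fun x : Tb c => pn (x.1.map Complex.re) :=
  continuous_pn _ (continuous_re.comp continuous_subtype_val) fun x => Cone.symm x.2.2

theorem exists_rt (c : ι → Fin 3) (a : Fin 3) {g A : Matrix ι ι ℝ} (hg : g.det ≠ 0)
    (hA : Qs (fun i => c i = a) (g⁻¹ * A * g⁻¹ᵀ)) :
    ∃ v : ({i // c i = a} → ι) → ℝ, (∃ S, v S ≠ 0) ∧ IsRt (mn c a A) v := by
  have hp := det_block_pos c a _ hA
  obtain ⟨S, hS⟩ := exists_um_ne c a hg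
  refine ⟨fun S => Real.sqrt ((g⁻¹ * A * g⁻¹ᵀ).toSquareBlock c a).det * um c a g S,
    ⟨S, mul_ne_zero (Real.sqrt_pos.2 hp).ne' hS⟩, ?_⟩
  intro S J
  have := minor_conj c a g _ hA S J
  rw [conj_inv_conj hg] at this
  rw [mn, this]
  calc _ = um c a g S * (Real.sqrt ((g⁻¹ * A * g⁻¹ᵀ).toSquareBlock c a).det *
        Real.sqrt ((g⁻¹ * A * g⁻¹ᵀ).toSquareBlock c a).det) * um c a g J := by ring
    _ = _ := by rw [Real.mul_self_sqrt hp.le]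

theorem block_Dg (c : ι → Fin 3) (a : Fin 3) :
    ((Dg (fun i => c i = a)).toSquareBlock c a) = 1 := by
  ext i j
  have := i.2
  simp [toSquareBlock, toSquareBlockProp, Dg, Matrix.one_apply, diagonal_apply, Subtype.ext_iff, i.2]

theorem isRt_Dg (c : ι → Fin 3) (a : Fin 3) (U : Matrix ι ι ℝ) :
    IsRt (mn c a (U * Dg (fun i => c i = a) * Uᵀ)) (um c a U) := by
  intro S J
  rw [mn, minor_conj c a U _ (Qs_Dg _), block_Dg]; simp

theorem isRt_orth0 (c : ι → Fin 3) (U : Matrix ι ι ℝ) (hU : U * Uᵀ = 1) :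
    IsRt (mn c 0 (pn (U * Dc c * Uᵀ)).1) (um c 0 U) := by
  rw [pn_orth c U hU]; exact isRt_Dg c 0 U

theorem isRt_orth1 (c : ι → Fin 3) (U : Matrix ι ι ℝ) (hU : U * Uᵀ = 1) :
    IsRt (mn c 1 (pn (U * Dc c * Uᵀ)).2) (um c 1 U) := by
  rw [pn_orth c U hU]; exact isRt_Dg c 1 U

theorem pn_Dc (c : ι → Fin 3) : pn (Dc c) = (Dg (fun i => c i = 0), Dg (fun i => c i = 1)) := by
  have := pn_orth c 1 (by simp)
  simpa using this

/-- reflections -/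
def Hh (v : ι → ℝ) : Matrix ι ι ℝ := 1 - (2 : ℝ) • vecMulVec v v

theorem Hh_transpose (v : ι → ℝ) : (Hh v)ᵀ = Hh v := by
  simp [Hh, transpose_vecMulVec]

theorem Hh_sq (v : ι → ℝ) (hv : v ⬝ᵥ v = 1) : Hh v * Hh v = 1 := by
  simp only [Hh, sub_mul, mul_sub, one_mul, mul_one, smul_mul_assoc, mul_smul_comm,
    vecMulVec_mul_vecMulVec, hv, one_smul]
  module

theorem Hh_single (i : ι) : Hh (Pi.single i 1) = diagonal (fun k => if k = i then (-1 : ℝ) else 1) := by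
  ext a b
  by_cases h : a = b
  · subst h
    by_cases h' : a = i
    · subst h'; simp [Hh, vecMulVec_apply]; norm_num
    · simp [Hh, vecMulVec_apply, h']
  · by_cases h' : a = i
    · subst h'; simp [Hh, vecMulVec_apply, h, Ne.symm h, Pi.single_apply]
    · simp [Hh, vecMulVec_apply, h, h', Pi.single_apply]

/-- rotation path -/
noncomputable def rot (i l : ι) (t : I) : Matrix ι ι ℝ :=
  Hh (Real.cos (Real.pi / 2 * t) • Pi.single l 1 + Real.sin (Real.pi / 2 * t) • Pi.single i 1) *
    Hh (Pi.single l 1)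

theorem continuous_rot (i l : ι) : Continuous (rot i l) := by
  unfold rot Hh
  have : Continuous fun t : I => (Real.cos (Real.pi / 2 * t) • Pi.single l 1 +
    Real.sin (Real.pi / 2 * t) • Pi.single i 1 : ι → ℝ) := by fun_prop
  exact (continuous_const.sub ((this.matrix_vecMulVec this).const_smul (2 : ℝ))).mul continuous_const

theorem rot_zero (i l : ι) : rot i l 0 = 1 := by
  have : (Pi.single l 1 : ι → ℝ) ⬝ᵥ Pi.single l 1 = 1 := by simp
  simp [rot, Hh_sq _ this]

theorem rot_one {i l : ι} (h : i ≠ l) : rot i l 1 =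
    diagonal (fun k => if k = i ∨ k = l then (-1 : ℝ) else 1) := by
  simp only [rot, Set.Icc.coe_one, mul_one, Real.cos_pi_div_two, Real.sin_pi_div_two, zero_smul,
    zero_add, one_smul, Hh_single, diagonal_mul_diagonal]
  congr 1
  ext k
  by_cases h1 : k = i
  · subst h1; simp [h]
  · simp [h1]

theorem rot_orth {i l : ι} (h : i ≠ l) (t : I) : rot i l t * (rot i l t)ᵀ = 1 := by
  have h1 : (Pi.single l 1 : ι → ℝ) ⬝ᵥ Pi.single l 1 = 1 := by simp
  rw [rot, transpose_mul, Hh_transpose, Hh_transpose, mul_assoc, ← mul_assoc (Hh (Pi.single l 1)),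
    Hh_sq _ h1, one_mul, Hh_sq]
  simp [add_dotProduct, dotProduct_add, h, h.symm]
  nlinarith [Real.sin_sq_add_cos_sq (Real.pi / 2 * t)]

theorem orth_det {U : Matrix ι ι ℝ} (hU : U * Uᵀ = 1) : U.det ≠ 0 := by
  intro h
  have := congrArg det hU
  simp [h] at this

theorem diag_conj_Dc (c : ι → Fin 3) (d : ι → ℝ) (hd : ∀ i, d i * d i = 1) :
    diagonal d * Dc c * (diagonal d)ᵀ = Dc c := by
  rw [Dc_eq, diagonal_transpose, diagonal_mul_diagonal, diagonal_mul_diagonal]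
  congr 1
  ext i
  rw [mul_right_comm, hd, one_mul]

/-- rotation loop -/
noncomputable def rotLoop (c : ι → Fin 3) {i l : ι} (h : i ≠ l) : Path (bpt c) (bpt c) where
  toFun t := ⟨(rot i l t * Dc c * (rot i l t)ᵀ).map Complex.ofReal,
    ofReal_mem ⟨_, orth_det (rot_orth h t), rfl⟩⟩
  continuous_toFun := by
    refine Continuous.subtype_mk (continuous_ofR.comp ?_) _
    have := continuous_rot i l
    fun_prop
  source' := by
    refine Subtype.ext ?_
    simp [rot_zero, bpt]
  target' := by
    refine Subtype.ext ?_
    simp only [bpt, rot_one h]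
    rw [diag_conj_Dc]
    intro k; split_ifs <;> norm_num

theorem um_rot_one (c : ι → Fin 3) (a : Fin 3) {i l : ι} (h : i ≠ l) (hl : c l ≠ a) :
    um c a (rot i l 1) = if c i = a then - um c a 1 else um c a 1 := by
  have hk : Ks (fun i => c i = a) (rot i l 1) := by
    rw [rot_one h]
    intro x y hy hx
    refine diagonal_apply_ne _ ?_
    rintro rfl; exact hx hy
  have hb : ((rot i l 1).toSquareBlock c a) =
      diagonal (fun k : {k // c k = a} => if k.1 = i then (-1 : ℝ) else 1) := by
    ext x y
    rw [rot_one h]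
    have : x.1 ≠ l := by rintro rfl; exact hl x.2
    simp [toSquareBlock, toSquareBlockProp, diagonal_apply, Subtype.ext_iff, this]
  ext S
  have := um_mul c a 1 (rot i l 1) hk S
  rw [one_mul] at this
  rw [this, hb, det_diagonal]
  split_ifs with hi
  · have : ∏ k : {k // c k = a}, (if k.1 = i then (-1 : ℝ) else 1) = -1 := by
      rw [Finset.prod_eq_single (⟨i, hi⟩ : {k // c k = a})]
      · simp
      · intro b _ hb
        rw [if_neg]; intro hh; exact hb (Subtype.ext hh)
      · simp
    rw [this]; simp
  · rw [Finset.prod_eq_one]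
    · simp
    · intro k _
      rw [if_neg]; intro hh; exact hi (hh ▸ k.2)

theorem rot_lifts (c : ι → Fin 3) {i l : ι} (h : i ≠ l) :
    LiftsTo (bpt c) (rotLoop c h) (fun x => mn c 0 (pn (x.1.map Complex.re)).1)
      (fun x => mn c 1 (pn (x.1.map Complex.re)).2) (um c 0 1) (um c 0 (rot i l 1))
      (um c 1 1) (um c 1 (rot i l 1)) := by
  refine ⟨fun t => um c 0 (rot i l t), fun t => um c 1 (rot i l t),
    (continuous_um c 0).comp (continuous_rot i l), (continuous_um c 1).comp (continuous_rot i l),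
    ?_, ?_, by simp only [rot_zero], rfl, by simp only [rot_zero], rfl⟩
  · intro t
    have := isRt_orth0 c _ (rot_orth h t)
    rw [← map_re_ofReal (rot i l t * Dc c * (rot i l t)ᵀ)] at this
    exact this
  · intro t
    have := isRt_orth1 c _ (rot_orth h t)
    rw [← map_re_ofReal (rot i l t * Dc c * (rot i l t)ᵀ)] at this
    exact this

theorem null_in_Tb (c : ι → Fin 3) {i j : ι} (hij : i ≠ j) (hc : c i = c j)
    (γ : Path (bpt c) (bpt c))
    (h : LiftsTo (bpt c) γ (fun x => mn c 0 (pn (x.1.map Complex.re)).1)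
      (fun x => mn c 1 (pn (x.1.map Complex.re)).2) (um c 0 1) (um c 0 1)
      (um c 1 1) (um c 1 1)) : γ.Homotopic (Path.refl _) := by
  obtain ⟨v, w, hv, hw, hvA, hwA, hv0, hv1, hw0, hw1⟩ := h
  have hb : pn ((bpt c).1.map Complex.re) = (Dg (fun i => c i = 0), Dg (fun i => c i = 1)) := by
    rw [bpt, map_re_ofReal, pn_Dc]
  let δ : Path (baseC (fun i => c i = 0) (fun i => c i = 1)) (baseC (fun i => c i = 0) (fun i => c i = 1)) :=
    { toFun := fun t => ⟨pn ((γ t).1.map Complex.re), pn_mem (γ t).2.2⟩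
      continuous_toFun := Continuous.subtype_mk ((continuous_pnT c).comp γ.continuous) _
      source' := by
        refine Subtype.ext ?_
        simp only [γ.source, hb]
      target' := by
        refine Subtype.ext ?_
        simp only [γ.target, hb] }
  have hδ : δ.Homotopic (Path.refl _) := by
    refine null_in_Cp c hij hc _ _ rfl rfl δ ?_
    intro g hg hg0 hL hP hN
    exact ⟨det_pos_of_path c 0 g (fun t => (pn ((γ t).1.map Complex.re)).1) hg (fun t => (hL t).1)
        (fun t => (hL t).2.1) v hv hvA hv0 hv1 hg0 hP,
      det_pos_of_path c 1 g (fun t => (pn ((γ t).1.map Complex.re)).2) hg (fun t => (hL t).1)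
        (fun t => (hL t).2.2) w hw hwA hw0 hw1 hg0 hN⟩
  -- map back
  obtain ⟨F⟩ := hδ
  have hfix : ((Dg (fun i => c i = 0) - Dg (fun i => c i = 1) : Matrix ι ι ℝ)).map Complex.ofReal
    = (bpt c).1 := rfl
  have hcont : Continuous fun p : I × I => ((F p).1.1 - (F p).1.2).map Complex.ofReal := by
    refine continuous_ofR.comp ?_
    have : Continuous fun p : I × I => (F p).1 := continuous_subtype_val.comp F.continuous
    exact (continuous_fst.comp this).sub (continuous_snd.comp this)
  let γr : Path (bpt c) (bpt c) :=
    { toFun := fun t => ⟨((γ t).1.map Complex.re).map Complex.ofReal, ofReal_mem (γ t).2.2⟩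
      continuous_toFun := Continuous.subtype_mk (continuous_ofR.comp (continuous_re.comp
        (continuous_subtype_val.comp γ.continuous))) _
      source' := by
        refine Subtype.ext ?_
        change ((γ 0).1.map Complex.re).map Complex.ofReal = (bpt c).1
        rw [γ.source]
        simp only [bpt, map_re_ofReal]
      target' := by
        refine Subtype.ext ?_
        change ((γ 1).1.map Complex.re).map Complex.ofReal = (bpt c).1
        rw [γ.target]
        simp only [bpt, map_re_ofReal] }
  have hbr : ((bpt c).1.map Complex.re).map Complex.ofReal = (bpt c).1 := by
    simp only [bpt, map_re_ofReal]
  have h1 : γ.Homotopic γr := by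
    refine homotopic_of_family γ γr
      (fun s t => (1 - (s : ℝ)) • (γ t).1 + (s : ℝ) • ((γ t).1.map Complex.re).map Complex.ofReal)
      ?_ ?_ ?_ ?_ ?_ ?_
    · have h1 : Continuous fun p : I × I => (γ p.2).1 :=
        continuous_subtype_val.comp (γ.continuous.comp continuous_snd)
      have h2 : Continuous fun p : I × I => ((γ p.2).1.map Complex.re).map Complex.ofReal :=
        continuous_ofR.comp (continuous_re.comp h1)
      have h3 : Continuous fun p : I × I => (p.1 : ℝ) := by fun_prop
      exact ((continuous_const.sub h3).smul h1).add (h3.smul h2)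
    · intro s t
      refine ⟨?_, ?_⟩
      · rw [transpose_add, transpose_smul, transpose_smul, (γ t).2.1, ← transpose_map,
          ← transpose_map, (γ t).2.1]
      · have : ((1 - (s : ℝ)) • (γ t).1 + (s : ℝ) • ((γ t).1.map Complex.re).map Complex.ofReal).map
            Complex.re = (γ t).1.map Complex.re := by
          ext a b; simp; ring
        rw [this]; exact (γ t).2.2
    · intro t; simp
    · intro t; simp [γr]
    · intro s
      simp only [γ.source, hbr]
      module
    · intro s
      simp only [γ.target, hbr]
      module
  refine h1.trans ?_
  refine homotopic_of_family γr _ (fun s t => ((F (s, t)).1.1 - (F (s, t)).1.2).map Complex.ofReal)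
    hcont ?_ ?_ ?_ ?_ ?_
  · intro s t
    exact ofReal_mem (sub_mem_Cone (F (s, t)).2)
  · intro t
    have : F (0, t) = δ t := F.apply_zero t
    rw [this]
    change ((pn ((γ t).1.map Complex.re)).1 - (pn ((γ t).1.map Complex.re)).2).map Complex.ofReal = _
    rw [pn_sub (Cone.symm (γ t).2.2)]
    rfl
  · intro t
    rw [F.apply_one]; rfl
  · intro s
    rw [F.source]; rfl
  · intro s
    rw [F.target]; rfl

theorem klein_Tb (c : ι → Fin 3) {i j a b l : ι} (hij : i ≠ j) (hc : c i = c j)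
    (ha : c a = 0) (hb : c b = 1) (hl : c l = 2) :
    Nonempty (FundamentalGroup (Tb c) (bpt c) ≃* (ℤˣ × ℤˣ)ᵐᵒᵖ) := by
  have hal : a ≠ l := by rintro rfl; rw [ha] at hl; exact absurd hl (by decide)
  have hbl : b ≠ l := by rintro rfl; rw [hb] at hl; exact absurd hl (by decide)
  have hr0 := isRt_orth0 c 1 (by simp)
  have hr1 := isRt_orth1 c 1 (by simp)
  simp only [one_mul, transpose_one, mul_one] at hr0 hr1
  refine klein_of_data (M₁ := fun x : Tb c => mn c 0 (pn (x.1.map Complex.re)).1)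
    (M₂ := fun x : Tb c => mn c 1 (pn (x.1.map Complex.re)).2) ?_ ?_ ?_ ?_ (bpt c)
    (um c 0 1) (um c 1 1) ?_ ?_ ⟨rotLoop c hal, ?_⟩ ⟨rotLoop c hbl, ?_⟩ (null_in_Tb c hij hc)
  · intro S J
    exact (continuous_mn c 0 S J).comp (continuous_fst.comp (continuous_pnT c))
  · intro S J
    exact (continuous_mn c 1 S J).comp (continuous_snd.comp (continuous_pnT c))
  · intro x
    obtain ⟨g, hg, h1, h2⟩ := pn_mem x.2.2
    exact exists_rt c 0 hg h1
  · intro x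
    obtain ⟨g, hg, h1, h2⟩ := pn_mem x.2.2
    exact exists_rt c 1 hg h2
  · simp only [bpt, map_re_ofReal]; exact hr0
  · simp only [bpt, map_re_ofReal]; exact hr1
  · have := rot_lifts c hal
    rwa [um_rot_one c 0 hal (by simp [hl]), um_rot_one c 1 hal (by simp [hl]), if_pos ha,
      if_neg (by simp [ha])] at this
  · have := rot_lifts c hbl
    rwa [um_rot_one c 0 hbl (by simp [hl]), um_rot_one c 1 hbl (by simp [hl]), if_pos hb,
      if_neg (by simp [hb])] at this

theorem joined_bpt (c : ι → Fin 3) {l : ι} (hl : c l = 2) (x : Matrix ι ι ℂ) (hx : x ∈ Tb c) :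
    JoinedIn (Tb c) (bpt c) x := by
  have hre : JoinedIn (Tb c) ((x.map Complex.re).map Complex.ofReal) x := by
    refine ⟨⟨⟨fun s : I => (1 - (s : ℝ)) • (x.map Complex.re).map Complex.ofReal + (s : ℝ) • x, ?_⟩,
      ?_, ?_⟩, ?_⟩
    · fun_prop
    · simp
    · simp
    · intro s
      refine ⟨?_, ?_⟩
      · change ((1 - (s : ℝ)) • (x.map Complex.re).map Complex.ofReal + (s : ℝ) • x)ᵀ =
          (1 - (s : ℝ)) • (x.map Complex.re).map Complex.ofReal + (s : ℝ) • x
        rw [transpose_add, transpose_smul, transpose_smul, hx.1, ← transpose_map,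
          ← transpose_map, hx.1]
      · change ((1 - (s : ℝ)) • (x.map Complex.re).map Complex.ofReal + (s : ℝ) • x).map
            Complex.re ∈ Cone c
        have : ((1 - (s : ℝ)) • (x.map Complex.re).map Complex.ofReal + (s : ℝ) • x).map
            Complex.re = x.map Complex.re := by
          ext a b; simp; ring
        rw [this]; exact hx.2
  refine JoinedIn.trans ?_ hre
  have key : ∃ g : Matrix ι ι ℝ, 0 < g.det ∧ x.map Complex.re = g * Dc c * gᵀ := by
    obtain ⟨g, hg, he⟩ := hx.2
    rcases lt_or_gt_of_ne hg with h | h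
    · refine ⟨g * diagonal (fun k => if k = l then (-1 : ℝ) else 1), ?_, ?_⟩
      · rw [det_mul, det_diagonal]
        simp [Finset.prod_ite_eq', h]
      · rw [he, transpose_mul]
        conv_lhs => rw [← diag_conj_Dc c (fun k => if k = l then (-1 : ℝ) else 1)
          (by intro k; split_ifs <;> norm_num)]
        simp only [mul_assoc]
    · exact ⟨g, h, he⟩
  obtain ⟨g, hg, he⟩ := key
  obtain ⟨γ, hγ⟩ := joined_one_of_det_pos g hg
  rw [he]
  refine ⟨⟨⟨fun t => (γ t * Dc c * (γ t)ᵀ).map Complex.ofReal, ?_⟩, ?_, ?_⟩, ?_⟩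
  · refine continuous_ofR.comp ?_
    have := γ.continuous
    fun_prop
  · simp [bpt]
  · simp
  · intro t
    exact ofReal_mem ⟨γ t, hγ t, rfl⟩

theorem pathConnected_Tb (c : ι → Fin 3) {l : ι} (hl : c l = 2) : PathConnectedSpace (Tb c) := by
  rw [← isPathConnected_iff_pathConnectedSpace]
  exact ⟨bpt c, (bpt c).2, fun {y} hy => joined_bpt c hl y hy⟩

theorem units_klein : Nonempty ((ℤˣ × ℤˣ)ᵐᵒᵖ ≃* Multiplicative (ZMod 2 × ZMod 2)) := by
  have h1 : IsKleinFour (Multiplicative (ZMod 2 × ZMod 2)) := inferInstance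
  have h2 : IsKleinFour (ℤˣ × ℤˣ)ᵐᵒᵖ := by
    refine ⟨?_, ?_⟩
    · rw [Nat.card_congr MulOpposite.opEquiv.symm, Nat.card_eq_fintype_card]
      rfl
    · have hd : Monoid.exponent (ℤˣ × ℤˣ)ᵐᵒᵖ ∣ 2 := by
        refine Monoid.exponent_dvd_of_forall_pow_eq_one fun g => ?_
        refine MulOpposite.unop_injective ?_
        refine Prod.ext ?_ ?_ <;> exact Int.units_sq _
      rcases (Nat.dvd_prime Nat.prime_two).1 hd with h | h
      · have := Monoid.pow_exponent_eq_one (MulOpposite.op ((-1, 1) : ℤˣ × ℤˣ))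
        rw [h, pow_one] at this
        have := congrArg (fun g => (MulOpposite.unop g).1) this
        exact absurd this (by decide)
      · exact h
  exact IsKleinFour.nonempty_mulEquiv
end tube
end TubeAux

namespace TubeAux
/-- the class function of a signature -/
def cls (n p q : ℕ) (i : Fin n) : Fin 3 :=
  if (i : ℕ) < p then 0 else if (i : ℕ) < p + q then 1 else 2

theorem signatureDiag_eq (n p q : ℕ) : signatureDiag n p q = Dc (cls n p q) := by
  rw [Dc_eq, signatureDiag]
  congr 1
  ext i
  unfold cls
  split_ifs <;> simp_all

theorem sigTube_eq (n p q : ℕ) : sigTube n p q = Tb (cls n p q) := by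
  ext z
  have e : (Matrix.of fun i j => ((z + z.map (starRingEnd ℂ)) i j).re / 2) = z.map Complex.re := by
    ext i j; simp
  unfold sigTube Tb
  rw [Set.mem_ofPred_eq, Set.mem_ofPred_eq, e]
  refine and_congr Iff.rfl ?_
  unfold sigCone Cone
  rw [Set.mem_ofPred_eq, Set.mem_ofPred_eq, signatureDiag_eq]
  refine exists_congr fun g => and_congr ?_ Iff.rfl
  rw [Matrix.isUnit_iff_isUnit_det, isUnit_iff_ne_zero]
end TubeAux

/-- For `n > 3` and `p, q ≥ 1` with `p + q < n`, the tube manifold `𝒯_{p,q}` is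
path-connected with fundamental group `ℤ/2 × ℤ/2`. -/
theorem tube_fundamentalGroup_klein (n p q : ℕ) (hn : 3 < n)
    (hp : 1 ≤ p) (hq : 1 ≤ q) (hpq : p + q < n) :
    PathConnectedSpace (sigTube n p q) ∧
    ∀ x : sigTube n p q,
      Nonempty (FundamentalGroup (sigTube n p q) x ≃* Multiplicative (ZMod 2 × ZMod 2)) := by
  rw [TubeAux.sigTube_eq]
  have ha : TubeAux.cls n p q ⟨0, by omega⟩ = 0 := by
    unfold TubeAux.cls; rw [if_pos]; exact hp
  have hb : TubeAux.cls n p q ⟨p, by omega⟩ = 1 := by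
    unfold TubeAux.cls
    rw [if_neg (lt_irrefl p), if_pos]; change p < p + q; omega
  have hl : TubeAux.cls n p q ⟨p + q, hpq⟩ = 2 := by
    unfold TubeAux.cls
    rw [if_neg, if_neg]
    · exact lt_irrefl (p + q)
    · change ¬ (p + q < p); omega
  obtain ⟨i, j, hij, hc⟩ := Fintype.exists_ne_map_eq_of_card_lt (TubeAux.cls n p q)
    (by simpa using hn)
  have hpc := TubeAux.pathConnected_Tb (TubeAux.cls n p q) hl
  refine ⟨hpc, fun x => ?_⟩
  obtain ⟨e⟩ := TubeAux.klein_Tb (TubeAux.cls n p q) hij hc ha hb hl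
  obtain ⟨f⟩ := TubeAux.units_klein
  exact ⟨((FundamentalGroup.fundamentalGroupMulEquivOfPathConnected x
    (TubeAux.bpt (TubeAux.cls n p q))).trans e).trans f⟩
end

section
/- For every n ≥ 3 and 0 < p < n, the tube manifold 𝒯_{p,0} ⊆ Matrix (Fin n) (Fin n) ℂ is path-connected and its fundamental group at any basepoint is isomorphic to ℤ/2: for every x ∈ 𝒯_{p,0} there is a group isomorphism FundamentalGroup 𝒯_{p,0} x ≃* ZMod 2. -/
open Matrix

section TopologyPart


variable {X : Type*} [TopologicalSpace X]

/-- A locally natural choice of path classes from a base point forces simple connectedness. -/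
theorem simplyConnected_of_section {ι : Type*} (x₀ : X)
    (c : ∀ y : X, Path.Homotopic.Quotient x₀ y) (U : ι → Set X)
    (hU : ∀ i, IsOpen (U i)) (hcov : ∀ y, ∃ i, y ∈ U i)
    (h : ∀ i (a b : X) (γ : Path a b), (∀ t, γ t ∈ U i) →
      (c a).trans (Path.Homotopic.Quotient.mk γ) = c b) : SimplyConnectedSpace X := by
  have key : ∀ (a b : X) (γ : Path a b), (c a).trans (Path.Homotopic.Quotient.mk γ) = c b := by
    intro a b γ
    obtain ⟨t, t0, tmono, ⟨N, tN⟩, ht⟩ :=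
      exists_monotone_Icc_subset_open_cover_unitInterval (c := fun i => γ ⁻¹' (U i))
        (fun i => (hU i).preimage γ.continuous)
        (fun s _ => by
          obtain ⟨i, hi⟩ := hcov (γ s)
          exact Set.mem_iUnion.2 ⟨i, hi⟩)
    have step : ∀ k, (c (γ 0)).trans (Path.Homotopic.Quotient.mk (γ.subpath 0 (t k))) = c (γ (t k)) := by
      intro k
      induction k with
      | zero =>
        rw [t0, Path.subpath_self, Path.Homotopic.Quotient.mk_refl, Path.Homotopic.Quotient.trans_refl]
      | succ k ih =>
        have h1 : Path.Homotopic.Quotient.mk (γ.subpath 0 (t (k+1))) =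
            (Path.Homotopic.Quotient.mk (γ.subpath 0 (t k))).trans
              (Path.Homotopic.Quotient.mk (γ.subpath (t k) (t (k+1)))) := by
          rw [← Path.Homotopic.Quotient.mk_trans, Path.Homotopic.Quotient.eq]
          exact ⟨(Path.Homotopy.subpathTransSubpath γ 0 (t k) (t (k+1))).symm⟩
        rw [h1, ← Path.Homotopic.Quotient.trans_assoc, ih]
        obtain ⟨i, hi⟩ := ht k
        apply h i
        intro s
        have : γ.subpath (t k) (t (k+1)) s ∈ Set.range (γ.subpath (t k) (t (k+1))) := ⟨s, rfl⟩
        rw [Path.range_subpath_of_le _ _ _ (tmono (Nat.le_succ k))] at this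
        obtain ⟨r, hr, hr'⟩ := this
        rw [← hr']
        exact hi hr
    have h1 := step N
    rw [tN N le_rfl, Path.subpath_zero_one] at h1
    have aux : ∀ (a' b' : X) (ha : a' = a) (hb : b' = b),
        (c a').trans (Path.Homotopic.Quotient.mk (γ.cast ha hb)) = c b' →
        (c a).trans (Path.Homotopic.Quotient.mk γ) = c b := by
      intro a' b' ha hb hh
      subst ha hb
      simpa using hh
    exact aux _ _ γ.source γ.target h1
  rw [simply_connected_iff_unique_homotopic]
  refine ⟨⟨x₀⟩, fun x y => ⟨⟨⟨(c x).symm.trans (c y)⟩, fun q => ?_⟩⟩⟩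
  induction q using Path.Homotopic.Quotient.ind with
  | mk γ =>
    change Path.Homotopic.Quotient.mk γ = (c x).symm.trans (c y)
    rw [← key x y γ, ← Path.Homotopic.Quotient.trans_assoc, Path.Homotopic.Quotient.symm_trans, Path.Homotopic.Quotient.refl_trans]

/-- Sets which are path connected and in which all paths are homotopic in the ambient space. -/
structure NiceSet (V : Set X) : Prop where
  joined : ∀ a ∈ V, ∀ b ∈ V, JoinedIn V a b
  homotopic : ∀ (a b : X) (γ γ' : Path a b), (∀ t, γ t ∈ V) → (∀ t, γ' t ∈ V) →
    Path.Homotopic γ γ'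

/-- The unique class of paths inside a nice set. -/
noncomputable def NiceSet.cls {V : Set X} (hV : NiceSet V) {a b : X} (ha : a ∈ V) (hb : b ∈ V) :
    Path.Homotopic.Quotient a b := Path.Homotopic.Quotient.mk (hV.joined a ha b hb).somePath

theorem NiceSet.mk_eq {V : Set X} (hV : NiceSet V) {a b : X} (ha : a ∈ V) (hb : b ∈ V)
    (γ : Path a b) (hγ : ∀ t, γ t ∈ V) : Path.Homotopic.Quotient.mk γ = hV.cls ha hb := by
  rw [NiceSet.cls, Path.Homotopic.Quotient.eq]
  exact hV.homotopic _ _ _ _ hγ (hV.joined a ha b hb).somePath_mem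

theorem NiceSet.cls_trans {V : Set X} (hV : NiceSet V) {a b c : X} (ha : a ∈ V) (hb : b ∈ V)
    (hc : c ∈ V) : (hV.cls ha hb).trans (hV.cls hb hc) = hV.cls ha hc := by
  rw [← hV.mk_eq ha hc ((hV.joined a ha b hb).somePath.trans (hV.joined b hb c hc).somePath)]
  · rw [Path.Homotopic.Quotient.mk_trans]; rfl
  · intro t
    have := Set.mem_range_self (f := ((hV.joined a ha b hb).somePath.trans
      (hV.joined b hb c hc).somePath)) t
    rw [Path.trans_range] at this
    rcases this with ⟨s, hs⟩ | ⟨s, hs⟩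
    · rw [← hs]; exact (hV.joined a ha b hb).somePath_mem s
    · rw [← hs]; exact (hV.joined b hb c hc).somePath_mem s

theorem NiceSet.cls_self {V : Set X} (hV : NiceSet V) {a : X} (ha : a ∈ V) :
    hV.cls ha ha = Path.Homotopic.Quotient.refl a := by
  rw [← hV.mk_eq ha ha (Path.refl a) (fun _ => ha), Path.Homotopic.Quotient.mk_refl]

theorem NiceSet.propagate {V W : Set X} (hV : NiceSet V) (hW : NiceSet W) {x₀ a b y z : X}
    (α : Path.Homotopic.Quotient x₀ a) (β : Path.Homotopic.Quotient x₀ b)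
    (ha : a ∈ V) (hb : b ∈ W) (hyV : y ∈ V) (hyW : y ∈ W) (hzV : z ∈ V) (hzW : z ∈ W)
    (hj : JoinedIn (V ∩ W) y z)
    (h : α.trans (hV.cls ha hyV) = β.trans (hW.cls hb hyW)) :
    α.trans (hV.cls ha hzV) = β.trans (hW.cls hb hzW) := by
  rw [← hV.cls_trans ha hyV hzV, ← hW.cls_trans hb hyW hzW, ← Path.Homotopic.Quotient.trans_assoc,
    ← Path.Homotopic.Quotient.trans_assoc, h, ← hV.mk_eq hyV hzV hj.somePath (fun t => (hj.somePath_mem t).1),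
    ← hW.mk_eq hyW hzW hj.somePath (fun t => (hj.somePath_mem t).2)]

/-- The combinatorial covering lemma. -/
theorem simplyConnected_of_signCharts {ι : Type*} (V : ι → Bool → Set X) (adj : ι → ι → Prop)
    (adj_symm : ∀ S T, adj S T → adj T S)
    (hopen : ∀ S s, IsOpen (V S s)) (hnice : ∀ S s, NiceSet (V S s))
    (hdisj : ∀ S y, y ∈ V S true → y ∈ V S false → False)
    (hcov : ∀ y, ∃ S s, y ∈ V S s)
    (hjoin : ∀ S T, adj S T → ∀ s t, ∀ y ∈ V S s ∩ V T t, ∀ z ∈ V S s ∩ V T t,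
      JoinedIn (V S s ∩ V T t) y z)
    (v : X) (hv : ∀ S, v ∈ V S true)
    (w : ι → X) (hw : ∀ S, w S ∈ V S false) (hw' : ∀ S T, adj S T → w S ∈ V T true)
    (hnbr : ∀ S, ∃ T, adj S T)
    (hnbrs : ∀ S J K, adj S J → adj S K → ∃ L, adj S L ∧ (L = J ∨ adj J L) ∧ (L = K ∨ adj L K))
    (htri : ∀ S T, adj S T → ∃ L, adj S L ∧ adj T L ∧ ∃ y, y ∈ V S false ∧ y ∈ V T false ∧
      y ∈ V L true)
    (hexch : ∀ y S T s t, y ∈ V S s → y ∈ V T t →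
      Relation.ReflTransGen (fun A B => adj A B ∧ ∃ r, y ∈ V B r) S T) :
    SimplyConnectedSpace X := by
  choose N hN using hnbr
  -- positive classes
  let cp : ∀ S y, y ∈ V S true → Path.Homotopic.Quotient v y := fun S y hy =>
    (Path.Homotopic.Quotient.refl v).trans ((hnice S true).cls (hv S) hy)
  let cm : ∀ S y, y ∈ V S false → Path.Homotopic.Quotient v y := fun S y hy =>
    (cp (N S) (w S) (hw' _ _ (hN S))).trans ((hnice S false).cls (hw S) hy)
  have hpp : ∀ S T, adj S T → ∀ y (h1 : y ∈ V S true) (h2 : y ∈ V T true),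
      cp S y h1 = cp T y h2 := by
    intro S T hST y h1 h2
    refine NiceSet.propagate (hnice S true) (hnice T true) _ _ (hv S) (hv T) (hv S) (hv T) h1 h2
      (hjoin S T hST true true v ⟨hv S, hv T⟩ y ⟨h1, h2⟩) ?_
    rw [NiceSet.cls_self, NiceSet.cls_self]
  have hpw : ∀ S J K (hJ : adj S J) (hK : adj S K),
      cp J (w S) (hw' _ _ hJ) = cp K (w S) (hw' _ _ hK) := by
    intro S J K hJ hK
    obtain ⟨L, hL, h1, h2⟩ := hnbrs S J K hJ hK
    have e1 : cp J (w S) (hw' _ _ hJ) = cp L (w S) (hw' _ _ hL) := by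
      rcases h1 with rfl | h1
      · rfl
      · exact hpp _ _ h1 _ _ _
    have e2 : cp L (w S) (hw' _ _ hL) = cp K (w S) (hw' _ _ hK) := by
      rcases h2 with rfl | h2
      · rfl
      · exact hpp _ _ h2 _ _ _
    rw [e1, e2]
  have hmp : ∀ S T, adj S T → ∀ y (h1 : y ∈ V S false) (h2 : y ∈ V T true),
      cm S y h1 = cp T y h2 := by
    intro S T hST y h1 h2
    refine NiceSet.propagate (hnice S false) (hnice T true) _ _ (hw S) (hv T) (hw S)
      (hw' _ _ hST) h1 h2 (hjoin S T hST false true (w S) ⟨hw S, hw' _ _ hST⟩ y ⟨h1, h2⟩) ?_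
    rw [NiceSet.cls_self, Path.Homotopic.Quotient.trans_refl]
    exact hpw S _ _ (hN S) hST
  have hmm : ∀ S T, adj S T → ∀ y (h1 : y ∈ V S false) (h2 : y ∈ V T false),
      cm S y h1 = cm T y h2 := by
    intro S T hST y h1 h2
    obtain ⟨L, hSL, hTL, z, z1, z2, z3⟩ := htri S T hST
    refine NiceSet.propagate (hnice S false) (hnice T false) _ _ (hw S) (hw T) z1 z2 h1 h2
      (hjoin S T hST false false z ⟨z1, z2⟩ y ⟨h1, h2⟩) ?_
    exact (hmp S L hSL z z1 z3).trans (hmp T L hTL z z2 z3).symm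
  let C : ∀ S s y, y ∈ V S s → Path.Homotopic.Quotient v y := fun S s y =>
    match s with
    | true => cp S y
    | false => cm S y
  have hC : ∀ S T, adj S T → ∀ s t y (h1 : y ∈ V S s) (h2 : y ∈ V T t),
      C S s y h1 = C T t y h2 := by
    intro S T hST s t y h1 h2
    cases s <;> cases t
    · exact hmm S T hST y h1 h2
    · exact hmp S T hST y h1 h2
    · exact (hmp T S (adj_symm _ _ hST) y h2 h1).symm
    · exact hpp S T hST y h1 h2
  have hCS : ∀ S s t y (h1 : y ∈ V S s) (h2 : y ∈ V S t), C S s y h1 = C S t y h2 := by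
    intro S s t y h1 h2
    cases s <;> cases t
    · rfl
    · exact (hdisj S y h2 h1).elim
    · exact (hdisj S y h1 h2).elim
    · rfl
  have hCC : ∀ S T s t y (h1 : y ∈ V S s) (h2 : y ∈ V T t), C S s y h1 = C T t y h2 := by
    intro S T s t y h1 h2
    have hch := hexch y S T s t h1 h2
    have : ∀ T, Relation.ReflTransGen (fun A B => adj A B ∧ ∃ r, y ∈ V B r) S T →
        ∀ t (h2 : y ∈ V T t), C S s y h1 = C T t y h2 := by
      intro T hT
      induction hT with
      | refl => intro t h2; exact hCS _ _ _ _ _ _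
      | tail hab hbc ih =>
        rename_i B D
        intro t h2
        rcases Relation.ReflTransGen.cases_tail hab with hB | ⟨_, _, _, r, hr⟩
        · subst hB
          exact hC _ _ hbc.1 _ _ _ _ _
        · exact (ih r hr).trans (hC _ _ hbc.1 _ _ _ _ _)
    exact this T hch t h2
  choose S₀ s₀ h₀ using hcov
  refine simplyConnected_of_section v (fun y => C (S₀ y) (s₀ y) y (h₀ y))
    (fun i : ι × Bool => V i.1 i.2) (fun i => hopen _ _) (fun y => ⟨(S₀ y, s₀ y), h₀ y⟩) ?_
  rintro ⟨S, s⟩ a b γ hγ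
  have ha : a ∈ V S s := by simpa using hγ 0
  have hb : b ∈ V S s := by simpa using hγ 1
  change (C (S₀ a) (s₀ a) a (h₀ a)).trans _ = C (S₀ b) (s₀ b) b (h₀ b)
  rw [hCC _ S _ s a _ ha, hCC _ S _ s b _ hb, (hnice S s).mk_eq ha hb γ hγ]
  cases s
  · change (Path.Homotopic.Quotient.trans _ _).trans _ = Path.Homotopic.Quotient.trans _ _
    rw [Path.Homotopic.Quotient.trans_assoc, NiceSet.cls_trans]
  · change (Path.Homotopic.Quotient.trans _ _).trans _ = Path.Homotopic.Quotient.trans _ _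
    rw [Path.Homotopic.Quotient.trans_assoc, NiceSet.cls_trans]

end TopologyPart
section TopologyPart2

variable {X : Type*} [TopologicalSpace X]

theorem niceSet_of_chart {K : Type*} [TopologicalSpace K] [SimplyConnectedSpace K] (V : Set X)
    (Φ : C(K, X)) (hΦ : ∀ k, Φ k ∈ V) (Ψ : V → K) (hΨ : Continuous Ψ)
    (h : ∀ y : V, Φ (Ψ y) = y) : NiceSet V where
  joined := by
    intro a ha b hb
    obtain ⟨γ⟩ := PathConnectedSpace.joined (Ψ ⟨a, ha⟩) (Ψ ⟨b, hb⟩)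
    refine ⟨(γ.map Φ.continuous).cast (h ⟨a, ha⟩).symm (h ⟨b, hb⟩).symm, fun t => ?_⟩
    exact hΦ _
  homotopic := by
    intro a b γ γ' hγ hγ'
    have ha : a ∈ V := by simpa using hγ 0
    have hb : b ∈ V := by simpa using hγ 1
    have lift : ∀ γ : Path a b, (∀ t, γ t ∈ V) →
        ∃ δ : Path (Ψ ⟨a, ha⟩) (Ψ ⟨b, hb⟩),
          γ = (δ.map Φ.continuous).cast (h ⟨a, ha⟩).symm (h ⟨b, hb⟩).symm := by
      intro γ hγ
      refine ⟨{ toFun := fun t => Ψ ⟨γ t, hγ t⟩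
                continuous_toFun := hΨ.comp (by fun_prop)
                source' := by simp
                target' := by simp }, ?_⟩
      ext t
      exact (h ⟨γ t, hγ t⟩).symm
    obtain ⟨δ, rfl⟩ := lift γ hγ
    obtain ⟨δ', rfl⟩ := lift γ' hγ'
    have := SimplyConnectedSpace.paths_homotopic δ δ'
    obtain ⟨F⟩ := this
    exact ⟨(F.map Φ).cast (by ext; rfl) (by ext; rfl)⟩

theorem joinedIn_of_chart {F : Type*} [AddCommGroup F] [Module ℝ F] [TopologicalSpace F]
    [IsTopologicalAddGroup F] [ContinuousSMul ℝ F] (K : Set F) (Φ : C(K, X)) (C : Set F)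
    (hC : Convex ℝ C) (hCK : C ⊆ K) (V' : Set X) (hV : ∀ k : K, (k : F) ∈ C → Φ k ∈ V')
    (k k' : K) (hk : (k : F) ∈ C) (hk' : (k' : F) ∈ C) : JoinedIn V' (Φ k) (Φ k') := by
  have := (hC.isPathConnected ⟨_, hk⟩).joinedIn _ hk _ hk'
  obtain ⟨γ, hγ⟩ := this
  refine ⟨⟨⟨fun t => Φ ⟨γ t, hCK (hγ t)⟩, by fun_prop⟩, ?_, ?_⟩, fun t => ?_⟩
  · simp
  · simp
  · exact hV _ (hγ t)

end TopologyPart2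
section LinAlg

theorem det_perm_rows {n p : ℕ} (I J : Fin p → Fin n) (hI : Function.Injective I)
    (h : Set.range I = Set.range J) :
    ∃ δ : ℝ, δ * δ = 1 ∧ ∀ A : Matrix (Fin n) (Fin p) ℝ,
      (A.submatrix I id).det = δ * (A.submatrix J id).det := by
  have h1 : ∀ a, ∃ b, J b = I a := fun a => by
    have : I a ∈ Set.range J := h ▸ ⟨a, rfl⟩
    exact this
  choose σ hσ using h1
  have hσi : Function.Injective σ := fun a b hab => hI (by rw [← hσ a, ← hσ b, hab])
  let τ : Equiv.Perm (Fin p) := Equiv.ofBijective σ (Finite.injective_iff_bijective.1 hσi)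
  refine ⟨((Equiv.Perm.sign τ : ℤ) : ℝ), ?_, fun A => ?_⟩
  · rcases Int.units_eq_one_or (Equiv.Perm.sign τ) with h | h <;> simp [h]
  · rw [← Matrix.det_permute]
    congr 1
    ext a b
    simp [τ, hσ]

theorem conj_signatureDiag {p m : ℕ} (g : Matrix (Fin (p + m)) (Fin (p + m)) ℝ)
    (i j : Fin (p + m)) : (g * signatureDiag (p + m) p 0 * gᵀ) i j =
      ∑ a : Fin p, g i (Fin.castAdd m a) * g j (Fin.castAdd m a) := by
  rw [Matrix.mul_apply]
  simp only [signatureDiag, Matrix.mul_diagonal, Fin.sum_univ_add]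
  simp

theorem cone_factor {n p : ℕ} (h : p ≤ n) (x : Matrix (Fin n) (Fin n) ℝ)
    (hx : x ∈ sigCone n p 0) : ∃ A : Matrix (Fin n) (Fin p) ℝ, x = A * Aᵀ ∧
      ∃ I : Fin p → Fin n, Function.Injective I ∧ (A.submatrix I id).det ≠ 0 := by
  obtain ⟨g, hg, rfl⟩ := hx
  obtain ⟨m, rfl⟩ := Nat.exists_eq_add_of_le h
  refine ⟨g.submatrix id (Fin.castAdd m), ?_, ?_⟩
  · ext i j
    rw [conj_signatureDiag, Matrix.mul_apply]
    rfl
  · have hB : (g⁻¹).submatrix (Fin.castAdd m) id * g.submatrix id (Fin.castAdd m) = 1 := by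
      rw [← Matrix.submatrix_mul _ _ _ _ _ Function.bijective_id, Matrix.nonsing_inv_mul _ ((Matrix.isUnit_iff_isUnit_det _).1 hg)]
      ext a b
      simp [Matrix.one_apply]
    generalize (g⁻¹).submatrix (Fin.castAdd m) id = B at hB
    generalize g.submatrix id (Fin.castAdd m) = A at hB
    have hr : A.rank = p := by
      apply le_antisymm
      · simpa using A.rank_le_width
      · have := Matrix.rank_mul_le_right B A
        rw [hB, Matrix.rank_one] at this
        simpa using this
    obtain ⟨f, hf, -, hf2⟩ := Submodule.exists_fun_fin_finrank_span_eq ℝ (Set.range A.row)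
    have hfr : Module.finrank ℝ (Submodule.span ℝ (Set.range A.row)) = p := by
      rw [← Matrix.rank_eq_finrank_span_row, hr]
    choose I hI using hf
    have hli : LinearIndependent ℝ (A.submatrix (I ∘ Fin.cast hfr.symm) id).row := by
      have : (A.submatrix (I ∘ Fin.cast hfr.symm) id).row = f ∘ Fin.cast hfr.symm := by
        ext a b
        simp only [Function.comp, ← hI]
        rfl
      rw [this]
      exact hf2.comp _ (Fin.cast_injective _)
    refine ⟨I ∘ Fin.cast hfr.symm, ?_, ?_⟩
    · intro a b hab
      apply hli.injective
      ext c
      change A ((I ∘ Fin.cast hfr.symm) a) c = A ((I ∘ Fin.cast hfr.symm) b) c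
      rw [hab]
    · have := Matrix.linearIndependent_rows_iff_isUnit.1 hli
      exact ((Matrix.isUnit_iff_isUnit_det _).1 this).ne_zero

theorem exists_perm_castAdd {m p : ℕ} (I : Fin p → Fin (p + m)) (hI : Function.Injective I) :
    ∃ σ : Equiv.Perm (Fin (p + m)), ∀ a, σ (Fin.castAdd m a) = I a := by
  classical
  let e1 : Set.range (Fin.castAdd m : Fin p → Fin (p+m)) ≃ Set.range I :=
    (Equiv.ofInjective _ (Fin.castAdd_injective p m)).symm.trans (Equiv.ofInjective _ hI)
  refine ⟨Equiv.extendSubtype e1, fun a => ?_⟩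
  rw [Equiv.extendSubtype_apply_of_mem e1 _ ⟨a, rfl⟩]
  simp only [e1, Equiv.trans_apply]
  have : (Equiv.ofInjective _ (Fin.castAdd_injective p m)).symm ⟨Fin.castAdd m a, ⟨a, rfl⟩⟩ = a := by
    rw [Equiv.symm_apply_eq]; rfl
  rw [this]; rfl

theorem factor_cone {n p : ℕ} (h : p ≤ n) (A : Matrix (Fin n) (Fin p) ℝ)
    (I : Fin p → Fin n) (hI : Function.Injective I) (hd : (A.submatrix I id).det ≠ 0) :
    A * Aᵀ ∈ sigCone n p 0 := by
  obtain ⟨m, rfl⟩ := Nat.exists_eq_add_of_le h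
  obtain ⟨σ, hσ⟩ := exists_perm_castAdd I hI
  let g : Matrix (Fin (p+m)) (Fin (p+m)) ℝ := Matrix.of fun i k =>
    Fin.addCases (fun a => A i a) (fun b => if i = σ (Fin.natAdd p b) then 1 else 0) k
  have g1 : ∀ i a, g i (Fin.castAdd m a) = A i a := fun i a => by simp [g]
  have g2 : ∀ i b, g i (Fin.natAdd p b) = if i = σ (Fin.natAdd p b) then 1 else 0 :=
    fun i b => by simp [g]
  refine ⟨g, ?_, ?_⟩
  · rw [← Matrix.mulVec_injective_iff_isUnit, ← Matrix.coe_mulVecLin, ← LinearMap.ker_eq_bot, LinearMap.ker_eq_bot']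
    intro v hv
    have hv' : ∀ i, ∑ a, A i a * v (Fin.castAdd m a) +
        ∑ b, (if i = σ (Fin.natAdd p b) then 1 else 0) * v (Fin.natAdd p b) = 0 := by
      intro i
      have := congrFun hv i
      simpa [Matrix.mulVec, dotProduct, Fin.sum_univ_add, g1, g2] using this
    have h0 : (fun a => v (Fin.castAdd m a)) = 0 := by
      apply Matrix.eq_zero_of_mulVec_eq_zero hd
      ext c
      have := hv' (I c)
      rw [← hσ c] at this
      have hne : ∀ b, ¬ (Fin.castAdd m c = Fin.natAdd p b) := by
        intro b hb
        have := congrArg Fin.val hb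
        simp at this
        omega
      simpa [Matrix.mulVec, dotProduct, hne, ← hσ c] using this
    have h0' : ∀ a, v (Fin.castAdd m a) = 0 := fun a => congrFun h0 a
    ext k
    refine Fin.addCases h0' (fun b => ?_) k
    have := hv' (σ (Fin.natAdd p b))
    simpa [h0'] using this
  · ext i j
    rw [conj_signatureDiag, Matrix.mul_apply]
    simp [g1]

end LinAlg
section Combinatorics

abbrev Idx (n p : ℕ) := {S : Finset (Fin n) // S.card = p}

def emb {n p : ℕ} (S : Idx n p) : Fin p → Fin n := S.1.orderEmbOfFin S.2

theorem emb_inj {n p : ℕ} (S : Idx n p) : Function.Injective (emb S) :=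
  (S.1.orderEmbOfFin S.2).injective

theorem range_emb {n p : ℕ} (S : Idx n p) : Set.range (emb S) = S.1 :=
  Finset.range_orderEmbOfFin S.1 S.2

theorem emb_mem {n p : ℕ} (S : Idx n p) (a : Fin p) : emb S a ∈ S.1 :=
  Finset.orderEmbOfFin_mem S.1 S.2 a

theorem exists_emb {n p : ℕ} (S : Idx n p) {i : Fin n} (hi : i ∈ S.1) : ∃ a, emb S a = i := by
  have : i ∈ Set.range (emb S) := by rw [range_emb]; exact hi
  exact this

def Idx.adj {n p : ℕ} (S T : Idx n p) : Prop :=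
  ∃ i ∈ S.1, ∃ j, j ∉ S.1 ∧ T.1 = insert j (S.1.erase i)

theorem exists_idx_swap {n p : ℕ} (S : Idx n p) {i j : Fin n} (hi : i ∈ S.1) (hj : j ∉ S.1) :
    ∃ T : Idx n p, T.1 = insert j (S.1.erase i) := by
  refine ⟨⟨insert j (S.1.erase i), ?_⟩, rfl⟩
  rw [Finset.card_insert_of_notMem (by simp [hj]), Finset.card_erase_of_mem hi, S.2]
  have : 0 < S.1.card := Finset.card_pos.2 ⟨i, hi⟩
  have := S.2
  omega

theorem adj_symm' {n p : ℕ} (S T : Idx n p) (h : S.adj T) : T.adj S := by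
  obtain ⟨i, hi, j, hj, hT⟩ := h
  have hij : i ≠ j := by rintro rfl; exact hj hi
  refine ⟨j, by simp [hT], i, by simp [hT, hij], ?_⟩
  rw [hT]
  ext k
  simp only [Finset.mem_insert, Finset.mem_erase]
  by_cases h1 : k = i <;> by_cases h2 : k = j <;> simp_all

theorem adj_nbrs {n p : ℕ} (S J K : Idx n p) (h1 : S.adj J) (h2 : S.adj K) :
    ∃ L : Idx n p, S.adj L ∧ (L = J ∨ J.adj L) ∧ (L = K ∨ L.adj K) := by
  obtain ⟨a, ha, j, hj, hJ⟩ := h1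
  obtain ⟨b, hb, k, hk, hK⟩ := h2
  obtain ⟨L, hL⟩ := exists_idx_swap S ha hk
  refine ⟨L, ⟨a, ha, k, hk, hL⟩, ?_, ?_⟩
  · by_cases hjk : k = j
    · left; apply Subtype.ext; rw [hL, hJ, hjk]
    · right
      refine ⟨j, by simp [hJ], k, by simp [hJ, hjk, hk], ?_⟩
      rw [hL, hJ]
      ext x
      simp only [Finset.mem_insert, Finset.mem_erase]
      by_cases h1 : x = a <;> by_cases h2 : x = j <;> by_cases h3 : x = k <;> simp_all
  · by_cases hab : a = b
    · left; apply Subtype.ext; rw [hL, hK, hab]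
    · right
      have hak : a ≠ k := by rintro rfl; exact hk ha
      have hbk : b ≠ k := by rintro rfl; exact hk hb
      refine ⟨b, by simp [hL, hb, Ne.symm hab], a, by simp [hL, hak], ?_⟩
      rw [hL, hK]
      ext x
      simp only [Finset.mem_insert, Finset.mem_erase]
      by_cases h1 : x = a <;> by_cases h2 : x = b <;> by_cases h3 : x = k <;> simp_all

theorem exists_mem_idx {n p : ℕ} (hp : 0 < p) (S : Idx n p) : ∃ i, i ∈ S.1 :=
  Finset.card_pos.1 (by rw [S.2]; exact hp)

theorem exists_notMem_idx {n p : ℕ} (hpn : p < n) (S : Idx n p) : ∃ i, i ∉ S.1 := by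
  by_contra! h
  have : S.1 = Finset.univ := Finset.eq_univ_iff_forall.2 h
  have h2 := S.2
  rw [this, Finset.card_univ, Fintype.card_fin] at h2
  omega

/-- A third vertex adjacent to both ends of an edge. -/
theorem adj_tri {n p : ℕ} (hn : 3 ≤ n) (S T : Idx n p) {i j : Fin n}
    (hi : i ∈ S.1) (hj : j ∉ S.1) (hT : T.1 = insert j (S.1.erase i)) :
    ∃ L : Idx n p, T.adj L ∧ ∃ i' ∈ S.1, ∃ j', j' ∉ S.1 ∧ L.1 = insert j' (S.1.erase i') ∧
      ¬ (i' = i ∧ j' = j) := by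
  have hij : i ≠ j := by rintro rfl; exact hj hi
  have h3 : ∃ l, l ≠ i ∧ l ≠ j := by
    have : ∃ l ∈ (Finset.univ : Finset (Fin n)), l ∉ ({i, j} : Finset (Fin n)) := by
      apply Finset.exists_mem_notMem_of_card_lt_card
      have := Finset.card_le_two (a := i) (b := j)
      rw [Finset.card_univ, Fintype.card_fin]
      omega
    simpa using this
  obtain ⟨l, hli, hlj⟩ := h3
  by_cases hl : l ∈ S.1
  · obtain ⟨L, hL⟩ := exists_idx_swap S hl hj
    refine ⟨L, ⟨l, by simp [hT, hl, hli], i, by simp [hT, hij], ?_⟩, l, hl, j, hj, hL, by tauto⟩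
    rw [hL, hT]
    ext x
    simp only [Finset.mem_insert, Finset.mem_erase]
    by_cases h1 : x = i <;> by_cases h2 : x = j <;> by_cases h3 : x = l <;> simp_all
  · obtain ⟨L, hL⟩ := exists_idx_swap S hi hl
    refine ⟨L, ⟨j, by simp [hT], l, by simp [hT, hl, hlj], ?_⟩, i, hi, l, hl, hL, by tauto⟩
    rw [hL, hT]
    ext x
    simp only [Finset.mem_insert, Finset.mem_erase]
    by_cases h1 : x = i <;> by_cases h2 : x = j <;> by_cases h3 : x = l <;> simp_all

theorem det_swap {n p : ℕ} (S T : Idx n p) {i j : Fin n} (hj : j ∉ S.1)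
    (hT : T.1 = insert j (S.1.erase i)) (a : Fin p) (ha : emb S a = i) :
    ∃ δ : ℝ, δ * δ = 1 ∧ ∀ A : Matrix (Fin n) (Fin p) ℝ, (A.submatrix (emb T) id).det =
      δ * (A.submatrix (Function.update (emb S) a j) id).det := by
  apply det_perm_rows _ _ (emb_inj T)
  rw [range_emb, hT]
  ext x
  simp only [Finset.coe_insert, Finset.coe_erase, Set.mem_insert_iff, Set.mem_sdiff, Finset.mem_coe,
    Set.mem_singleton_iff, Set.mem_range]
  constructor
  · rintro (rfl | ⟨h1, h2⟩)
    · exact ⟨a, by simp⟩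
    · obtain ⟨b, rfl⟩ := exists_emb S h1
      have : b ≠ a := by rintro rfl; exact h2 ha
      exact ⟨b, by simp [this]⟩
  · rintro ⟨b, rfl⟩
    by_cases hb : b = a
    · subst hb; simp
    · right
      simp only [Function.update_of_ne hb]
      exact ⟨emb_mem S b, fun h => hb (emb_inj S (h.trans ha.symm))⟩

theorem det_update_one {n p : ℕ} (S : Idx n p) (Y : Matrix (Fin n) (Fin p) ℝ)
    (hY : Y.submatrix (emb S) id = 1) (a : Fin p) (j : Fin n) :
    (Y.submatrix (Function.update (emb S) a j) id).det = Y j a := by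
  have : Y.submatrix (Function.update (emb S) a j) id =
      (1 : Matrix (Fin p) (Fin p) ℝ).updateRow a (Y j) := by
    rw [← hY]
    ext b c
    by_cases hb : b = a
    · subst hb; simp
    · simp [hb, Matrix.updateRow_apply]
  rw [this, ← Matrix.cramer_transpose_apply, Matrix.transpose_one, Matrix.cramer_one]
  rfl

theorem eq_of_adj {n p : ℕ} (S T : Idx n p) {i j : Fin n} (hj : j ∉ S.1)
    (hT : T.1 = insert j (S.1.erase i)) (a : Fin p) (ha : emb S a = i) :
    ∃ δ : ℝ, δ * δ = 1 ∧ ∀ Y : Matrix (Fin n) (Fin p) ℝ, Y.submatrix (emb S) id = 1 →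
      (Y.submatrix (emb T) id).det = δ * Y j a := by
  obtain ⟨δ, h1, h2⟩ := det_swap S T hj hT a ha
  exact ⟨δ, h1, fun Y hY => by rw [h2, det_update_one S Y hY]⟩

theorem exists_idx {n p : ℕ} (A : Matrix (Fin n) (Fin p) ℝ) (I : Fin p → Fin n)
    (hI : Function.Injective I) (hd : (A.submatrix I id).det ≠ 0) :
    ∃ S : Idx n p, (A.submatrix (emb S) id).det ≠ 0 := by
  classical
  let S : Idx n p := ⟨Finset.univ.image I, by
    rw [Finset.card_image_of_injective _ hI, Finset.card_univ, Fintype.card_fin]⟩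
  obtain ⟨δ, h1, h2⟩ := det_perm_rows I (emb S) hI (by rw [range_emb]; simp [S])
  refine ⟨S, fun h => hd ?_⟩
  rw [h2, h, mul_zero]

end Combinatorics
section Charts

noncomputable def reM {n : ℕ} (z : Matrix (Fin n) (Fin n) ℂ) : Matrix (Fin n) (Fin n) ℝ :=
  Matrix.of fun i j => ((z + z.map (starRingEnd ℂ)) i j).re / 2

theorem reM_apply {n : ℕ} (z : Matrix (Fin n) (Fin n) ℂ) (i j : Fin n) :
    reM z i j = (z i j).re := by
  simp [reM]

theorem continuous_reM {n : ℕ} :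
    Continuous (reM : Matrix (Fin n) (Fin n) ℂ → Matrix (Fin n) (Fin n) ℝ) := by
  refine continuous_matrix fun i j => ?_
  simp only [reM_apply]
  fun_prop

/-- The double cover of the tube: a point together with a choice of Plücker vector. -/
def EE (n p : ℕ) : Type :=
  {e : sigTube n p 0 × ((Fin p → Fin n) → ℝ) //
    ∀ I J, e.2 I * e.2 J = ((reM e.1.1).submatrix I J).det}

noncomputable instance (n p : ℕ) : TopologicalSpace (EE n p) := by unfold EE; infer_instance

def EE.z {n p : ℕ} (e : EE n p) : sigTube n p 0 := e.1.1
def EE.om {n p : ℕ} (e : EE n p) : (Fin p → Fin n) → ℝ := e.1.2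

theorem EE.ext' {n p : ℕ} {e e' : EE n p} (h : e.z = e'.z) (h' : e.om = e'.om) : e = e' :=
  Subtype.ext (Prod.ext h h')

theorem EE.continuous_z {n p : ℕ} : Continuous (EE.z : EE n p → _) :=
  continuous_fst.comp continuous_subtype_val

theorem EE.continuous_om {n p : ℕ} : Continuous (EE.om : EE n p → _) :=
  continuous_snd.comp continuous_subtype_val

theorem EE.continuous_om' {n p : ℕ} (I : Fin p → Fin n) :
    Continuous (fun e : EE n p => e.om I) :=
  (continuous_apply I).comp EE.continuous_om

theorem EE.rel {n p : ℕ} (e : EE n p) (I J : Fin p → Fin n) :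
    e.om I * e.om J = ((reM e.z.1).submatrix I J).det := e.2 I J

theorem det_mul_transpose_submatrix {n p : ℕ} (A : Matrix (Fin n) (Fin p) ℝ)
    (I J : Fin p → Fin n) : ((A * Aᵀ).submatrix I J).det =
      (A.submatrix I id).det * (A.submatrix J id).det := by
  rw [Matrix.submatrix_mul _ _ _ id _ Function.bijective_id, Matrix.det_mul,
    ← Matrix.transpose_submatrix, Matrix.det_transpose]

theorem eq_or_eq_neg_of_products {ι : Type*} (u u' : ι → ℝ) (h : ∀ I J, u I * u J = u' I * u' J) :
    u = u' ∨ u = -u' := by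
  by_cases h0 : ∃ S, u S ≠ 0
  · obtain ⟨S, hS⟩ := h0
    have h1 : u S = u' S ∨ u S = - u' S := mul_self_eq_mul_self_iff.1 (h S S)
    rcases h1 with h1 | h1
    · left; ext I
      have := h I S
      rw [← h1] at this
      exact mul_right_cancel₀ hS this
    · right; ext I
      have := h I S
      have h2 : u' S = - u S := by linarith
      rw [h2] at this
      have : u I * u S = (- u' I) * u S := by linarith
      exact mul_right_cancel₀ hS this
  · push Not at h0
    left; ext I
    have := h I I
    rw [h0 I] at this
    rw [h0 I]
    symm
    exact mul_self_eq_zero.1 (by linarith)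

theorem EE.factor {n p : ℕ} (hp : 0 < p) (hpn : p ≤ n) (e : EE n p) :
    ∃ A : Matrix (Fin n) (Fin p) ℝ, reM e.z.1 = A * Aᵀ ∧
      (∀ I, e.om I = (A.submatrix I id).det) ∧ ∃ S : Idx n p, e.om (emb S) ≠ 0 := by
  obtain ⟨A, hA, I, hI, hd⟩ := cone_factor hpn (reM e.z.1) e.z.2.2
  obtain ⟨S, hS⟩ := exists_idx A I hI hd
  have h := eq_or_eq_neg_of_products e.om (fun I => (A.submatrix I id).det) (fun I J => by
    rw [e.rel, hA, det_mul_transpose_submatrix])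
  rcases h with h | h
  · exact ⟨A, hA, fun I => congrFun h I, S, by rw [h]; exact hS⟩
  · let d : Fin p → ℝ := fun a => if a = ⟨0, hp⟩ then -1 else 1
    have hd2 : ∀ a, d a * d a = 1 := fun a => by simp only [d]; split_ifs <;> norm_num
    have hdd : (Matrix.diagonal d) * (Matrix.diagonal d)ᵀ = 1 := by
      rw [Matrix.diagonal_transpose, Matrix.diagonal_mul_diagonal, ← Matrix.diagonal_one]
      congr 1; ext a; exact hd2 a
    have hdet : (Matrix.diagonal d).det = -1 := by
      rw [Matrix.det_diagonal]
      simp [d, Finset.prod_ite_eq']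
    refine ⟨A * Matrix.diagonal d, ?_, ?_, S, ?_⟩
    · rw [hA, Matrix.transpose_mul, Matrix.mul_assoc, ← Matrix.mul_assoc (Matrix.diagonal d), hdd,
        Matrix.one_mul]
    · intro I
      rw [Matrix.submatrix_mul _ _ _ id _ Function.bijective_id, Matrix.submatrix_id_id,
        Matrix.det_mul, hdet, h]
      simp
    · rw [h]
      simpa using hS

/-- The chart parameter domain. -/
def KK {n p : ℕ} (S : Idx n p) :
    Set (Matrix (Fin p) (Fin p) ℝ × Matrix (Fin n) (Fin p) ℝ × Matrix (Fin n) (Fin n) ℝ) :=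
  {k | k.1.PosDef ∧ k.2.1.submatrix (emb S) id = 1 ∧ k.2.2ᵀ = k.2.2}

theorem KK_convex {n p : ℕ} (S : Idx n p) : Convex ℝ (KK S) := by
  rw [convex_iff_forall_pos]
  rintro ⟨P, Y, y⟩ ⟨h1, h2, h3⟩ ⟨P', Y', y'⟩ ⟨h1', h2', h3'⟩ a b ha hb hab
  refine ⟨?_, ?_, ?_⟩
  · exact (h1.smul ha).add (h1'.smul hb)
  · simp only at h2 h2' ⊢
    change a • Y.submatrix (emb S) id + b • Y'.submatrix (emb S) id = 1
    rw [h2, h2', ← add_smul, hab, one_smul]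
  · simp only at h3 h3' ⊢
    change (a • y + b • y')ᵀ = a • y + b • y'
    rw [Matrix.transpose_add, Matrix.transpose_smul, Matrix.transpose_smul, h3, h3']

noncomputable def mkz {n : ℕ} (x y : Matrix (Fin n) (Fin n) ℝ) : Matrix (Fin n) (Fin n) ℂ :=
  Matrix.of fun i j => (x i j : ℂ) + (y i j : ℂ) * Complex.I

theorem reM_mkz {n : ℕ} (x y : Matrix (Fin n) (Fin n) ℝ) : reM (mkz x y) = x := by
  ext i j
  simp [reM_apply, mkz]

theorem mkz_self {n : ℕ} (z : Matrix (Fin n) (Fin n) ℂ) :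
    mkz (reM z) (Matrix.of fun i j => (z i j).im) = z := by
  ext i j
  simp [mkz, reM_apply, Complex.re_add_im]

theorem posDef_sqrt {p : ℕ} (P : Matrix (Fin p) (Fin p) ℝ) (hP : P.PosDef) :
    ∃ B : Matrix (Fin p) (Fin p) ℝ, P = B * Bᵀ ∧ B.det ≠ 0 := by
  open scoped MatrixOrder in
  obtain ⟨B, hB⟩ := CStarAlgebra.nonneg_iff_eq_star_mul_self.mp hP.posSemidef.nonneg
  rw [Matrix.star_eq_conjTranspose, Matrix.conjTranspose_eq_transpose_of_trivial] at hB
  refine ⟨Bᵀ, by rw [hB, Matrix.transpose_transpose], fun h => ?_⟩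
  have := hP.det_pos
  rw [hB, Matrix.det_mul, h, zero_mul] at this
  exact lt_irrefl _ this

theorem mkz_mem {n p : ℕ} (hpn : p ≤ n) (S : Idx n p) {k} (hk : k ∈ KK S) :
    mkz (k.2.1 * k.1 * k.2.1ᵀ) k.2.2 ∈ sigTube n p 0 := by
  obtain ⟨P, Y, y⟩ := k
  obtain ⟨h1, h2, h3⟩ := hk
  simp only at h1 h2 h3 ⊢
  obtain ⟨B, rfl, hB⟩ := posDef_sqrt P h1
  have e1 : Y * (B * Bᵀ) * Yᵀ = (Y * B) * (Y * B)ᵀ := by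
    rw [Matrix.transpose_mul]; simp only [Matrix.mul_assoc]
  rw [e1]
  refine ⟨?_, ?_⟩
  · ext i j
    have hs : ((Y * B) * (Y * B)ᵀ) j i = ((Y * B) * (Y * B)ᵀ) i j := by
      conv_lhs => rw [← Matrix.transpose_apply ((Y * B) * (Y * B)ᵀ), Matrix.transpose_mul,
        Matrix.transpose_transpose]
    have hy : y j i = y i j := by conv_lhs => rw [← h3, Matrix.transpose_apply]
    simp only [Matrix.transpose_apply, mkz, Matrix.of_apply, hs, hy]
  · change reM _ ∈ _
    rw [reM_mkz]
    refine factor_cone hpn _ (emb S) (emb_inj S) ?_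
    rw [Matrix.submatrix_mul _ _ _ id _ Function.bijective_id, h2]
    simpa using hB

def WW {n p : ℕ} (S : Idx n p) (s : ℝ) : Set (EE n p) := {e | 0 < s * e.om (emb S)}

theorem isOpen_WW {n p : ℕ} (S : Idx n p) (s : ℝ) : IsOpen (WW S s) :=
  isOpen_lt continuous_const (continuous_const.mul (EE.continuous_om' _))

theorem exists_PhiFun {n p : ℕ} (hpn : p ≤ n) (S : Idx n p) (s : ℝ) (hs : s * s = 1) :
    ∃ Φ : C(KK S, EE n p), ∀ k, (Φ k).z.1 = mkz (k.1.2.1 * k.1.1 * k.1.2.1ᵀ) k.1.2.2 ∧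
      ∀ I, (Φ k).om I = s * √(k.1.1.det) * (k.1.2.1.submatrix I id).det := by
  refine ⟨⟨fun k => ⟨(⟨_, mkz_mem hpn S k.2⟩, fun I =>
    s * √(k.1.1.det) * (k.1.2.1.submatrix I id).det), ?_⟩, ?_⟩, fun k => ⟨rfl, fun I => rfl⟩⟩
  · intro I J
    simp only [reM_mkz]
    rw [Matrix.submatrix_mul _ _ _ id _ Function.bijective_id,
      Matrix.submatrix_mul _ _ _ id _ Function.bijective_id, Matrix.det_mul, Matrix.det_mul,
      ← Matrix.transpose_submatrix, Matrix.det_transpose, Matrix.submatrix_id_id]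
    have : √(k.1.1.det) * √(k.1.1.det) = k.1.1.det :=
      Real.mul_self_sqrt k.2.1.det_pos.le
    linear_combination (s * s * (k.1.2.1.submatrix I id).det * (k.1.2.1.submatrix J id).det) * this
      + k.1.1.det * (k.1.2.1.submatrix I id).det * (k.1.2.1.submatrix J id).det * hs
  · refine Continuous.subtype_mk (Continuous.prodMk (Continuous.subtype_mk ?_ _) ?_) _
    · refine continuous_matrix fun i j => ?_
      simp only [mkz, Matrix.of_apply]
      have h1 : Continuous fun k : KK S => (k.1.2.1 * k.1.1 * k.1.2.1ᵀ) i j := by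
        apply Continuous.matrix_elem
        fun_prop
      have h2 : Continuous fun k : KK S => k.1.2.2 i j := by
        apply Continuous.matrix_elem
        fun_prop
      fun_prop
    · refine continuous_pi fun I => ?_
      have h1 : Continuous fun k : KK S => k.1.1.det := by
        apply Continuous.matrix_det; fun_prop
      have h2 : Continuous fun k : KK S => (k.1.2.1.submatrix I id).det := by
        apply Continuous.matrix_det
        apply Continuous.matrix_submatrix
        fun_prop
      fun_prop

theorem EE.normal {n p : ℕ} (hp : 0 < p) (hpn : p ≤ n) (e : EE n p) (S : Idx n p)
    (h : e.om (emb S) ≠ 0) :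
    ∃ Y : Matrix (Fin n) (Fin p) ℝ, Y.submatrix (emb S) id = 1 ∧
      (∀ I, e.om I = e.om (emb S) * (Y.submatrix I id).det) ∧
      ((reM e.z.1).submatrix (emb S) (emb S)).PosDef ∧
      reM e.z.1 = Y * ((reM e.z.1).submatrix (emb S) (emb S)) * Yᵀ := by
  obtain ⟨A, hA, hom, -⟩ := e.factor hp hpn
  rw [hom] at h
  have hu : IsUnit (A.submatrix (emb S) id).det := isUnit_iff_ne_zero.2 h
  have hx : (reM e.z.1).submatrix (emb S) (emb S) =
      A.submatrix (emb S) id * (A.submatrix (emb S) id)ᵀ := by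
    rw [hA, Matrix.submatrix_mul _ _ _ id _ Function.bijective_id, Matrix.transpose_submatrix]
  have hAY : A = A * (A.submatrix (emb S) id)⁻¹ * A.submatrix (emb S) id := by
    rw [Matrix.mul_assoc, Matrix.nonsing_inv_mul _ hu, Matrix.mul_one]
  refine ⟨A * (A.submatrix (emb S) id)⁻¹, ?_, ?_, ?_, ?_⟩
  · rw [Matrix.submatrix_mul _ _ _ id _ Function.bijective_id, Matrix.submatrix_id_id,
      Matrix.mul_nonsing_inv _ hu]
  · intro I
    rw [hom, hom]
    conv_lhs => rw [hAY, Matrix.submatrix_mul _ _ _ id _ Function.bijective_id, Matrix.det_mul,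
      Matrix.submatrix_id_id]
    rw [mul_comm]
  · rw [hx, ← Matrix.conjTranspose_eq_transpose_of_trivial,
      (Matrix.posSemidef_self_mul_conjTranspose _).posDef_iff_det_ne_zero,
      Matrix.conjTranspose_eq_transpose_of_trivial, Matrix.det_mul, Matrix.det_transpose]
    exact mul_ne_zero h h
  · rw [hx]
    conv_lhs => rw [hA, hAY, Matrix.transpose_mul]
    simp only [Matrix.mul_assoc]

noncomputable def PsiFun {n p : ℕ} (S : Idx n p) (e : EE n p) :
    Matrix (Fin p) (Fin p) ℝ × Matrix (Fin n) (Fin p) ℝ × Matrix (Fin n) (Fin n) ℝ :=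
  ((reM e.z.1).submatrix (emb S) (emb S),
    Matrix.of fun j a => e.om (Function.update (emb S) a j) / e.om (emb S),
    Matrix.of fun i j => (e.z.1 i j).im)

theorem PsiFun_spec {n p : ℕ} (hp : 0 < p) (hpn : p ≤ n) (e : EE n p) (S : Idx n p)
    (h : e.om (emb S) ≠ 0) : PsiFun S e ∈ KK S ∧
      (∀ I, e.om I = e.om (emb S) * ((PsiFun S e).2.1.submatrix I id).det) ∧
      reM e.z.1 = (PsiFun S e).2.1 * (PsiFun S e).1 * (PsiFun S e).2.1ᵀ := by
  obtain ⟨Y, h1, h2, h3, h4⟩ := e.normal hp hpn S h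
  have hY : (PsiFun S e).2.1 = Y := by
    ext j a
    simp only [PsiFun, Matrix.of_apply]
    rw [h2, det_update_one S Y h1, mul_comm, mul_div_assoc, div_self h, mul_one]
  refine ⟨⟨h3, by rw [hY, h1], ?_⟩, by rw [hY]; exact h2, by rw [hY]; exact h4⟩
  ext i j
  have := e.z.2.1
  simp only [PsiFun, Matrix.transpose_apply, Matrix.of_apply]
  conv_rhs => rw [← this, Matrix.transpose_apply]

theorem continuous_PsiFun {n p : ℕ} (S : Idx n p) (V : Set (EE n p))
    (hV : ∀ e ∈ V, e.om (emb S) ≠ 0) : Continuous fun e : V => PsiFun S e.1 := by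
  unfold PsiFun
  have hz : Continuous fun e : V => e.1.z.1 :=
    continuous_subtype_val.comp (EE.continuous_z.comp continuous_subtype_val)
  refine Continuous.prodMk ?_ (Continuous.prodMk ?_ ?_)
  · exact (continuous_reM.comp hz).matrix_submatrix _ _
  · refine continuous_matrix fun j a => ?_
    exact ((EE.continuous_om' _).comp continuous_subtype_val).div
      ((EE.continuous_om' _).comp continuous_subtype_val) (fun e => hV e.1 e.2)
  · refine continuous_matrix fun i j => ?_
    exact Complex.continuous_im.comp (hz.matrix_elem i j)

/-- All chart facts bundled. -/
theorem exists_chart {n p : ℕ} (hp : 0 < p) (hpn : p ≤ n) (S : Idx n p) (s : ℝ) (hs : s * s = 1) :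
    ∃ Φ : C(KK S, EE n p), (∀ k, Φ k ∈ WW S s) ∧
      (∀ k I, (Φ k).om I = s * √(k.1.1.det) * (k.1.2.1.submatrix I id).det) ∧
      ∃ Ψ : WW S s → KK S, Continuous Ψ ∧ ∀ y, Φ (Ψ y) = y := by
  obtain ⟨Φ, hΦ⟩ := exists_PhiFun hpn S s hs
  have hne : ∀ e ∈ WW S s, e.om (emb S) ≠ 0 := by
    intro e he h
    simp [WW, h] at he
  refine ⟨Φ, ?_, fun k I => (hΦ k).2 I, fun e => ⟨PsiFun S e.1, (PsiFun_spec hp hpn e.1 S (hne _ e.2)).1⟩,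
    (continuous_PsiFun S _ hne).subtype_mk _, ?_⟩
  · intro k
    simp only [WW, Set.mem_ofPred_eq]
    rw [(hΦ k).2, k.2.2.1, Matrix.det_one, mul_one, ← mul_assoc, hs, one_mul]
    exact Real.sqrt_pos.2 k.2.1.det_pos
  · rintro ⟨e, he⟩
    obtain ⟨h1, h2, h3⟩ := PsiFun_spec hp hpn e S (hne _ he)
    apply EE.ext'
    · apply Subtype.ext
      rw [(hΦ _).1]
      simp only
      rw [← h3]
      exact mkz_self _
    · ext I
      rw [(hΦ _).2]
      simp only
      rw [h2 I]
      congr 1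
      have : (PsiFun S e).1.det = e.om (emb S) * e.om (emb S) := (e.rel _ _).symm
      rw [this]
      have h5 : e.om (emb S) * e.om (emb S) = (s * e.om (emb S)) * (s * e.om (emb S)) := by
        linear_combination (- e.om (emb S) * e.om (emb S)) * hs
      rw [h5, Real.sqrt_mul_self (le_of_lt he), ← mul_assoc, hs, one_mul]

end Charts
section SC

noncomputable def vand (n p : ℕ) : Matrix (Fin n) (Fin p) ℝ :=
  Matrix.of fun i k => ((i : ℕ) : ℝ) ^ (k : ℕ)

theorem vand_det {n p : ℕ} (S : Idx n p) : ((vand n p).submatrix (emb S) id).det ≠ 0 := by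
  have : (vand n p).submatrix (emb S) id = Matrix.vandermonde (fun a => (((emb S a : Fin n) : ℕ) : ℝ)) := by
    ext a b; simp [vand, Matrix.vandermonde]
  rw [this, Matrix.det_vandermonde_ne_zero_iff]
  intro a b hab
  have h : (((emb S a : Fin n) : ℕ) : ℝ) = (((emb S b : Fin n) : ℕ) : ℝ) := hab
  exact emb_inj S (Fin.ext (by exact_mod_cast h))

noncomputable def sg {n p : ℕ} (S : Idx n p) : ℝ :=
  if 0 < ((vand n p).submatrix (emb S) id).det then 1 else -1

theorem sg_sq {n p : ℕ} (S : Idx n p) : sg S * sg S = 1 := by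
  unfold sg; split_ifs <;> norm_num

theorem sg_pos {n p : ℕ} (S : Idx n p) : 0 < sg S * ((vand n p).submatrix (emb S) id).det := by
  unfold sg
  split_ifs with h
  · simpa using h
  · have := lt_of_le_of_ne (not_lt.1 h) (vand_det S)
    linarith

noncomputable def bs (b : Bool) : ℝ := if b then 1 else -1

theorem bs_sq (b : Bool) : bs b * bs b = 1 := by cases b <;> norm_num [bs]

theorem bsg_sq {n p : ℕ} (S : Idx n p) (b : Bool) : (bs b * sg S) * (bs b * sg S) = 1 := by
  linear_combination (bs b * bs b) * sg_sq S + bs_sq b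

theorem WW_joined {n p : ℕ} (hp : 0 < p) (hpn : p ≤ n) (S T : Idx n p) (hST : S.adj T)
    (s t : ℝ) (hs : s * s = 1) :
    ∀ y ∈ WW S s ∩ WW T t, ∀ z ∈ WW S s ∩ WW T t, JoinedIn (WW S s ∩ WW T t) y z := by
  obtain ⟨Φ, h1, h2, Ψ, h3, h4⟩ := exists_chart hp hpn S s hs
  obtain ⟨i, hi, j, hj, hT⟩ := hST
  obtain ⟨a, ha⟩ := exists_emb S hi
  obtain ⟨δ, hδ, hδ'⟩ := eq_of_adj S T hj hT a ha
  have key : ∀ k : KK S, Φ k ∈ WW T t ↔ 0 < (t * s * δ) * k.1.2.1 j a := by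
    intro k
    change 0 < t * (Φ k).om (emb T) ↔ _
    rw [h2, hδ' _ k.2.2.1]
    have hd : 0 < √(k.1.1.det) := Real.sqrt_pos.2 k.2.1.det_pos
    have : t * (s * √(k.1.1.det) * (δ * k.1.2.1 j a)) =
      √(k.1.1.det) * ((t * s * δ) * k.1.2.1 j a) := by ring
    rw [this, mul_pos_iff_of_pos_left hd]
  let C : Set (Matrix (Fin p) (Fin p) ℝ × Matrix (Fin n) (Fin p) ℝ × Matrix (Fin n) (Fin n) ℝ) :=
    {k | k ∈ KK S ∧ 0 < (t * s * δ) * k.2.1 j a}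
  have hC : Convex ℝ C := by
    rw [convex_iff_forall_pos]
    intro k hk k' hk' c c' hc hc' hcc
    refine ⟨convex_iff_forall_pos.1 (KK_convex S) hk.1 hk'.1 hc hc' hcc, ?_⟩
    change 0 < (t * s * δ) * (c * k.2.1 j a + c' * k'.2.1 j a)
    have e1 := mul_pos hc hk.2
    have e2 := mul_pos hc' hk'.2
    linarith
  rintro y ⟨hy, hy'⟩ z ⟨hz, hz'⟩
  have := joinedIn_of_chart (KK S) Φ C hC (fun k hk => hk.1) (WW S s ∩ WW T t)
    (fun k hk => ⟨h1 k, (key k).2 hk.2⟩) (Ψ ⟨y, hy⟩) (Ψ ⟨z, hz⟩)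
    ⟨(Ψ ⟨y, hy⟩).2, (key _).1 (by rw [h4]; exact hy')⟩
    ⟨(Ψ ⟨z, hz⟩).2, (key _).1 (by rw [h4]; exact hz')⟩
  rwa [h4, h4] at this

theorem one_mem_KK {n p : ℕ} (S : Idx n p) (Y : Matrix (Fin n) (Fin p) ℝ)
    (hY : Y.submatrix (emb S) id = 1) :
    ((1 : Matrix (Fin p) (Fin p) ℝ), Y, (0 : Matrix (Fin n) (Fin n) ℝ)) ∈ KK S :=
  ⟨Matrix.PosDef.one, hY, Matrix.transpose_zero⟩

theorem vand_normal {n p : ℕ} (S : Idx n p) : ∃ Y : Matrix (Fin n) (Fin p) ℝ,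
    Y.submatrix (emb S) id = 1 ∧ ∀ I, ((vand n p).submatrix I id).det =
      ((vand n p).submatrix (emb S) id).det * (Y.submatrix I id).det := by
  have hu : IsUnit ((vand n p).submatrix (emb S) id).det := isUnit_iff_ne_zero.2 (vand_det S)
  have hAY : vand n p = vand n p * ((vand n p).submatrix (emb S) id)⁻¹ * (vand n p).submatrix (emb S) id := by
    rw [Matrix.mul_assoc, Matrix.nonsing_inv_mul _ hu, Matrix.mul_one]
  refine ⟨vand n p * ((vand n p).submatrix (emb S) id)⁻¹, ?_, ?_⟩
  · rw [Matrix.submatrix_mul _ _ _ id _ Function.bijective_id, Matrix.submatrix_id_id,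
      Matrix.mul_nonsing_inv _ hu]
  · intro I
    conv_lhs => rw [hAY, Matrix.submatrix_mul _ _ _ id _ Function.bijective_id, Matrix.det_mul,
      Matrix.submatrix_id_id]
    rw [mul_comm]

theorem exists_base {n p : ℕ} (hp : 0 < p) (hpn : p ≤ n) :
    ∃ v : EE n p, ∀ S : Idx n p, v ∈ WW S (sg S) := by
  have hS : ∃ S : Idx n p, True := by
    obtain ⟨S, -, hS⟩ := Finset.exists_subset_card_eq (s := (Finset.univ : Finset (Fin n))) (n := p)
      (by simpa using hpn)
    exact ⟨⟨S, hS⟩, trivial⟩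
  obtain ⟨S, -⟩ := hS
  obtain ⟨Φ, h1, h2, -⟩ := exists_chart hp hpn S (sg S) (sg_sq S)
  obtain ⟨Y, hY, hY'⟩ := vand_normal S
  refine ⟨Φ ⟨_, one_mem_KK S Y hY⟩, fun T => ?_⟩
  change 0 < sg T * (Φ _).om (emb T)
  rw [h2]
  simp only [Matrix.det_one, Real.sqrt_one, mul_one]
  have e1 := sg_pos T
  have e2 := sg_pos S
  have e3 := sg_sq S
  rw [hY'] at e1
  generalize sg T = x at *
  generalize sg S = y at *
  generalize (Y.submatrix (emb T) id).det = u at *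
  generalize ((vand n p).submatrix (emb S) id).det = d at *
  have e4 : 0 < (y * d) * (x * (y * u)) := by
    have : (y * d) * (x * (y * u)) = x * (d * u) := by linear_combination (d * x * u) * e3
    rw [this]; exact e1
  exact (mul_pos_iff_of_pos_left e2).1 e4

theorem exists_pt {n p : ℕ} (hp : 0 < p) (hpn : p ≤ n) (S : Idx n p) (η : Fin n → Fin p → ℝ) :
    ∃ e : EE n p, e ∈ WW S (bs false * sg S) ∧ ∀ (T : Idx n p) (j : Fin n) (a : Fin p),
      j ∉ S.1 → T.1 = insert j (S.1.erase (emb S a)) →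
      ∃ c : ℝ, 0 < c ∧ sg T * e.om (emb T) = - η j a * c := by
  obtain ⟨Φ, h1, h2, -⟩ := exists_chart hp hpn S (bs false * sg S) (bsg_sq S false)
  obtain ⟨Y, hY, hY'⟩ := vand_normal S
  let Z : Matrix (Fin n) (Fin p) ℝ := Matrix.of fun k a => if k ∈ S.1 then Y k a else η k a * Y k a
  have hZ : Z.submatrix (emb S) id = 1 := by
    rw [← hY]
    ext b c
    simp [Z, emb_mem]
  refine ⟨Φ ⟨_, one_mem_KK S Z hZ⟩, h1 _, ?_⟩
  intro T j a hj hT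
  obtain ⟨δ, hδ, hδ'⟩ := eq_of_adj S T hj hT a rfl
  have e1 := sg_pos T
  have e2 := sg_pos S
  have e3 := sg_sq S
  rw [hY', hδ' _ hY] at e1
  rw [h2]
  simp only [Matrix.det_one, Real.sqrt_one, mul_one]
  rw [hδ' _ hZ]
  refine ⟨sg T * sg S * δ * Y j a, ?_, ?_⟩
  · generalize sg T = x at *
    generalize sg S = y at *
    generalize Y j a = u at *
    generalize ((vand n p).submatrix (emb S) id).det = d at *
    have e4 : 0 < (y * d) * (x * y * δ * u) := by
      have : (y * d) * (x * y * δ * u) = x * (d * (δ * u)) := by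
        linear_combination (d * x * δ * u) * e3
      rw [this]; exact e1
    exact (mul_pos_iff_of_pos_left e2).1 e4
  · have : Z j a = η j a * Y j a := by simp [Z, hj]
    rw [this]
    simp only [bs]
    simp
    ring

theorem mem_WW_of_ne {n p : ℕ} (S : Idx n p) (y : EE n p) (h : y.om (emb S) ≠ 0) :
    ∃ b, y ∈ WW S (bs b * sg S) := by
  have hs : sg S ≠ 0 := fun h0 => by have := sg_sq S; rw [h0] at this; norm_num at this
  have h2 : sg S * y.om (emb S) ≠ 0 := mul_ne_zero hs h
  rcases lt_or_gt_of_ne h2 with h3 | h3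
  · refine ⟨false, ?_⟩
    simp only [WW, bs, Set.mem_ofPred_eq]
    simp
    linarith
  · refine ⟨true, ?_⟩
    simp only [WW, bs, Set.mem_ofPred_eq]
    simpa using h3

theorem ne_of_mem_WW {n p : ℕ} {S : Idx n p} {s : ℝ} {y : EE n p} (h : y ∈ WW S s) :
    y.om (emb S) ≠ 0 := by
  intro h0
  simp [WW, h0] at h

theorem exchange {n p : ℕ} (hp : 0 < p) (hpn : p ≤ n) (y : EE n p) (m : ℕ) :
    ∀ S T : Idx n p, (S.1 \ T.1).card = m → y.om (emb S) ≠ 0 → y.om (emb T) ≠ 0 →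
      Relation.ReflTransGen (fun A B : Idx n p => A.adj B ∧ ∃ r, y ∈ WW B (bs r * sg B)) S T := by
  induction m with
  | zero =>
    intro S T h hS hT
    have h1 : S.1 ⊆ T.1 := by
      rw [← Finset.sdiff_eq_empty_iff_subset]; exact Finset.card_eq_zero.1 h
    have h2 : S = T := Subtype.ext (Finset.eq_of_subset_of_card_le h1 (by rw [S.2, T.2]))
    rw [h2]
  | succ m ih =>
    intro S T h hS hT
    obtain ⟨Y, hY, hY', -, -⟩ := y.normal hp hpn S hS
    obtain ⟨i, hi⟩ : (S.1 \ T.1).Nonempty := Finset.card_pos.1 (by omega)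
    obtain ⟨hiS, hiT⟩ := Finset.mem_sdiff.1 hi
    obtain ⟨a, ha⟩ := exists_emb S hiS
    have hex : ∃ j, j ∈ T.1 ∧ j ∉ S.1 ∧ Y j a ≠ 0 := by
      by_contra! hcon
      apply hT
      rw [hY']
      rw [Matrix.det_eq_zero_of_column_eq_zero a, mul_zero]
      intro b
      change Y (emb T b) a = 0
      by_cases hb : emb T b ∈ S.1
      · obtain ⟨c, hc⟩ := exists_emb S hb
        have hca : c ≠ a := by
          rintro rfl
          apply hiT
          rw [← ha, hc]
          exact emb_mem T b
        rw [← hc]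
        have := congrFun (congrFun hY c) a
        simpa [Matrix.one_apply, hca] using this
      · exact hcon _ (emb_mem T b) hb
    obtain ⟨j, hjT, hjS, hjY⟩ := hex
    obtain ⟨S', hS'⟩ := exists_idx_swap S hiS hjS
    obtain ⟨δ, hδ, hδ'⟩ := eq_of_adj S S' hjS hS' a ha
    have hne : y.om (emb S') ≠ 0 := by
      rw [hY', hδ' Y hY]
      have : δ ≠ 0 := by rintro rfl; norm_num at hδ
      positivity
    refine Relation.ReflTransGen.head ⟨⟨i, hiS, j, hjS, hS'⟩, mem_WW_of_ne S' y hne⟩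
      (ih S' T ?_ hne hT)
    have : S'.1 \ T.1 = (S.1 \ T.1).erase i := by
      rw [hS']
      ext x
      simp only [Finset.mem_sdiff, Finset.mem_insert, Finset.mem_erase]
      constructor
      · rintro ⟨rfl | h, h'⟩
        · exact absurd hjT h'
        · tauto
      · tauto
    rw [this, Finset.card_erase_of_mem hi, h]
    rfl

theorem EE_simplyConnected {n p : ℕ} (hn : 3 ≤ n) (hp : 0 < p) (hpn : p < n) :
    SimplyConnectedSpace (EE n p) := by
  have hle := hpn.le
  obtain ⟨v, hv⟩ := exists_base hp hle
  choose w hw hw' using fun S : Idx n p => exists_pt hp hle S (fun _ _ => -1)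
  refine simplyConnected_of_signCharts (ι := Idx n p) (fun S b => WW S (bs b * sg S)) Idx.adj
    adj_symm' (fun S s => isOpen_WW _ _) ?_ ?_ ?_ ?_ v ?_ w hw ?_ ?_ adj_nbrs ?_ ?_
  · intro S s
    obtain ⟨Φ, h1, h2, Ψ, h3, h4⟩ := exists_chart hp hle S _ (bsg_sq S s)
    have hne : (KK S).Nonempty := by
      obtain ⟨Y, hY, -⟩ := vand_normal S
      exact ⟨_, one_mem_KK S Y hY⟩
    have : ContractibleSpace (KK S) := (KK_convex S).contractibleSpace hne
    exact niceSet_of_chart _ Φ h1 Ψ h3 h4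
  · intro S y h1 h2
    simp only [WW, bs, Set.mem_ofPred_eq] at h1 h2
    simp at h1 h2
    linarith
  · intro y
    obtain ⟨A, -, -, S, hS⟩ := y.factor hp hle
    exact ⟨S, mem_WW_of_ne S y hS⟩
  · intro S T hST s t
    exact WW_joined hp hle S T hST _ _ (bsg_sq S s)
  · intro S
    have := hv S
    simpa [bs] using this
  · rintro S T ⟨i, hi, j, hj, hT⟩
    obtain ⟨a, rfl⟩ := exists_emb S hi
    obtain ⟨c, hc, h⟩ := hw' S T j a hj hT
    simp only [WW, bs, Set.mem_ofPred_eq]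
    simp
    rw [h]
    linarith
  · intro S
    obtain ⟨i, hi⟩ := exists_mem_idx hp S
    obtain ⟨j, hj⟩ := exists_notMem_idx hpn S
    obtain ⟨T, hT⟩ := exists_idx_swap S hi hj
    exact ⟨T, i, hi, j, hj, hT⟩
  · rintro S T ⟨i, hi, j, hj, hT⟩
    obtain ⟨a, rfl⟩ := exists_emb S hi
    obtain ⟨L, hTL, i', hi', j', hj', hL, hne⟩ := adj_tri hn S T hi hj hT
    obtain ⟨a', rfl⟩ := exists_emb S hi'
    obtain ⟨y, hy, hy'⟩ := exists_pt hp hle S (fun k b => if k = j ∧ b = a then 1 else -1)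
    refine ⟨L, ⟨_, hi', j', hj', hL⟩, hTL, y, hy, ?_, ?_⟩
    · obtain ⟨c, hc, h⟩ := hy' T j a hj hT
      simp at h
      simp only [WW, bs, Set.mem_ofPred_eq]
      simp
      rw [h]
      linarith
    · obtain ⟨c, hc, h⟩ := hy' L j' a' hj' hL
      have : ¬ (j' = j ∧ a' = a) := by
        rintro ⟨rfl, rfl⟩; exact hne ⟨rfl, rfl⟩
      rw [if_neg this] at h
      simp only [WW, bs, Set.mem_ofPred_eq]
      simp
      rw [h]
      linarith
  · intro y S T s t h1 h2
    exact exchange hp hle y _ S T rfl (ne_of_mem_WW h1) (ne_of_mem_WW h2)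

end SC
section Cover

theorem unit_sq (g : ℤˣ) : ((g : ℤ) : ℝ) * ((g : ℤ) : ℝ) = 1 := by
  rcases Int.units_eq_one_or g with h | h <;> simp [h]

noncomputable instance (n p : ℕ) : MulAction ℤˣ (EE n p) where
  smul g e := ⟨(e.z, fun I => ((g : ℤ) : ℝ) * e.om I), fun I J => by
    have h1 := unit_sq g
    have h2 := e.rel I J
    simp only
    rw [← h2]
    linear_combination (e.om I * e.om J) * h1⟩
  one_smul e := by
    apply EE.ext'
    · rfl
    · ext I
      change (((1 : ℤˣ) : ℤ) : ℝ) * e.om I = _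
      simp
  mul_smul g h e := by
    apply EE.ext'
    · rfl
    · ext I
      change (((g * h : ℤˣ) : ℤ) : ℝ) * e.om I = ((g : ℤ) : ℝ) * (((h : ℤ) : ℝ) * e.om I)
      push_cast
      ring

theorem EE.smul_z {n p : ℕ} (g : ℤˣ) (e : EE n p) : (g • e).z = e.z := rfl
theorem EE.smul_om {n p : ℕ} (g : ℤˣ) (e : EE n p) (I : Fin p → Fin n) :
    (g • e).om I = ((g : ℤ) : ℝ) * e.om I := rfl

theorem EE.z_surjective {n p : ℕ} (hpn : p ≤ n) : Function.Surjective (EE.z : EE n p → _) := by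
  intro z
  obtain ⟨A, hA, -⟩ := cone_factor hpn (reM z.1) z.2.2
  exact ⟨⟨(z, fun I => (A.submatrix I id).det), fun I J => by
    simp only; rw [hA, det_mul_transpose_submatrix]⟩, rfl⟩

theorem EE.isOpenMap_z {n p : ℕ} (hp : 0 < p) (hpn : p ≤ n) : IsOpenMap (EE.z : EE n p → _) := by
  classical
  apply IsOpenMap.of_sections
  intro e
  obtain ⟨A, -, -, S, hS⟩ := e.factor hp hpn
  let dd : sigTube n p 0 → ℝ := fun z => ((reM z.1).submatrix (emb S) (emb S)).det
  have hdd : Continuous dd := by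
    apply Continuous.matrix_det
    exact (continuous_reM.comp continuous_subtype_val).matrix_submatrix _ _
  let s : ℝ := if 0 < e.om (emb S) then 1 else -1
  have hs : s * s = 1 := by simp only [s]; split_ifs <;> norm_num
  have hs' : s * e.om (emb S) = |e.om (emb S)| := by
    simp only [s]
    split_ifs with h
    · rw [abs_of_pos h, one_mul]
    · rw [abs_of_nonpos (not_lt.1 h)]; ring
  let f : sigTube n p 0 → (Fin p → Fin n) → ℝ := fun z I =>
    s * ((reM z.1).submatrix I (emb S)).det / √(dd z)
  have hf : ∀ z, 0 < dd z → ∀ I J, f z I * f z J = ((reM z.1).submatrix I J).det := by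
    intro z hz I J
    obtain ⟨B, hB, -⟩ := cone_factor hpn (reM z.1) z.2.2
    have hsq : √(dd z) ≠ 0 := (Real.sqrt_pos.2 hz).ne'
    have hsq2 : √(dd z) * √(dd z) = dd z := Real.mul_self_sqrt hz.le
    simp only [f]
    rw [div_mul_div_comm, hsq2, div_eq_iff hz.ne']
    simp only [dd]
    rw [hB]
    simp only [det_mul_transpose_submatrix]
    linear_combination ((B.submatrix I id).det * (B.submatrix J id).det *
      (B.submatrix (emb S) id).det ^ 2) * hs
  have hee : dd e.z = e.om (emb S) * e.om (emb S) := (e.rel _ _).symm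
  have he : 0 < dd e.z := by
    rw [hee]; exact mul_self_pos.2 hS
  choose r hr using EE.z_surjective hpn
  let g : sigTube n p 0 → EE n p := fun z =>
    if h : 0 < dd z then ⟨(z, f z), hf z h⟩ else r z
  have hg : ∀ z (h : 0 < dd z), g z = ⟨(z, f z), hf z h⟩ := fun z h => dif_pos h
  refine ⟨g, ?_, ?_, ?_⟩
  · have hind : Topology.IsInducing (Subtype.val : EE n p → sigTube n p 0 × ((Fin p → Fin n) → ℝ)) :=
      Topology.IsInducing.subtypeVal
    refine hind.continuousAt_iff.2 ?_
    have hev : (fun z => (z, f z)) =ᶠ[nhds e.z] (Subtype.val ∘ g) := by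
      have := (isOpen_lt continuous_const hdd).mem_nhds he
      filter_upwards [this] with z hz
      simp only [Function.comp]
      rw [hg z hz]
    refine ContinuousAt.congr ?_ hev
    refine continuousAt_id.prodMk ?_
    rw [continuousAt_pi]
    intro I
    refine ContinuousAt.div ?_ ?_ (Real.sqrt_pos.2 he).ne'
    · apply Continuous.continuousAt
      refine continuous_const.mul ?_
      apply Continuous.matrix_det
      exact (continuous_reM.comp continuous_subtype_val).matrix_submatrix _ _
    · exact (Real.continuous_sqrt.comp hdd).continuousAt
  · rw [hg _ he]
    apply EE.ext'
    · rfl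
    · ext I
      change s * ((reM e.z.1).submatrix I (emb S)).det / √(dd e.z) = e.om I
      rw [hee, Real.sqrt_mul_self_eq_abs, ← e.rel, div_eq_iff (abs_pos.2 hS).ne', ← hs']
      ring
  · intro z
    by_cases h : 0 < dd z
    · rw [hg z h]; rfl
    · have : g z = r z := dif_neg h
      rw [this]
      exact hr z

theorem EE.cover {n p : ℕ} (hp : 0 < p) (hpn : p ≤ n) :
    IsQuotientCoveringMap (EE.z : EE n p → sigTube n p 0) ℤˣ where
  toIsQuotientMap := (EE.isOpenMap_z hp hpn).isQuotientMap EE.continuous_z (EE.z_surjective hpn)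
  continuous_const_smul g := by
    refine Continuous.subtype_mk (EE.continuous_z.prodMk ?_) _
    exact continuous_pi fun I => continuous_const.mul (EE.continuous_om' I)
  apply_eq_iff_mem_orbit := by
    intro e₁ e₂
    constructor
    · intro h
      have := eq_or_eq_neg_of_products e₁.om e₂.om (fun I J => by rw [e₁.rel, e₂.rel, h])
      rcases this with h' | h'
      · exact ⟨1, by simpa using (EE.ext' h h').symm⟩
      · have h3 : e₁ = (-1 : ℤˣ) • e₂ := by
          refine EE.ext' h ?_
          ext I
          change _ = (((-1 : ℤˣ) : ℤ) : ℝ) * e₂.om I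
          rw [h']
          simp
        exact ⟨-1, h3.symm⟩
    · rintro ⟨g, rfl⟩
      rfl
  disjoint e := by
    obtain ⟨A, -, -, S, hS⟩ := e.factor hp hpn
    refine ⟨{e' | 0 < e'.om (emb S) * e.om (emb S)}, ?_, ?_⟩
    · refine (isOpen_lt continuous_const ((EE.continuous_om' _).mul continuous_const)).mem_nhds ?_
      change 0 < e.om (emb S) * e.om (emb S)
      exact mul_self_pos.2 hS
    · rintro g ⟨_, ⟨e', h1, rfl⟩, h2⟩
      rcases Int.units_eq_one_or g with h | h
      · exact h
      · exfalso
        subst h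
        change 0 < e'.om (emb S) * e.om (emb S) at h1
        change 0 < ((((-1 : ℤˣ) : ℤ) : ℝ) * e'.om (emb S)) * e.om (emb S) at h2
        simp at h2
        linarith

end Cover

/-- For `n ≥ 3` and `0 < p < n`, the tube manifold `𝒯_{p,0}` is path-connected with
fundamental group `ℤ/2`. -/
theorem tube_fundamentalGroup_z2 (n p : ℕ) (hn : 3 ≤ n) (hp : 0 < p) (hpn : p < n) :
    PathConnectedSpace (sigTube n p 0) ∧
    ∀ x : sigTube n p 0,
      Nonempty (FundamentalGroup (sigTube n p 0) x ≃* Multiplicative (ZMod 2)) := by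
  have hsc := EE_simplyConnected hn hp hpn
  have hsurj := EE.z_surjective (n := n) (p := p) hpn.le
  refine ⟨hsurj.pathConnectedSpace EE.continuous_z, fun x => ?_⟩
  obtain ⟨e, he⟩ := hsurj x
  have e1 := (EE.cover (n := n) hp hpn.le).fundamentalGroupEquiv ⟨e, he⟩
  have : Fact (Nat.Prime 2) := ⟨Nat.prime_two⟩
  have c1 : Nat.card (ℤˣᵐᵒᵖ) = 2 := by
    rw [Nat.card_congr MulOpposite.opEquiv.symm, Nat.card_eq_fintype_card]; rfl
  have c2 : Nat.card (Multiplicative (ZMod 2)) = 2 := by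
    rw [Nat.card_congr Multiplicative.toAdd, Nat.card_zmod]
  exact ⟨e1.trans (mulEquivOfPrimeCardEq c1 c2)⟩
end
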